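/- There is an absolute constant c > 0 with the following property. Let P ⊆ ℝ² be a finite set with |P| = N ≥ 2 such that not all points of P lie on a single horizontal line and not all points of P lie on a single vertical line. Then |R(P)| ≥ c·N/log N. -/

import Mathlib

/-- The rectangular area determined by two points of the plane. -/
noncomputable def rectArea (p q : ℝ × ℝ) : ℝ := (q.1 - p.1) * (q.2 - p.2)

namespace RectAreas

open MvPolynomial Filter Topology

abbrev Pt := ℝ × ℝ
abbrev Line := Pt × Pt
abbrev P3 := MvPolynomial (Fin 3) ℝ

/-- The point with parameter `t` on the line of transformations mapping `l.1` to `l.2`. -/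
def pt (l : Line) (t : ℝ) : Fin 3 → ℝ := ![t, l.2.1 - l.1.1 * t, l.2.2 * t - l.1.2]

/-- Restriction of polynomials to a line. -/
noncomputable def restr (l : Line) : P3 →ₐ[ℝ] Polynomial ℝ :=
  aeval ![Polynomial.X, Polynomial.C l.2.1 - Polynomial.C l.1.1 * Polynomial.X,
    Polynomial.C l.2.2 * Polynomial.X - Polynomial.C l.1.2]

lemma eval_restr (l : Line) (f : P3) (t : ℝ) : (restr l f).eval t = eval (pt l t) f := by
  have : ((Polynomial.aeval t).comp (restr l)) = (aeval (pt l t) : P3 →ₐ[ℝ] ℝ) := by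
    apply MvPolynomial.algHom_ext
    intro i
    fin_cases i <;> simp [restr, pt]
  have h := DFunLike.congr_fun this f
  simpa [Polynomial.coe_aeval_eq_eval, MvPolynomial.coe_aeval_eq_eval] using h

lemma natDegree_restr_le (l : Line) (f : P3) : (restr l f).natDegree ≤ f.totalDegree := by
  have := aeval_natDegree_le f le_rfl ![Polynomial.X, Polynomial.C l.2.1 - Polynomial.C l.1.1 * Polynomial.X,
    Polynomial.C l.2.2 * Polynomial.X - Polynomial.C l.1.2] (n := 1) (by
      intro i
      fin_cases i
      · simp
      · simp; compute_degree
      · simp; compute_degree)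
  simpa [restr] using this

lemma finrank_eq_inf_ker_add_map {E F : Type*} [AddCommGroup E] [Module ℝ E] [AddCommGroup F]
    [Module ℝ F] (φ : E →ₗ[ℝ] F) (V : Submodule ℝ E) [FiniteDimensional ℝ V] :
    Module.finrank ℝ V =
      Module.finrank ℝ (V.map φ) + Module.finrank ℝ (V ⊓ LinearMap.ker φ : Submodule ℝ E) := by
  rw [← LinearMap.finrank_range_add_finrank_ker (φ.domRestrict V)]
  congr 1
  · rw [LinearMap.range_domRestrict]
  · rw [LinearMap.ker_domRestrict]
    have := (Submodule.equivSubtypeMap V (Submodule.comap V.subtype (LinearMap.ker φ))).finrank_eq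
    rw [this, Submodule.map_comap_subtype]

/-- Polynomials of degree at most `t`. -/
noncomputable abbrev W (t : ℕ) : Submodule ℝ P3 := restrictTotalDegree (Fin 3) ℝ t

lemma mem_W {t : ℕ} {f : P3} : f ∈ W t ↔ f.totalDegree ≤ t := mem_restrictTotalDegree _ _ _

instance (t : ℕ) : FiniteDimensional ℝ (W t) := by
  unfold W; infer_instance

/-- Polynomials of degree at most `t` vanishing on all the lines of `S`. -/
noncomputable def V (t : ℕ) (S : Finset Line) : Submodule ℝ P3 :=
  W t ⊓ ⨅ l ∈ S, LinearMap.ker (restr l).toLinearMap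

lemma mem_V {t : ℕ} {S : Finset Line} {f : P3} :
    f ∈ V t S ↔ f.totalDegree ≤ t ∧ ∀ l ∈ S, restr l f = 0 := by
  simp [V, mem_W]

instance (t : ℕ) (S : Finset Line) : FiniteDimensional ℝ (V t S) :=
  Submodule.finiteDimensional_of_le (inf_le_left : V t S ≤ W t)

lemma V_empty (t : ℕ) : V t ∅ = W t := by simp [V]

open Classical in
lemma V_insert (t : ℕ) (S : Finset Line) (l : Line) :
    V t (insert l S) = V t S ⊓ LinearMap.ker (restr l).toLinearMap := by
  ext f; simp [mem_V]; tauto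

lemma finrank_degreeLT (n : ℕ) : Module.finrank ℝ (Polynomial.degreeLT ℝ n) = n := by
  rw [(Polynomial.degreeLTEquiv ℝ n).finrank_eq]; simp

instance (n : ℕ) : FiniteDimensional ℝ (Polynomial.degreeLT ℝ n) :=
  Module.Finite.equiv (Polynomial.degreeLTEquiv ℝ n).symm

/-- The separating linear forms. -/
lemma exists_sep {l l' : Line} (h : l ≠ l') :
    ∃ g : P3, g.totalDegree ≤ 1 ∧ restr l' g = 0 ∧ restr l g ≠ 0 := by
  by_cases h1 : restr l (X 1 - C l'.2.1 + C l'.1.1 * X 0) = 0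
  · refine ⟨X 2 - C l'.2.2 * X 0 + C l'.1.2, ?_, ?_, ?_⟩
    · refine (totalDegree_add _ _).trans (max_le ((totalDegree_sub _ _).trans (max_le ?_ ?_)) ?_)
      · simp
      · refine (totalDegree_mul _ _).trans ?_; simp
      · simp
    · simp [restr, Polynomial.C_eq_algebraMap]
    · intro h2
      apply h
      have e0 := congrArg (Polynomial.eval 0) h1
      have e1 := congrArg (Polynomial.eval 1) h1
      have e2 := congrArg (Polynomial.eval 0) h2
      have e3 := congrArg (Polynomial.eval 1) h2
      simp only [eval_restr] at e0 e1 e2 e3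
      simp [pt] at e0 e1 e2 e3
      ext <;> linarith
  · refine ⟨_, ?_, ?_, h1⟩
    · refine (totalDegree_add _ _).trans (max_le ((totalDegree_sub _ _).trans (max_le ?_ ?_)) ?_)
      · simp
      · simp
      · refine (totalDegree_mul _ _).trans ?_; simp
    · simp [restr]

lemma exists_sep_prod (S : Finset Line) (l : Line) (h : l ∉ S) :
    ∃ g : P3, g.totalDegree ≤ S.card ∧ (∀ l' ∈ S, restr l' g = 0) ∧ restr l g ≠ 0 := by
  classical
  induction S using Finset.induction_on with
  | empty => exact ⟨1, by simp, by simp, by simp⟩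
  | insert a S ha ih =>
    rw [Finset.mem_insert, not_or] at h
    obtain ⟨g, h1, h2, h3⟩ := ih h.2
    obtain ⟨g', h1', h2', h3'⟩ := exists_sep h.1
    refine ⟨g' * g, ?_, ?_, ?_⟩
    · rw [Finset.card_insert_of_notMem ha]
      have := totalDegree_mul g' g
      omega
    · intro l' hl'
      rw [map_mul]
      rcases Finset.mem_insert.1 hl' with rfl | hl'
      · rw [h2', zero_mul]
      · rw [h2 _ hl', mul_zero]
    · rw [map_mul]
      exact mul_ne_zero h3' h3

lemma exists_restr_eq (l : Line) (g : Polynomial ℝ) (n : ℕ) (hg : g.natDegree ≤ n) :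
    ∃ f : P3, f.totalDegree ≤ n ∧ restr l f = g := by
  refine ⟨Polynomial.aeval (X 0) g, ?_, ?_⟩
  · rw [Polynomial.aeval_eq_sum_range]
    refine (totalDegree_finsetSum _ _).trans (Finset.sup_le fun i hi => ?_)
    refine (totalDegree_smul_le _ _).trans ?_
    refine (totalDegree_pow _ _).trans ?_
    simp at hi ⊢; omega
  · rw [← Polynomial.aeval_algHom_apply]
    have : restr l (X 0) = Polynomial.X := by simp [restr]
    rw [this]; simp

open Classical in
lemma finrank_V_insert_le (t : ℕ) (S : Finset Line) (l : Line) (h : l ∉ S) :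
    Module.finrank ℝ (V t (insert l S)) + (t + 1 - S.card) ≤ Module.finrank ℝ (V t S) := by
  rw [finrank_eq_inf_ker_add_map (restr l).toLinearMap (V t S), V_insert, add_comm]
  gcongr
  obtain ⟨g, hg1, hg2, hg3⟩ := exists_sep_prod S l h
  have hinj : Function.Injective (LinearMap.mulLeft ℝ (restr l g)) :=
    fun a b hab => mul_left_cancel₀ hg3 hab
  rw [← finrank_degreeLT (t + 1 - S.card),
    (Submodule.equivMapOfInjective _ hinj _).finrank_eq]
  apply Submodule.finrank_mono
  rintro _ ⟨x, hx, rfl⟩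
  by_cases hts : S.card ≤ t
  · have hx' : x.natDegree ≤ t - S.card := by
      have := Polynomial.mem_degreeLT.1 hx
      rw [Polynomial.natDegree_le_iff_degree_le]
      rw [Nat.sub_add_comm hts] at this
      exact Order.le_of_lt_succ (by exact_mod_cast this)
    obtain ⟨f, hf, hfx⟩ := exists_restr_eq l x _ hx'
    refine ⟨g * f, ?_, by simp [hfx]⟩
    rw [SetLike.mem_coe, mem_V]
    refine ⟨(totalDegree_mul _ _).trans (by omega), fun l' hl' => by simp [hg2 l' hl']⟩
  · have : t + 1 - S.card = 0 := by omega
    rw [this] at hx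
    have : x = 0 := by simpa [Polynomial.mem_degreeLT] using hx
    simp [this]

open Classical in
/-- Adding a line through many points where the polynomials already vanish costs little. -/
lemma finrank_V_le_insert (t : ℕ) (S : Finset Line) (l : Line) (T : Finset ℝ)
    (hT : ∀ x ∈ T, ∃ l' ∈ S, ∃ y, pt l' y = pt l x) :
    Module.finrank ℝ (V t S) ≤ Module.finrank ℝ (V t (insert l S)) + (t + 1 - T.card) := by
  rw [finrank_eq_inf_ker_add_map (restr l).toLinearMap (V t S), V_insert, add_comm]
  gcongr
  set π : Polynomial ℝ := ∏ x ∈ T, (Polynomial.X - Polynomial.C x) with hπ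
  have key : (V t S).map (restr l).toLinearMap ≤
      (Polynomial.degreeLT ℝ (t + 1 - T.card)).map (LinearMap.mulLeft ℝ π) := by
    rintro _ ⟨f, hf, rfl⟩
    rw [SetLike.mem_coe, mem_V] at hf
    have hdvd : π ∣ restr l f := by
      apply Finset.prod_dvd_of_coprime
      · intro x _ y _ hxy
        exact Polynomial.isCoprime_X_sub_C_of_isUnit_sub (sub_ne_zero.2 hxy).isUnit
      · intro x hx
        rw [Polynomial.dvd_iff_isRoot, Polynomial.IsRoot, eval_restr]
        obtain ⟨l', hl', y, hy⟩ := hT x hx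
        rw [← hy, ← eval_restr, hf.2 l' hl']; simp
    obtain ⟨g, hg⟩ := hdvd
    refine ⟨g, ?_, by simp [hg]⟩
    rw [SetLike.mem_coe, Polynomial.mem_degreeLT]
    by_cases hg0 : g = 0
    · simp [hg0]
    have hπ1 : π.Monic := Polynomial.monic_prod_of_monic _ _ fun x _ => Polynomial.monic_X_sub_C x
    have hd : π.natDegree = T.card := by simp [hπ, Polynomial.natDegree_prod_of_monic, Polynomial.monic_X_sub_C]
    have h1 := natDegree_restr_le l f
    rw [hg, hπ1.natDegree_mul' hg0, hd] at h1
    rw [Polynomial.degree_eq_natDegree hg0]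
    have := hf.1
    have : g.natDegree < t + 1 - T.card := by omega
    exact_mod_cast this
  calc _ ≤ _ := Submodule.finrank_mono key
    _ ≤ _ := Submodule.finrank_map_le _ _
    _ = _ := finrank_degreeLT _

lemma card_degree_le (t : ℕ) :
    6 * (((Finset.range (t + 1)).biUnion
      fun j => (Finset.univ : Finset (Fin 3)).finsuppAntidiag j).card) =
      (t + 1) * (t + 2) * (t + 3) := by
  rw [Finset.card_biUnion]
  · induction t with
    | zero => simp
    | succ n ih =>
      rw [Finset.sum_range_succ, mul_add, ih, Finset.card_finsuppAntidiag_nat_eq_choose]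
      have h : (Finset.card (Finset.univ : Finset (Fin 3)) + (n + 1) - 1).choose (n + 1)
          = (n + 3).choose 2 := by
        simp only [Finset.card_univ, Fintype.card_fin]
        rw [show 3 + (n + 1) - 1 = n + 3 by omega, Nat.choose_symm_of_eq_add (show n + 3 = (n + 1) + 2 by omega)]
      rw [h]
      have h2 := Nat.choose_two_right (n + 3)
      have h3 : 2 * (n + 3).choose 2 = (n + 3) * (n + 2) := by
        rw [h2, Nat.mul_div_cancel']
        · simp
        · exact even_iff_two_dvd.1 (Nat.even_mul_pred_self (n + 3))
      nlinarith
  · intro i _ j _ hij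
    rw [Function.onFun, Finset.disjoint_left]
    intro x hx hy
    simp at hx hy
    omega

lemma finrank_W (t : ℕ) : 6 * Module.finrank ℝ (W t) = (t + 1) * (t + 2) * (t + 3) := by
  rw [← card_degree_le]
  congr 1
  have := Module.finrank_eq_nat_card_basis (basisRestrictSupport ℝ {n : Fin 3 →₀ ℕ | (n.sum fun _ e => e) ≤ t})
  rw [W, restrictTotalDegree, this, Nat.card_coe_set_eq, ← Set.ncard_coe_finset]
  congr 1
  ext n
  simp [Finsupp.sum_fintype]

open Classical in
lemma finrank_V_add_le (t : ℕ) (S : Finset Line) :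
    (Module.finrank ℝ (V t S) : ℝ) + S.card * (t + 1) - (S.card : ℝ) ^ 2 ≤
      Module.finrank ℝ (W t) := by
  induction S using Finset.induction_on with
  | empty => rw [V_empty]; simp
  | insert l S hl ih =>
    have h := finrank_V_insert_le t S l hl
    have h' : ((Module.finrank ℝ (V t (insert l S)) : ℕ) : ℝ) + (t + 1 - S.card) ≤
        Module.finrank ℝ (V t S) := by
      have h1 : ((t + 1 : ℕ) : ℝ) - S.card ≤ ((t + 1 - S.card : ℕ) : ℝ) := by
        rw [sub_le_iff_le_add]; norm_cast; omega
      have h2 : ((Module.finrank ℝ (V t (insert l S)) + (t + 1 - S.card) : ℕ) : ℝ) ≤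
        Module.finrank ℝ (V t S) := by exact_mod_cast h
      push_cast at h1 h2
      linarith
    rw [Finset.card_insert_of_notMem hl]
    push_cast
    nlinarith [(Nat.cast_nonneg S.card : (0 : ℝ) ≤ S.card)]

lemma totalDegree_le_of_dvd {f g : P3} (h : f ∣ g) (hg : g ≠ 0) :
    f.totalDegree ≤ g.totalDegree := by
  obtain ⟨k, rfl⟩ := h
  rw [totalDegree_mul_of_isDomain (left_ne_zero_of_mul hg) (right_ne_zero_of_mul hg)]
  omega

/-- Two surfaces without common component share at most `deg f * deg h` lines. -/
lemma card_lines_le {f h : P3} (hf : Irreducible f) (hfh : ¬ f ∣ h) (S : Finset Line)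
    (h1 : ∀ l ∈ S, restr l f = 0) (h2 : ∀ l ∈ S, restr l h = 0) :
    S.card ≤ f.totalDegree * h.totalDegree := by
  set d := f.totalDegree with hd
  set e := h.totalDegree with he
  have hf0 : f ≠ 0 := hf.ne_zero
  have hh0 : h ≠ 0 := by rintro rfl; exact hfh (dvd_zero f)
  have hprime : Prime f := hf.prime
  by_contra! hcon
  obtain ⟨S', hS', hcard⟩ := Finset.exists_subset_card_eq (Nat.succ_le_of_lt hcon)
  set m := d * e + 1 with hm
  have key : ∀ t : ℕ, d + e ≤ t → Module.finrank ℝ (W (t - d)) + Module.finrank ℝ (W (t - e)) ≤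
      Module.finrank ℝ (V t S') + Module.finrank ℝ (W (t - d - e)) := by
    intro t ht
    have injf : Function.Injective (LinearMap.mulLeft ℝ f) :=
      fun a b hab => mul_left_cancel₀ hf0 hab
    have injh : Function.Injective (LinearMap.mulLeft ℝ h) :=
      fun a b hab => mul_left_cancel₀ hh0 hab
    have injfh : Function.Injective (LinearMap.mulLeft ℝ (f * h)) :=
      fun a b hab => mul_left_cancel₀ (mul_ne_zero hf0 hh0) hab
    rw [(Submodule.equivMapOfInjective _ injf (W (t - d))).finrank_eq,
      (Submodule.equivMapOfInjective _ injh (W (t - e))).finrank_eq,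
      (Submodule.equivMapOfInjective _ injfh (W (t - d - e))).finrank_eq,
      ← Submodule.finrank_sup_add_finrank_inf_eq]
    gcongr
    · apply Submodule.finrank_mono
      refine sup_le ?_ ?_
      · rintro _ ⟨x, hx, rfl⟩
        have hx := mem_W.1 hx
        rw [mem_V]
        refine ⟨(totalDegree_mul _ _).trans (by omega), fun l hl => ?_⟩
        simp [h1 l (hS' hl)]
      · rintro _ ⟨x, hx, rfl⟩
        have hx := mem_W.1 hx
        rw [mem_V]
        refine ⟨(totalDegree_mul _ _).trans (by omega), fun l hl => ?_⟩
        simp [h2 l (hS' hl)]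
    · apply Submodule.finrank_mono
      rintro _ ⟨⟨x, hx, rfl⟩, ⟨y, hy, hxy⟩⟩
      have hx := mem_W.1 hx
      have hy := mem_W.1 hy
      simp only [LinearMap.mulLeft_apply] at hxy
      have : f ∣ h * y := ⟨x, hxy⟩
      obtain ⟨c, rfl⟩ := (hprime.dvd_or_dvd this).resolve_left hfh
      refine ⟨c, ?_, ?_⟩
      · rw [SetLike.mem_coe, mem_W]
        by_cases hc : c = 0
        · simp [hc]
        · rw [totalDegree_mul_of_isDomain hf0 hc] at hy
          omega
      · have : x = h * c := by
          apply mul_left_cancel₀ hf0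
          rw [← hxy]; ring
        simp [this]
  set t := d + e + m * m + d * e with ht
  have k1 := key t (by omega)
  have k2 := finrank_V_add_le t S'
  have n1 := finrank_W t
  have n2 := finrank_W (t - d)
  have n3 := finrank_W (t - e)
  have n4 := finrank_W (t - d - e)
  have c1 : ((t - d : ℕ) : ℝ) = t - d := by rw [Nat.cast_sub (by omega)]
  have c2 : ((t - e : ℕ) : ℝ) = t - e := by rw [Nat.cast_sub (by omega)]
  have c3 : ((t - d - e : ℕ) : ℝ) = t - d - e := by
    rw [Nat.cast_sub (by omega), Nat.cast_sub (by omega)]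
  have n1' : (6 : ℝ) * Module.finrank ℝ (W t) = (t + 1) * (t + 2) * (t + 3) := by exact_mod_cast n1
  have n2' : (6 : ℝ) * Module.finrank ℝ (W (t - d)) =
      ((t - d) + 1) * ((t - d) + 2) * ((t - d) + 3) := by rw [← c1]; exact_mod_cast n2
  have n3' : (6 : ℝ) * Module.finrank ℝ (W (t - e)) =
      ((t - e) + 1) * ((t - e) + 2) * ((t - e) + 3) := by rw [← c2]; exact_mod_cast n3
  have n4' : (6 : ℝ) * Module.finrank ℝ (W (t - d - e)) =
      ((t - d - e) + 1) * ((t - d - e) + 2) * ((t - d - e) + 3) := by rw [← c3]; exact_mod_cast n4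
  have k1' : (Module.finrank ℝ (W (t - d)) : ℝ) + Module.finrank ℝ (W (t - e)) ≤
      Module.finrank ℝ (V t S') + Module.finrank ℝ (W (t - d - e)) := by exact_mod_cast k1
  rw [hcard] at k2
  have hm' : ((d * e).succ : ℝ) = d * e + 1 := by push_cast; ring
  rw [hm'] at k2
  have ht' : (t : ℝ) = d + e + (d * e + 1) ^ 2 + d * e := by rw [ht, hm]; push_cast; ring
  have : (d * e + 1 : ℝ) * (t + 1) - (d * e + 1 : ℝ) ^ 2 ≤ d * e * (t + 2) - d * e * (d + e) / 2 := by
    nlinarith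
  have p1 : (0 : ℝ) ≤ d := Nat.cast_nonneg d
  have p2 : (0 : ℝ) ≤ e := Nat.cast_nonneg e
  have p3 : (0 : ℝ) ≤ d * e := by positivity
  have p4 : (0 : ℝ) ≤ d * e * (d + e) := by positivity
  nlinarith

/-- Average of the truncated linear function `x ↦ (D + 1 - x)⁺` over `0, …, M`. -/
noncomputable def avgCost (D M : ℕ) : ℝ := (∑ x ∈ Finset.range (M + 1), ((D + 1 - x : ℕ) : ℝ)) / (M + 1)

lemma avgCost_succ (D M : ℕ) :
    (M + 2) * avgCost D (M + 1) = (M + 1) * avgCost D M + ((D + 1 - (M + 1) : ℕ) : ℝ) := by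
  have h1 : (M : ℝ) + 1 ≠ 0 := by positivity
  have h2 : (M : ℝ) + 1 + 1 ≠ 0 := by positivity
  unfold avgCost
  rw [Finset.sum_range_succ (n := M + 1)]
  push_cast
  field_simp
  ring

lemma avgCost_rec (D M : ℕ) :
    (M + 1) * avgCost D M = M * avgCost D (M - 1) + ((D + 1 - M : ℕ) : ℝ) := by
  cases M with
  | zero => simp [avgCost]
  | succ M =>
    have := avgCost_succ D M
    push_cast at this ⊢
    linarith

lemma sum_range_le (D M : ℕ) :
    (∑ x ∈ Finset.range M, ((D + 1 - x : ℕ) : ℝ)) ≤ (D + 1) * (D + 2) / 2 := by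
  have h : ∀ D : ℕ, (∑ x ∈ Finset.range (D + 1), ((D + 1 - x : ℕ) : ℝ)) = (D + 1) * (D + 2) / 2 := by
    intro D
    induction D with
    | zero => simp
    | succ D ih =>
      rw [Finset.sum_range_succ']
      simp only [Nat.add_sub_add_right]
      rw [ih]; push_cast; ring
  rw [← h D]
  rcases le_total M (D + 1) with hM | hM
  · exact Finset.sum_le_sum_of_subset_of_nonneg (Finset.range_mono hM) (fun _ _ _ => by positivity)
  · apply le_of_eq
    symm
    apply Finset.sum_subset (Finset.range_mono hM)
    intro x _ hx
    simp at hx ⊢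
    omega

lemma avgCost_le {D M m : ℕ} (h : m ≤ M) : avgCost D M ≤ (D + 1) * (D + 2) / (2 * (m + 1)) := by
  unfold avgCost
  rw [div_le_div_iff₀ (by positivity) (by positivity)]
  have h1 := sum_range_le D (M + 1)
  have h2 : (m : ℝ) ≤ M := by exact_mod_cast h
  calc _ ≤ ((D + 1) * (D + 2) / 2 : ℝ) * (2 * (m + 1)) := by gcongr
    _ = (D + 1) * (D + 2) * (m + 1) := by ring
    _ ≤ _ := by gcongr

open Classical in
lemma exists_cheap (D : ℕ) (Par : Line → Finset Line) (hPar : ∀ l, l ∉ Par l)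
    (S : Finset Line) (hS : S.Nonempty) :
    ∃ l ∈ S, ((D + 1 - (Par l ∩ S).card : ℕ) : ℝ) +
      ∑ l' ∈ S.erase l, avgCost D (Par l' ∩ S.erase l).card ≤
      ∑ l' ∈ S, avgCost D (Par l' ∩ S).card := by
  apply Finset.exists_le_of_sum_le hS
  rw [Finset.sum_add_distrib, Finset.sum_const, nsmul_eq_mul, Finset.mul_sum]
  have hswap : ∑ l ∈ S, ∑ l' ∈ S.erase l, avgCost D (Par l' ∩ S.erase l).card =
      ∑ l' ∈ S, ∑ l ∈ S.erase l', avgCost D (Par l' ∩ S.erase l).card := by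
    apply Finset.sum_comm'
    intro x y
    simp only [Finset.mem_erase]
    tauto
  rw [hswap, ← Finset.sum_add_distrib]
  apply le_of_eq
  apply Finset.sum_congr rfl
  intro l' hl'
  set M := (Par l' ∩ S).card with hM
  have hsub : Par l' ∩ S ⊆ S.erase l' := by
    intro x hx
    rw [Finset.mem_inter] at hx
    exact Finset.mem_erase.2 ⟨fun e => hPar l' (e ▸ hx.1), hx.2⟩
  have hsplit : ∑ l ∈ S.erase l', avgCost D (Par l' ∩ S.erase l).card =
      M * avgCost D (M - 1) + ((S.card : ℝ) - 1 - M) * avgCost D M := by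
    rw [← Finset.sum_sdiff hsub]
    have e1 : ∀ l ∈ Par l' ∩ S, avgCost D (Par l' ∩ S.erase l).card = avgCost D (M - 1) := by
      intro l hl
      rw [Finset.inter_erase, Finset.card_erase_of_mem hl]
    have e2 : ∀ l ∈ S.erase l' \ (Par l' ∩ S), avgCost D (Par l' ∩ S.erase l).card =
        avgCost D M := by
      intro l hl
      rw [Finset.inter_erase, Finset.erase_eq_of_notMem]
      exact (Finset.mem_sdiff.1 hl).2
    rw [Finset.sum_congr rfl e1, Finset.sum_congr rfl e2, Finset.sum_const, Finset.sum_const,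
      Finset.card_sdiff_of_subset hsub, Finset.card_erase_of_mem hl', nsmul_eq_mul, nsmul_eq_mul]
    have h1 : M ≤ S.card - 1 := by
      rw [← Finset.card_erase_of_mem hl']; exact Finset.card_le_card hsub
    have h2 : 1 ≤ S.card := Finset.card_pos.2 hS
    rw [Nat.cast_sub h1, Nat.cast_sub h2]
    push_cast; ring
  rw [hsplit]
  have := avgCost_rec D M
  linarith

open Classical in
lemma finrank_W_le (D : ℕ) (Par : Line → Finset Line) (hPar : ∀ l, l ∉ Par l)
    (τ : Line → Line → ℝ) (hτ : ∀ l, Set.InjOn (τ l) (Par l))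
    (hmeet : ∀ l, ∀ l' ∈ Par l, ∃ y, pt l' y = pt l (τ l l')) (S : Finset Line) :
    (Module.finrank ℝ (W D) : ℝ) ≤
      Module.finrank ℝ (V D S) + ∑ l ∈ S, avgCost D (Par l ∩ S).card := by
  induction S using Finset.strongInduction with
  | H S ih =>
    rcases S.eq_empty_or_nonempty with rfl | hS
    · rw [V_empty]; simp
    · obtain ⟨l, hl, hcheap⟩ := exists_cheap D Par hPar S hS
      have h1 := ih _ (Finset.erase_ssubset hl)
      have h2 := finrank_V_le_insert D (S.erase l) l ((Par l ∩ S).image (τ l)) (by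
        intro x hx
        obtain ⟨l', hl', rfl⟩ := Finset.mem_image.1 hx
        rw [Finset.mem_inter] at hl'
        exact ⟨l', Finset.mem_erase.2 ⟨fun e => hPar l (e ▸ hl'.1), hl'.2⟩, hmeet l l' hl'.1⟩)
      rw [Finset.insert_erase hl, Finset.card_image_of_injOn
        ((hτ l).mono (by simp))] at h2
      have h2' : (Module.finrank ℝ (V D (S.erase l)) : ℝ) ≤
        Module.finrank ℝ (V D S) + ((D + 1 - (Par l ∩ S).card : ℕ) : ℝ) := by exact_mod_cast h2
      linarith

open Classical in
lemma exists_poly_vanishing (D m : ℕ) (S : Finset Line) (Par : Line → Finset Line)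
    (hPar : ∀ l, l ∉ Par l) (hsub : ∀ l, Par l ⊆ S) (hcard : ∀ l ∈ S, m ≤ (Par l).card)
    (τ : Line → Line → ℝ) (hτ : ∀ l, Set.InjOn (τ l) (Par l))
    (hmeet : ∀ l, ∀ l' ∈ Par l, ∃ y, pt l' y = pt l (τ l l'))
    (hD : 3 * S.card < (D + 3) * (m + 1)) :
    ∃ f : P3, f ≠ 0 ∧ f.totalDegree ≤ D ∧ ∀ l ∈ S, restr l f = 0 := by
  have h1 := finrank_W_le D Par hPar τ hτ hmeet S
  have h2 : ∑ l ∈ S, avgCost D (Par l ∩ S).card ≤ S.card * ((D + 1) * (D + 2) / (2 * (m + 1))) := by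
    rw [← nsmul_eq_mul]
    apply Finset.sum_le_card_nsmul
    intro l hl
    apply avgCost_le
    rw [Finset.inter_eq_left.2 (hsub l)]
    exact hcard l hl
  have h3 : (6 : ℝ) * Module.finrank ℝ (W D) = (D + 1) * (D + 2) * (D + 3) := by
    exact_mod_cast finrank_W D
  have h4 : (S.card : ℝ) * ((D + 1) * (D + 2) / (2 * (m + 1))) < (D + 1) * (D + 2) * (D + 3) / 6 := by
    rw [← mul_div_assoc, div_lt_div_iff₀ (by positivity) (by positivity)]
    have h5 : (3 * S.card : ℝ) < (D + 3) * (m + 1) := by exact_mod_cast hD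
    have h6 : (0 : ℝ) < 2 * ((D + 1) * (D + 2)) := by positivity
    nlinarith [mul_lt_mul_of_pos_left h5 h6]
  have h7 : 0 < Module.finrank ℝ (V D S) := by
    have : (0 : ℝ) < Module.finrank ℝ (V D S) := by linarith
    exact_mod_cast this
  obtain ⟨⟨f, hf⟩, hf0⟩ := Module.finrank_pos_iff_exists_ne_zero.1 h7
  rw [mem_V] at hf
  exact ⟨f, fun e => hf0 (by simpa using e), hf.1, hf.2⟩

lemma totalDegree_pderiv_le (i : Fin 3) (f : P3) :
    (pderiv i f).totalDegree ≤ f.totalDegree - 1 := by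
  refine Finset.sup_le fun m hm => ?_
  rw [mem_support_iff, coeff_pderiv] at hm
  have h1 : m + Finsupp.single i 1 ∈ f.support := by
    rw [mem_support_iff]; exact left_ne_zero_of_mul hm
  have h2 := le_totalDegree h1
  rw [Finsupp.sum_add_index' (by simp) (by simp), Finsupp.sum_single_index rfl] at h2
  omega

lemma derivative_aeval (g : Fin 3 → Polynomial ℝ) (f : P3) :
    Polynomial.derivative (aeval g f) =
      ∑ i, aeval g (pderiv i f) * Polynomial.derivative (g i) := by
  induction f using MvPolynomial.induction_on with
  | C a => simp
  | add p q hp hq => simp [hp, hq, Finset.sum_add_distrib, add_mul]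
  | mul_X p i hp =>
    have h1 : ∀ j, aeval g (pderiv j (p * X i)) * Polynomial.derivative (g j) =
        aeval g (pderiv j p) * Polynomial.derivative (g j) * g i +
          if j = i then aeval g p * Polynomial.derivative (g j) else 0 := by
      intro j
      rw [pderiv_mul, pderiv_X, map_add, map_mul, map_mul, aeval_X]
      by_cases h : j = i
      · subst h
        rw [Pi.single_eq_same, map_one, if_pos rfl]; ring
      · rw [Pi.single_eq_of_ne' h, map_zero, if_neg h]; ring
    rw [Finset.sum_congr rfl fun j _ => h1 j, Finset.sum_add_distrib, ← Finset.sum_mul, ← hp,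
      Finset.sum_ite_eq' Finset.univ i, if_pos (Finset.mem_univ i), map_mul, aeval_X,
      Polynomial.derivative_mul]

/-- Restriction of a polynomial to the parametrized line `σ ↦ x + σ v`. -/
noncomputable def alongLine (x v : Fin 3 → ℝ) : P3 →ₐ[ℝ] Polynomial ℝ :=
  aeval fun i => Polynomial.C (x i) + Polynomial.C (v i) * Polynomial.X

lemma eval_alongLine (x v : Fin 3 → ℝ) (f : P3) (σ : ℝ) :
    (alongLine x v f).eval σ = eval (fun i => x i + v i * σ) f := by
  have : ((Polynomial.aeval σ).comp (alongLine x v)) =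
      (aeval (fun i => x i + v i * σ) : P3 →ₐ[ℝ] ℝ) := by
    apply MvPolynomial.algHom_ext
    intro i
    simp [alongLine]
  have h := DFunLike.congr_fun this f
  rw [AlgHom.comp_apply, Polynomial.coe_aeval_eq_eval] at h
  rw [h, ← MvPolynomial.coe_aeval_eq_eval]
  rfl

lemma derivative_alongLine (x v : Fin 3 → ℝ) (f : P3) :
    Polynomial.derivative (alongLine x v f) =
      ∑ i, Polynomial.C (v i) * alongLine x v (pderiv i f) := by
  rw [alongLine, derivative_aeval]
  apply Finset.sum_congr rfl
  intro i _
  rw [mul_comm]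
  congr 1
  simp

/-- Polynomials in three variables with coefficients polynomial in the slope parameter. -/
abbrev PT := MvPolynomial (Fin 3) (Polynomial ℝ)

noncomputable def emb : P3 →+* PT := MvPolynomial.map Polynomial.C

noncomputable def T : PT := C Polynomial.X

noncomputable def ev (x : Fin 3 → ℝ) (t : ℝ) : PT →+* ℝ :=
  eval₂Hom (Polynomial.evalRingHom t) x

lemma ev_emb (x : Fin 3 → ℝ) (t : ℝ) (f : P3) : ev x t (emb f) = eval x f := by
  have : (ev x t).comp emb = MvPolynomial.eval x := by
    apply MvPolynomial.ringHom_ext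
    · intro r; simp [ev, emb]
    · intro i; simp [ev, emb]
  exact DFunLike.congr_fun this f

@[simp] lemma ev_T (x : Fin 3 → ℝ) (t : ℝ) : ev x t T = t := by simp [ev, T]

/-- The direction tangent to the level surface of `f`, whose base slope is the parameter. -/
noncomputable def dir (f : P3) : Fin 3 → PT :=
  ![emb (pderiv 2 f), -(T * emb (pderiv 2 f)), T * emb (pderiv 1 f) - emb (pderiv 0 f)]

/-- Iterated directional derivative of `g` along the frozen direction `dir f`. -/
noncomputable def iterD (f : P3) : ℕ → P3 → PT
  | 0, g => emb g
  | n + 1, g => ∑ i, dir f i * iterD f n (pderiv i g)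

/-- Numerical version of `dir`. -/
noncomputable def ndir (f : P3) (x : Fin 3 → ℝ) (t : ℝ) : Fin 3 → ℝ :=
  ![eval x (pderiv 2 f), -(t * eval x (pderiv 2 f)), t * eval x (pderiv 1 f) - eval x (pderiv 0 f)]

lemma ev_dir (f : P3) (x : Fin 3 → ℝ) (t : ℝ) (i : Fin 3) : ev x t (dir f i) = ndir f x t i := by
  fin_cases i <;> simp [dir, ndir, ev_emb]

lemma ev_iterD (f : P3) (x : Fin 3 → ℝ) (t : ℝ) (n : ℕ) (g : P3) :
    ev x t (iterD f n g) =
      (Polynomial.derivative^[n] (alongLine x (ndir f x t) g)).eval 0 := by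
  induction n generalizing g with
  | zero => simp [iterD, ev_emb, eval_alongLine]
  | succ n ih =>
    rw [Function.iterate_succ_apply, derivative_alongLine, Polynomial.iterate_derivative_sum,
      Polynomial.eval_finsetSum, iterD, map_sum]
    apply Finset.sum_congr rfl
    intro i _
    rw [map_mul, ih, ev_dir, Polynomial.iterate_derivative_C_mul]
    simp

lemma alongLine_eq_zero_iff (f : P3) (x : Fin 3 → ℝ) (t : ℝ) (g : P3) :
    alongLine x (ndir f x t) g = 0 ↔ ∀ n, ev x t (iterD f n g) = 0 := by
  constructor
  · intro h n
    rw [ev_iterD, h]; simp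
  · intro h
    ext n
    have := h n
    rw [ev_iterD, ← Polynomial.coeff_zero_eq_eval_zero, Polynomial.coeff_iterate_derivative] at this
    simp only [zero_add, Nat.descFactorial_self, nsmul_eq_mul] at this
    rw [Polynomial.coeff_zero]
    exact (mul_eq_zero.1 this).resolve_left (by exact_mod_cast Nat.factorial_ne_zero n)

lemma eq_zero_of_eval_zero {f : Polynomial ℝ} (h : ∀ t, f.eval t = 0) : f = 0 :=
  Polynomial.funext (by simpa using h)

lemma restr_eq_zero_iff (l : Line) (f : P3) : restr l f = 0 ↔ ∀ t, eval (pt l t) f = 0 := by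
  constructor
  · intro h t; rw [← eval_restr, h]; simp
  · intro h; apply eq_zero_of_eval_zero; intro t; rw [eval_restr, h]

/-- Tangency of a line contained in the surface. -/
lemma tangent_of_restr_eq_zero {l : Line} {f : P3} (h : restr l f = 0) (t : ℝ) :
    eval (pt l t) (pderiv 0 f) - l.1.1 * eval (pt l t) (pderiv 1 f) +
      l.2.2 * eval (pt l t) (pderiv 2 f) = 0 := by
  have h1 : Polynomial.derivative (restr l f) = 0 := by rw [h]; simp
  rw [restr, derivative_aeval] at h1
  have h2 := congrArg (Polynomial.eval t) h1
  rw [Fin.sum_univ_three] at h2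
  have hr : ∀ g : P3, aeval ![Polynomial.X, Polynomial.C l.2.1 - Polynomial.C l.1.1 * Polynomial.X,
    Polynomial.C l.2.2 * Polynomial.X - Polynomial.C l.1.2] g = restr l g := fun _ => rfl
  simp only [Polynomial.eval_add, Polynomial.eval_mul, hr, eval_restr] at h2
  simp at h2
  linarith

lemma ndir_eq_smul {l : Line} {f : P3} (h : restr l f = 0) (t : ℝ) :
    ndir f (pt l t) l.1.1 = fun i => eval (pt l t) (pderiv 2 f) * ![1, -l.1.1, l.2.2] i := by
  have := tangent_of_restr_eq_zero h t
  funext i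
  fin_cases i
  · simp [ndir]
  · simp [ndir, mul_comm]
  · simp [ndir]; linarith

lemma ev_iterD_eq_zero_of_line {l : Line} {f : P3} (h : restr l f = 0) (t : ℝ) (n : ℕ) :
    ev (pt l t) l.1.1 (iterD f n f) = 0 := by
  revert n
  rw [← alongLine_eq_zero_iff, ndir_eq_smul h]
  apply eq_zero_of_eval_zero
  intro σ
  rw [eval_alongLine]
  rw [restr_eq_zero_iff] at h
  have := h (t + eval (pt l t) (pderiv 2 f) * σ)
  convert this using 3
  funext i
  fin_cases i <;> simp [pt] <;> ring

/-- The line of transformations through `x` with base slope `t` tangent to the surface at `x`. -/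
noncomputable def tline (f : P3) (x : Fin 3 → ℝ) (t : ℝ) : Line :=
  ((t, (t * eval x (pderiv 1 f) - eval x (pderiv 0 f)) / eval x (pderiv 2 f) * x 0 - x 2),
    (x 1 + t * x 0, (t * eval x (pderiv 1 f) - eval x (pderiv 0 f)) / eval x (pderiv 2 f)))

lemma pt_tline (f : P3) (x : Fin 3 → ℝ) (t : ℝ) : pt (tline f x t) (x 0) = x := by
  funext i
  fin_cases i <;> simp [pt, tline]

lemma restr_tline_eq_zero {f : P3} {x : Fin 3 → ℝ} {t : ℝ} (hW : eval x (pderiv 2 f) ≠ 0)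
    (h : ∀ n, ev x t (iterD f n f) = 0) : restr (tline f x t) f = 0 := by
  rw [← alongLine_eq_zero_iff] at h
  rw [restr_eq_zero_iff]
  intro s
  have h1 := eval_alongLine x (ndir f x t) f ((s - x 0) / eval x (pderiv 2 f))
  rw [h, Polynomial.eval_zero] at h1
  rw [h1]
  congr 2
  funext i
  fin_cases i <;> simp [pt, tline, ndir] <;> field_simp <;> ring

/-- A line of the surface through a point with nonzero vertical derivative is determined by its
base slope. -/
lemma eq_tline {l : Line} {f : P3} (h : restr l f = 0) {t : ℝ}
    (hW : eval (pt l t) (pderiv 2 f) ≠ 0) : l = tline f (pt l t) l.1.1 := by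
  have h1 := tangent_of_restr_eq_zero h t
  have h2 : (l.1.1 * eval (pt l t) (pderiv 1 f) - eval (pt l t) (pderiv 0 f)) /
      eval (pt l t) (pderiv 2 f) = l.2.2 := by
    field_simp; linarith
  rw [tline, h2]
  obtain ⟨⟨a, b⟩, ⟨c, d⟩⟩ := l
  simp [pt]

lemma pderiv_comm (i j : Fin 3) (f : P3) : pderiv i (pderiv j f) = pderiv j (pderiv i f) := by
  have : ⁅(pderiv i : Derivation ℝ P3 P3), (pderiv j : Derivation ℝ P3 P3)⁆ = 0 := by
    apply MvPolynomial.derivation_ext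
    intro k
    rw [Derivation.commutator_apply, pderiv_X, pderiv_X]
    simp only [Derivation.zero_apply]
    rcases eq_or_ne k j with rfl | h1 <;> rcases eq_or_ne k i with rfl | h2 <;>
      simp_all
  have h := DFunLike.congr_fun this f
  rw [Derivation.commutator_apply] at h
  exact sub_eq_zero.1 h

/-- Derivative along the tangent direction. -/
noncomputable def dd (f : P3) (g : PT) : PT := ∑ i, dir f i * pderiv i g

lemma dd_add (f : P3) (g h : PT) : dd f (g + h) = dd f g + dd f h := by
  simp [dd, mul_add, Finset.sum_add_distrib]

lemma dd_mul (f : P3) (g h : PT) : dd f (g * h) = dd f g * h + g * dd f h := by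
  simp only [dd, pderiv_mul, Finset.sum_mul, Finset.mul_sum, ← Finset.sum_add_distrib]
  apply Finset.sum_congr rfl
  intro i _
  ring

lemma dd_sub (f : P3) (g h : PT) : dd f (g - h) = dd f g - dd f h := by
  simp [dd, mul_sub, Finset.sum_sub_distrib]

lemma dd_neg (f : P3) (g : PT) : dd f (-g) = - dd f g := by
  simp only [dd, Fin.sum_univ_three, map_neg]; ring

lemma dd_sum (f : P3) (g : Fin 3 → PT) : dd f (∑ i, g i) = ∑ i, dd f (g i) := by
  simp only [Fin.sum_univ_three, dd_add]

lemma dd_T (f : P3) : dd f T = 0 := by simp [dd, T]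

lemma dd_emb (f g : P3) : dd f (emb g) = iterD f 1 g := by
  simp only [dd, emb, pderiv_map, iterD]

lemma iterD_one_self (f : P3) : iterD f 1 f = 0 := by
  simp [iterD, Fin.sum_univ_three, dir]; ring

lemma dd_iterD (f : P3) (n : ℕ) (g : P3) : dd f (iterD f (n + 1) g) =
    iterD f (n + 2) g + (n + 1) * ∑ j, dd f (dir f j) * iterD f n (pderiv j g) := by
  induction n generalizing g with
  | zero =>
    rw [iterD, dd_sum]
    simp only [dd_mul, Finset.sum_add_distrib]
    rw [iterD]
    simp only [iterD, dd_emb, Nat.cast_zero, zero_add, one_mul]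
    rw [add_comm]
  | succ n ih =>
    rw [iterD, dd_sum]
    simp only [dd_mul, Finset.sum_add_distrib, ih, mul_add]
    have h1 : ∑ i, dir f i * iterD f (n + 2) (pderiv i g) = iterD f (n + 3) g := by
      rw [iterD]
    have h2 : ∑ i, dir f i * ((n + 1) * ∑ j, dd f (dir f j) * iterD f n (pderiv j (pderiv i g))) =
        (n + 1) * ∑ j, dd f (dir f j) * iterD f (n + 1) (pderiv j g) := by
      simp only [iterD, Finset.mul_sum]
      rw [Finset.sum_comm]
      refine Finset.sum_congr rfl fun j _ => Finset.sum_congr rfl fun i _ => ?_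
      rw [pderiv_comm]; ring
    rw [h1, h2]
    push_cast
    ring

lemma iterD_two (f : P3) : iterD f 2 f = ∑ i, dir f i * dd f (emb (pderiv i f)) := by
  simp only [dd_emb]; rw [iterD]

lemma mul_dd_dir (f : P3) (j : Fin 3) : emb (pderiv 2 f) * dd f (dir f j) =
    dd f (emb (pderiv 2 f)) * dir f j - (if j = 2 then iterD f 2 f else 0) := by
  fin_cases j
  · simp [dir]; ring
  · simp [dir, dd_neg, dd_mul, dd_T]; ring
  · rw [iterD_two]
    simp [dir, dd_sub, dd_mul, dd_T, Fin.sum_univ_three]; ring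

lemma mul_dd_iterD (f : P3) (n : ℕ) (g : P3) : emb (pderiv 2 f) * dd f (iterD f (n + 1) g) =
    emb (pderiv 2 f) * iterD f (n + 2) g + (n + 1) * (dd f (emb (pderiv 2 f)) * iterD f (n + 1) g -
      iterD f 2 f * iterD f n (pderiv 2 g)) := by
  rw [dd_iterD, mul_add, mul_left_comm, Finset.mul_sum]
  simp only [← mul_assoc, mul_dd_dir, sub_mul, Finset.sum_sub_distrib]
  congr 2
  congr 1
  · rw [iterD]
    simp only [Finset.mul_sum, mul_assoc]
  · simp

/-- Membership in an ideal after inverting `w`. -/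
def Sat (I : Ideal PT) (w g : PT) : Prop := ∃ N : ℕ, w ^ N * g ∈ I

lemma Sat.of_mem {I : Ideal PT} {w g : PT} (h : g ∈ I) : Sat I w g := ⟨0, by simpa⟩

lemma Sat.add {I : Ideal PT} {w g h : PT} (hg : Sat I w g) (hh : Sat I w h) : Sat I w (g + h) := by
  obtain ⟨N, hN⟩ := hg
  obtain ⟨M, hM⟩ := hh
  refine ⟨N + M, ?_⟩
  have : w ^ (N + M) * (g + h) = w ^ M * (w ^ N * g) + w ^ N * (w ^ M * h) := by ring
  rw [this]
  exact I.add_mem (I.mul_mem_left _ hN) (I.mul_mem_left _ hM)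

lemma Sat.mul_left {I : Ideal PT} {w g : PT} (a : PT) (hg : Sat I w g) : Sat I w (a * g) := by
  obtain ⟨N, hN⟩ := hg
  refine ⟨N, ?_⟩
  rw [mul_left_comm]
  exact I.mul_mem_left _ hN

lemma Sat.of_mul {I : Ideal PT} {w u g : PT} (hu : u ∣ w) (hg : Sat I w (u * g)) :
    Sat I w g := by
  obtain ⟨N, hN⟩ := hg
  obtain ⟨v, rfl⟩ := hu
  refine ⟨N + 1, ?_⟩
  have : (u * v) ^ (N + 1) * g = v * ((u * v) ^ N * (u * g)) := by ring
  rw [this]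
  exact I.mul_mem_left _ hN

lemma dd_pow (f : P3) (w : PT) (N : ℕ) : ∃ b, w * dd f (w ^ N) = b * w ^ N := by
  induction N with
  | zero => exact ⟨0, by simp [dd]⟩
  | succ n ih =>
    obtain ⟨b, hb⟩ := ih
    refine ⟨b + dd f w, ?_⟩
    rw [pow_succ, dd_mul]
    linear_combination w * hb

lemma Sat.dd {f : P3} {I : Ideal PT} {w g : PT} (hI : ∀ g ∈ I, Sat I w (dd f g))
    (hg : Sat I w g) : Sat I w (dd f g) := by
  obtain ⟨N, hN⟩ := hg
  have h1 := hI _ hN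
  obtain ⟨b, hb⟩ := dd_pow f w N
  have h2 : Sat I w (w ^ (N + 1) * RectAreas.dd f g) := by
    have : w ^ (N + 1) * RectAreas.dd f g =
        w * RectAreas.dd f (w ^ N * g) + (-b) * (w ^ N * g) := by
      rw [dd_mul]; linear_combination (-g) * hb
    rw [this]
    exact (h1.mul_left w).add ((Sat.of_mem hN).mul_left _)
  obtain ⟨M, hM⟩ := h2
  exact ⟨M + (N + 1), by rw [pow_add, mul_assoc]; exact hM⟩

lemma sat_iterD {f : P3} {I : Ideal PT} {w : PT} (hI : ∀ g ∈ I, Sat I w (dd f g))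
    (hw : emb (pderiv 2 f) ∣ w) (hf : emb f ∈ I) (hq : iterD f 2 f ∈ I) (n : ℕ) :
    Sat I w (iterD f n f) := by
  induction n with
  | zero => exact Sat.of_mem hf
  | succ n ih =>
    cases n with
    | zero => rw [iterD_one_self]; exact Sat.of_mem I.zero_mem
    | succ n =>
      apply Sat.of_mul hw
      have h := mul_dd_iterD f n f
      have : emb (pderiv 2 f) * iterD f (n + 1 + 1) f =
          emb (pderiv 2 f) * dd f (iterD f (n + 1) f) + ((-(n + 1) * dd f (emb (pderiv 2 f))) *
            iterD f (n + 1) f + ((n + 1) * iterD f n (pderiv 2 f)) * iterD f 2 f) := by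
        linear_combination -h
      rw [this]
      exact ((ih.dd hI).mul_left _).add ((ih.mul_left _).add ((Sat.of_mem hq).mul_left _))

lemma Sat.ev_eq_zero {I : Ideal PT} {w g : PT} (hg : Sat I w g) {x : Fin 3 → ℝ} {t : ℝ}
    (hI : ∀ g ∈ I, ev x t g = 0) (hw : ev x t w ≠ 0) : ev x t g = 0 := by
  obtain ⟨N, hN⟩ := hg
  have := hI _ hN
  rw [map_mul, map_pow] at this
  exact (mul_eq_zero.1 this).resolve_left (pow_ne_zero _ hw)

/-- Polynomials in the slope parameter with coefficients of bounded degree. -/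
def Rep (n D : ℕ) (g : PT) : Prop :=
  ∃ c : ℕ → P3, (∀ k, (c k).totalDegree ≤ D) ∧ g = ∑ k ∈ Finset.range (n + 1), emb (c k) * T ^ k

lemma Rep.add {n D : ℕ} {g h : PT} (hg : Rep n D g) (hh : Rep n D h) : Rep n D (g + h) := by
  obtain ⟨c, hc, rfl⟩ := hg
  obtain ⟨c', hc', rfl⟩ := hh
  refine ⟨fun k => c k + c' k, fun k => (totalDegree_add _ _).trans (max_le (hc k) (hc' k)), ?_⟩
  simp [add_mul, Finset.sum_add_distrib]

lemma Rep.emb_mul {n D E : ℕ} {g : PT} (a : P3) (ha : a.totalDegree ≤ E) (hg : Rep n D g) :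
    Rep (n + 1) (E + D) (emb a * g) := by
  obtain ⟨c, hc, rfl⟩ := hg
  refine ⟨fun k => if k = n + 1 then 0 else a * c k, fun k => ?_, ?_⟩
  · dsimp only
    split_ifs
    · simp
    · exact (totalDegree_mul _ _).trans (add_le_add ha (hc k))
  · rw [Finset.sum_range_succ (n := n + 1), Finset.mul_sum]
    simp only [if_true, map_zero, zero_mul, add_zero]
    refine Finset.sum_congr rfl fun k hk => ?_
    rw [Finset.mem_range] at hk
    rw [if_neg (by omega), map_mul, mul_assoc]

lemma Rep.T_emb_mul {n D E : ℕ} {g : PT} (a : P3) (ha : a.totalDegree ≤ E) (hg : Rep n D g) :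
    Rep (n + 1) (E + D) (T * emb a * g) := by
  obtain ⟨c, hc, rfl⟩ := hg
  refine ⟨fun k => if k = 0 then 0 else a * c (k - 1), fun k => ?_, ?_⟩
  · dsimp only
    split_ifs
    · simp
    · exact (totalDegree_mul _ _).trans (add_le_add ha (hc _))
  · rw [Finset.sum_range_succ' (n := n + 1), Finset.mul_sum]
    simp only [if_true, map_zero, zero_mul, add_zero]
    refine Finset.sum_congr rfl fun k hk => ?_
    rw [if_neg (by omega), map_mul, Nat.add_sub_cancel]
    ring

lemma Rep.sub {n D : ℕ} {g h : PT} (hg : Rep n D g) (hh : Rep n D h) : Rep n D (g - h) := by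
  obtain ⟨c, hc, rfl⟩ := hg
  obtain ⟨c', hc', rfl⟩ := hh
  refine ⟨fun k => c k - c' k, fun k => (totalDegree_sub _ _).trans (max_le (hc k) (hc' k)), ?_⟩
  simp [sub_mul, Finset.sum_sub_distrib]

lemma rep_iterD (f : P3) (n : ℕ) (g : P3) :
    Rep n (n * f.totalDegree + g.totalDegree) (iterD f n g) := by
  induction n generalizing g with
  | zero =>
    refine ⟨fun _ => g, fun _ => by simp, by simp [iterD]⟩
  | succ n ih =>
    have hd : ∀ (i : Fin 3) (h : P3), (pderiv i h).totalDegree ≤ h.totalDegree :=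
      fun i h => (totalDegree_pderiv_le i h).trans (Nat.sub_le _ _)
    have ih' : ∀ i, Rep n (n * f.totalDegree + g.totalDegree) (iterD f n (pderiv i g)) := by
      intro i
      obtain ⟨c, hc, h⟩ := ih (pderiv i g)
      exact ⟨c, fun k => (hc k).trans (Nat.add_le_add_left (hd i g) _), h⟩
    have e : (n + 1) * f.totalDegree + g.totalDegree =
        f.totalDegree + (n * f.totalDegree + g.totalDegree) := by ring
    rw [iterD, Fin.sum_univ_three, e]
    have e0 : dir f 0 = emb (pderiv 2 f) := rfl
    have e1 : dir f 1 = -(T * emb (pderiv 2 f)) := rfl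
    have e2 : dir f 2 = T * emb (pderiv 1 f) - emb (pderiv 0 f) := rfl
    have e3 : dir f 0 * iterD f n (pderiv 0 g) + dir f 1 * iterD f n (pderiv 1 g) +
        dir f 2 * iterD f n (pderiv 2 g) =
        (emb (pderiv 2 f) * iterD f n (pderiv 0 g) -
          T * emb (pderiv 2 f) * iterD f n (pderiv 1 g)) +
        (T * emb (pderiv 1 f) * iterD f n (pderiv 2 g) -
          emb (pderiv 0 f) * iterD f n (pderiv 2 g)) := by
      rw [e0, e1, e2]; ring
    rw [e3]
    exact (((ih' 0).emb_mul _ (hd 2 f)).sub ((ih' 1).T_emb_mul _ (hd 2 f))).add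
      (((ih' 2).T_emb_mul _ (hd 1 f)).sub ((ih' 2).emb_mul _ (hd 0 f)))

lemma continuous_eval_pt (l : Line) (g : P3) : Continuous fun t => eval (pt l t) g := by
  simp only [← eval_restr]
  exact (restr l g).continuous

lemma continuous_pt : Continuous fun z : Line × ℝ => pt z.1 z.2 := by
  apply continuous_pi
  intro i
  fin_cases i <;> simp [pt] <;> fun_prop

lemma continuous_pt_right (l : Line) : Continuous fun t => pt l t :=
  continuous_pt.comp (by fun_prop : Continuous fun t => (l, t))

/-- The data attached to a surface all of whose points carry the two lines predicted by a
quadratic polynomial in the base slope. -/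
structure Ruled (f q0 q1 q2 : P3) : Prop where
  root : ∀ l, restr l f = 0 → ∀ t, eval (pt l t) q0 + eval (pt l t) q1 * l.1.1 +
    eval (pt l t) q2 * l.1.1 ^ 2 = 0
  line : ∀ x t, eval x f = 0 → eval x (pderiv 2 f) ≠ 0 → eval x q2 ≠ 0 →
    eval x q0 + eval x q1 * t + eval x q2 * t ^ 2 = 0 → restr (tline f x t) f = 0

lemma exists_other_ruling {f q0 q1 q2 : P3} (hr : Ruled f q0 q1 q2) {l l' : Line} {t₀ : ℝ}
    (hl : restr l f = 0) (hl' : restr l' f = 0) (hne : l.1.1 ≠ l'.1.1)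
    (hpt : pt l t₀ = pt l' t₀) (hW : eval (pt l t₀) (pderiv 2 f) ≠ 0)
    (hq : eval (pt l t₀) q2 ≠ 0) :
    ∃ m : ℝ → Line, ContinuousAt m t₀ ∧ m t₀ = l' ∧
      ∀ᶠ t in 𝓝 t₀, restr (m t) f = 0 ∧ pt (m t) t = pt l t := by
  have hWc := (continuous_eval_pt l (pderiv 2 f)).continuousAt (x := t₀)
  have h1c := (continuous_eval_pt l (pderiv 1 f)).continuousAt (x := t₀)
  have h0c := (continuous_eval_pt l (pderiv 0 f)).continuousAt (x := t₀)
  have hq2c := (continuous_eval_pt l q2).continuousAt (x := t₀)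
  have hq1c := (continuous_eval_pt l q1).continuousAt (x := t₀)
  have hptc := (continuous_pt_right l).continuousAt (x := t₀)
  have hx : ∀ i, ContinuousAt (fun t => pt l t i) t₀ := fun i =>
    (continuous_apply i).continuousAt.comp hptc
  set τ : ℝ → ℝ := fun t => - eval (pt l t) q1 / eval (pt l t) q2 - l.1.1 with hτ
  have hτc : ContinuousAt τ t₀ := (hq1c.neg.div hq2c hq).sub continuousAt_const
  have hτroot : ∀ t, eval (pt l t) q2 ≠ 0 →
      eval (pt l t) q0 + eval (pt l t) q1 * τ t + eval (pt l t) q2 * τ t ^ 2 = 0 := by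
    intro t ht
    have h := hr.root l hl t
    simp only [hτ]
    field_simp
    linear_combination (eval (pt l t) q2) * h
  refine ⟨fun t => tline f (pt l t) (τ t), ?_, ?_, ?_⟩
  · have hD : ContinuousAt (fun t => (τ t * eval (pt l t) (pderiv 1 f) -
        eval (pt l t) (pderiv 0 f)) / eval (pt l t) (pderiv 2 f)) t₀ :=
      ((hτc.mul h1c).sub h0c).div hWc hW
    unfold tline
    exact (hτc.prodMk ((hD.mul (hx 0)).sub (hx 2))).prodMk
      (((hx 1).add (hτc.mul (hx 0))).prodMk hD)
  · have h1 := hr.root l hl t₀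
    have h2 := hr.root l' hl' t₀
    rw [← hpt] at h2
    have h3 : eval (pt l t₀) q1 + eval (pt l t₀) q2 * (l.1.1 + l'.1.1) = 0 := by
      apply mul_left_cancel₀ (sub_ne_zero.2 hne)
      linear_combination h1 - h2
    have h4 : τ t₀ = l'.1.1 := by
      simp only [hτ]
      field_simp
      linear_combination - h3
    have h5 : eval (pt l' t₀) (pderiv 2 f) ≠ 0 := by rwa [← hpt]
    rw [eq_tline hl' h5]
    simp only [h4, hpt]
  · filter_upwards [hWc.eventually_ne hW, hq2c.eventually_ne hq] with t htW htq
    exact ⟨hr.line _ _ ((restr_eq_zero_iff l f).1 hl t) htW htq (hτroot t htq),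
      pt_tline f (pt l t) (τ t)⟩

lemma eq_of_vertical {f : P3} {x y : Fin 3 → ℝ} (hx : eval x f = 0) (hy : eval y f = 0)
    (h0 : x 0 = y 0) (h1 : x 1 = y 1)
    (hW : ∀ z ∈ segment ℝ x y, eval z (pderiv 2 f) ≠ 0) : x = y := by
  set v : Fin 3 → ℝ := fun i => y i - x i with hv
  have hroll : ∃ c ∈ Set.Ioo (0 : ℝ) 1,
      (Polynomial.derivative (alongLine x v f)).eval c = 0 := by
    apply exists_hasDerivAt_eq_zero (f := fun σ => (alongLine x v f).eval σ) zero_lt_one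
    · exact (alongLine x v f).continuous.continuousOn
    · simp only [eval_alongLine]
      simp [hv, hx, hy]
    · intro σ _; exact (alongLine x v f).hasDerivAt σ
  obtain ⟨c, hc, hc0⟩ := hroll
  rw [derivative_alongLine, Polynomial.eval_finsetSum, Fin.sum_univ_three] at hc0
  simp only [Polynomial.eval_mul, Polynomial.eval_C, eval_alongLine] at hc0
  have hv0 : v 0 = 0 := by simp [hv, h0]
  have hv1 : v 1 = 0 := by simp [hv, h1]
  rw [hv0, hv1, zero_mul, zero_mul, zero_add, zero_add] at hc0
  have hmem : (fun i => x i + v i * c) ∈ segment ℝ x y := by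
    rw [segment_eq_image']
    refine ⟨c, ⟨hc.1.le, hc.2.le⟩, ?_⟩
    funext i
    simp [hv, mul_comm]
  have hv2 := (mul_eq_zero.1 hc0).resolve_right (hW _ hmem)
  funext i
  fin_cases i
  · exact h0
  · exact h1
  · simp only [hv] at hv2
    simp; linarith

lemma eventually_meet {f q2 : P3} {m n : ℝ → Line} {t₀ : ℝ} (hm : ContinuousAt m t₀)
    (hn : ContinuousAt n t₀) (hmf : ∀ᶠ t in 𝓝 t₀, restr (m t) f = 0)
    (hnf : ∀ᶠ t in 𝓝 t₀, restr (n t) f = 0) (hne : (m t₀).1.1 ≠ (n t₀).1.1)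
    (hpt : pt (m t₀) t₀ = pt (n t₀) t₀) (hW : eval (pt (m t₀) t₀) (pderiv 2 f) ≠ 0)
    (hq : eval (pt (m t₀) t₀) q2 ≠ 0) :
    ∀ᶠ z in 𝓝 t₀ ×ˢ 𝓝 t₀, (m z.1).1.1 ≠ (n z.2).1.1 ∧ ∃ ν, pt (m z.1) ν = pt (n z.2) ν ∧
      eval (pt (n z.2) ν) (pderiv 2 f) ≠ 0 ∧ eval (pt (n z.2) ν) q2 ≠ 0 := by
  rw [← nhds_prod_eq]
  have hm' : ContinuousAt (fun z : ℝ × ℝ => m z.1) (t₀, t₀) :=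
    ContinuousAt.comp (f := Prod.fst) (x := (t₀, t₀)) hm continuousAt_fst
  have hn' : ContinuousAt (fun z : ℝ × ℝ => n z.2) (t₀, t₀) :=
    ContinuousAt.comp (f := Prod.snd) (x := (t₀, t₀)) hn continuousAt_snd
  set ν : ℝ × ℝ → ℝ := fun z =>
    ((m z.1).2.1 - (n z.2).2.1) / ((m z.1).1.1 - (n z.2).1.1) with hν
  have hd : ContinuousAt (fun z : ℝ × ℝ => (m z.1).1.1 - (n z.2).1.1) (t₀, t₀) :=
    (hm'.fst.fst).sub hn'.fst.fst
  have hνc : ContinuousAt ν (t₀, t₀) :=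
    (hm'.snd.fst.sub hn'.snd.fst).div hd (sub_ne_zero.2 hne)
  have hν0 : ν (t₀, t₀) = t₀ := by
    have := congrFun hpt 1
    simp [pt] at this
    simp only [hν]
    rw [div_eq_iff (sub_ne_zero.2 hne)]
    linarith
  have hy : ContinuousAt (fun z : ℝ × ℝ => pt (m z.1) (ν z)) (t₀, t₀) :=
    ContinuousAt.comp (g := fun z : Line × ℝ => pt z.1 z.2) (f := fun z : ℝ × ℝ => (m z.1, ν z))
      continuous_pt.continuousAt (hm'.prodMk hνc)
  have hy' : ContinuousAt (fun z : ℝ × ℝ => pt (n z.2) (ν z)) (t₀, t₀) :=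
    ContinuousAt.comp (g := fun z : Line × ℝ => pt z.1 z.2) (f := fun z : ℝ × ℝ => (n z.2, ν z))
      continuous_pt.continuousAt (hn'.prodMk hνc)
  set x₀ := pt (m t₀) t₀ with hx₀
  have hcont : ∀ g : P3, Continuous fun x : Fin 3 → ℝ => eval x g := fun g =>
    MvPolynomial.continuous_eval g
  have hU : ∀ᶠ x in 𝓝 x₀, eval x (pderiv 2 f) ≠ 0 ∧ eval x q2 ≠ 0 :=
    ((hcont _).continuousAt.eventually_ne hW).and ((hcont _).continuousAt.eventually_ne hq)
  obtain ⟨ε, hε, hball⟩ := Metric.eventually_nhds_iff_ball.1 hU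
  have e1 : ∀ᶠ z in 𝓝 (t₀, t₀), pt (m z.1) (ν z) ∈ Metric.ball x₀ ε := by
    apply hy.eventually_mem
    rw [hν0]
    exact Metric.ball_mem_nhds _ hε
  have e2 : ∀ᶠ z in 𝓝 (t₀, t₀), pt (n z.2) (ν z) ∈ Metric.ball x₀ ε := by
    apply hy'.eventually_mem
    rw [hν0]
    show _ ∈ 𝓝 (pt (n t₀) t₀)
    rw [← hpt]
    exact Metric.ball_mem_nhds _ hε
  have e3 : ∀ᶠ z : ℝ × ℝ in 𝓝 (t₀, t₀), restr (m z.1) f = 0 :=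
    (continuousAt_fst : ContinuousAt Prod.fst (t₀, t₀)).eventually hmf
  have e4 : ∀ᶠ z : ℝ × ℝ in 𝓝 (t₀, t₀), restr (n z.2) f = 0 :=
    (continuousAt_snd : ContinuousAt Prod.snd (t₀, t₀)).eventually hnf
  filter_upwards [e1, e2, e3, e4, hd.eventually_ne (sub_ne_zero.2 hne)] with z h1 h2 h3 h4 h5
  refine ⟨sub_ne_zero.1 h5, ν z, ?_, hball _ h2⟩
  apply eq_of_vertical ((restr_eq_zero_iff _ _).1 h3 _) ((restr_eq_zero_iff _ _).1 h4 _)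
  · simp [pt]
  · have : ν z * ((m z.1).1.1 - (n z.2).1.1) = (m z.1).2.1 - (n z.2).2.1 := by
      simp only [hν]; exact div_mul_cancel₀ _ h5
    simp [pt]; linarith
  · intro w hw
    exact (hball w ((convex_ball x₀ ε).segment_subset h1 h2 hw)).1

lemma exists_quadric (S : Finset Line) (hS : S.card ≤ 3) :
    ∃ Q : P3, Q ≠ 0 ∧ Q.totalDegree ≤ 2 ∧ ∀ l ∈ S, restr l Q = 0 := by
  classical
  have key : ∀ S : Finset Line, Module.finrank ℝ (W 2) ≤ Module.finrank ℝ (V 2 S) + 3 * S.card := by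
    intro S
    induction S using Finset.induction_on with
    | empty => rw [V_empty]; simp
    | insert l S hl ih =>
      have := finrank_V_le_insert 2 S l ∅ (by simp)
      rw [Finset.card_empty] at this
      rw [Finset.card_insert_of_notMem hl]
      omega
  have h1 := finrank_W 2
  have h2 := key S
  have h3 : 0 < Module.finrank ℝ (V 2 S) := by omega
  obtain ⟨⟨f, hf⟩, hf0⟩ := Module.finrank_pos_iff_exists_ne_zero.1 h3
  rw [mem_V] at hf
  exact ⟨f, fun e => hf0 (by simpa using e), hf.1, hf.2⟩

lemma dvd_of_infinite_lines {f h : P3} (hf : Irreducible f) {s : Set Line} (hs : s.Infinite)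
    (h1 : ∀ l ∈ s, restr l f = 0) (h2 : ∀ l ∈ s, restr l h = 0) : f ∣ h := by
  by_contra hcon
  obtain ⟨S, hS, hcard⟩ := hs.exists_subset_card_eq (f.totalDegree * h.totalDegree + 1)
  have := card_lines_le hf hcon S (fun l hl => h1 l (hS hl)) (fun l hl => h2 l (hS hl))
  omega

lemma slope_eq_of_two_points {l l' : Line} {a b : ℝ} (hab : a ≠ b) (ha : pt l a = pt l' a)
    (hb : pt l b = pt l' b) : l.1.1 = l'.1.1 := by
  have e1 := congrFun ha 1
  have e2 := congrFun hb 1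
  simp [pt] at e1 e2
  apply mul_left_cancel₀ (sub_ne_zero.2 hab)
  linarith

lemma exists_quadric_multiple {f q0 q1 q2 : P3} (hf : Irreducible f) (hr : Ruled f q0 q1 q2)
    {l l' : Line} {t₀ : ℝ}
    (hl : restr l f = 0) (hl' : restr l' f = 0) (hne : l.1.1 ≠ l'.1.1)
    (hpt : pt l t₀ = pt l' t₀) (hW : eval (pt l t₀) (pderiv 2 f) ≠ 0)
    (hq : eval (pt l t₀) q2 ≠ 0) : ∃ Q : P3, Q ≠ 0 ∧ Q.totalDegree ≤ 2 ∧ f ∣ Q := by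
  obtain ⟨m, hmc, hm0, hm⟩ := exists_other_ruling hr hl hl' hne hpt hW hq
  obtain ⟨n, hnc, hn0, hn⟩ := exists_other_ruling hr hl' hl hne.symm hpt.symm
    (by rwa [← hpt]) (by rwa [← hpt])
  have hmeet := eventually_meet (f := f) (q2 := q2) hmc hnc (hm.mono fun _ h => h.1)
    (hn.mono fun _ h => h.1) (by rw [hm0, hn0]; exact hne.symm) (by rw [hm0, hn0, hpt])
    (by rw [hm0, ← hpt]; exact hW) (by rw [hm0, ← hpt]; exact hq)
  obtain ⟨U, hU, hUmeet⟩ := (eventually_prod_self_iff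
    (r := fun a b => (m a).1.1 ≠ (n b).1.1 ∧ ∃ ν, pt (m a) ν = pt (n b) ν ∧
      eval (pt (n b) ν) (pderiv 2 f) ≠ 0 ∧ eval (pt (n b) ν) q2 ≠ 0)).1 hmeet
  have hms : ∀ᶠ t in 𝓝 t₀, (m t).1.1 ≠ l.1.1 :=
    hmc.fst.fst.eventually_ne (by rw [hm0]; exact hne.symm)
  have hns : ∀ᶠ t in 𝓝 t₀, (n t).1.1 ≠ l'.1.1 :=
    hnc.fst.fst.eventually_ne (by rw [hn0]; exact hne)
  have hgood : {t | t ∈ U ∧ (restr (m t) f = 0 ∧ pt (m t) t = pt l t) ∧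
      (restr (n t) f = 0 ∧ pt (n t) t = pt l' t) ∧ (m t).1.1 ≠ l.1.1 ∧ (n t).1.1 ≠ l'.1.1} ∈ 𝓝 t₀ := by
    filter_upwards [hU, hm, hn, hms, hns] with t h1 h2 h3 h4 h5
    exact ⟨h1, h2, h3, h4, h5⟩
  set G := {t | t ∈ U ∧ (restr (m t) f = 0 ∧ pt (m t) t = pt l t) ∧
      (restr (n t) f = 0 ∧ pt (n t) t = pt l' t) ∧ (m t).1.1 ≠ l.1.1 ∧ (n t).1.1 ≠ l'.1.1}
  have hGinf : G.Infinite := infinite_of_mem_nhds t₀ hgood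
  have hminj : Set.InjOn m G := by
    intro a ha b hb hab
    by_contra hne'
    apply ha.2.2.2.1
    apply slope_eq_of_two_points hne' ha.2.1.2
    rw [hab]; exact hb.2.1.2
  have hninj : Set.InjOn n G := by
    intro a ha b hb hab
    by_contra hne'
    apply ha.2.2.2.2
    apply slope_eq_of_two_points hne' ha.2.2.1.2
    rw [hab]; exact hb.2.2.1.2
  obtain ⟨R, hRG, hRcard⟩ := hGinf.exists_subset_card_eq 3
  classical
  obtain ⟨Q, hQ0, hQ2, hQ⟩ := exists_quadric (R.image m) (Finset.card_image_le.trans hRcard.le)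
  refine ⟨Q, hQ0, hQ2, dvd_of_infinite_lines hf (hGinf.image hninj) ?_ ?_⟩
  · rintro _ ⟨t, ht, rfl⟩
    exact ht.2.2.1.1
  · rintro _ ⟨μ, hμ, rfl⟩
    have hν : ∀ t : ℝ, ∃ ν, t ∈ R → pt (m t) ν = pt (n μ) ν ∧
        eval (pt (n μ) ν) (pderiv 2 f) ≠ 0 ∧ eval (pt (n μ) ν) q2 ≠ 0 := by
      intro t
      by_cases ht : t ∈ R
      · obtain ⟨ν, hν⟩ := (hUmeet t (hRG ht).1 μ hμ.1).2
        exact ⟨ν, fun _ => hν⟩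
      · exact ⟨0, fun h => absurd h ht⟩
    choose ν hν using hν
    have hνinj : Set.InjOn ν R := by
      intro a ha b hb hab
      obtain ⟨ha1, ha2, ha3⟩ := hν a ha
      obtain ⟨hb1, hb2, hb3⟩ := hν b hb
      rw [← hab] at hb1
      have haG := hRG ha
      have hbG := hRG hb
      have sa := (hUmeet a haG.1 μ hμ.1).1
      have sb := (hUmeet b hbG.1 μ hμ.1).1
      have ra := hr.root (m a) haG.2.1.1 (ν a)
      have rb := hr.root (m b) hbG.2.1.1 (ν a)
      have rμ := hr.root (n μ) hμ.2.2.1.1 (ν a)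
      rw [ha1] at ra
      rw [hb1] at rb
      set x := pt (n μ) (ν a)
      have e1 : eval x q1 + eval x q2 * ((m a).1.1 + (n μ).1.1) = 0 := by
        apply mul_left_cancel₀ (sub_ne_zero.2 sa)
        linear_combination ra - rμ
      have e2 : eval x q1 + eval x q2 * ((m b).1.1 + (n μ).1.1) = 0 := by
        apply mul_left_cancel₀ (sub_ne_zero.2 sb)
        linear_combination rb - rμ
      have e3 : (m a).1.1 = (m b).1.1 := by
        apply mul_left_cancel₀ ha3
        linear_combination e1 - e2
      apply hminj haG hbG
      have wa : eval (pt (m a) (ν a)) (pderiv 2 f) ≠ 0 := by rw [ha1]; exact ha2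
      have wb : eval (pt (m b) (ν a)) (pderiv 2 f) ≠ 0 := by rw [hb1]; exact ha2
      rw [eq_tline haG.2.1.1 wa, eq_tline hbG.2.1.1 wb, ha1, hb1, e3]
    have hroots : ∀ x ∈ R.image ν, (restr (n μ) Q).eval x = 0 := by
      intro x hx
      obtain ⟨t, ht, rfl⟩ := Finset.mem_image.1 hx
      rw [eval_restr, ← (hν t ht).1]
      exact (restr_eq_zero_iff _ _).1 (hQ _ (Finset.mem_image_of_mem m ht)) _
    apply Polynomial.eq_zero_of_natDegree_lt_card_of_eval_eq_zero' _ _ hroots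
    rw [Finset.card_image_of_injOn hνinj, hRcard]
    have := natDegree_restr_le (n μ) Q
    omega

lemma one_le_totalDegree {f : P3} (hf : Irreducible f) : 1 ≤ f.totalDegree := by
  by_contra h
  have h0 : f.totalDegree = 0 := by omega
  rw [totalDegree_eq_zero_iff_eq_C] at h0
  by_cases hc : coeff 0 f = 0
  · rw [hc, C_0] at h0
    exact hf.ne_zero h0
  · apply hf.not_isUnit
    rw [h0]
    exact (isUnit_iff_ne_zero.2 hc).map C

lemma totalDegree_eq_one_of_dvd {f h : P3} (hf : Irreducible f) (hfh : f ∣ h) (h0 : h ≠ 0)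
    (h1 : h.totalDegree ≤ 1) : f.totalDegree = 1 := by
  have := one_le_totalDegree hf
  have := totalDegree_le_of_dvd hfh h0
  omega

lemma totalDegree_linear_le (a b c e : ℝ) :
    (C a * X 0 + C b * X 1 + C c * X 2 + C e : P3).totalDegree ≤ 1 := by
  have h : ∀ (r : ℝ) (i : Fin 3), (C r * X i : P3).totalDegree ≤ 1 := fun r i =>
    (totalDegree_mul _ _).trans (by simp)
  refine (totalDegree_add _ _).trans (max_le ?_ (by simp))
  refine (totalDegree_add _ _).trans (max_le ?_ (h _ _))
  exact (totalDegree_add _ _).trans (max_le (h _ _) (h _ _))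

lemma eval_eq_of_pderiv_two {f : P3} (hW : pderiv 2 f = 0) {x y : Fin 3 → ℝ} (h0 : x 0 = y 0)
    (h1 : x 1 = y 1) : eval x f = eval y f := by
  have hd : Polynomial.derivative (alongLine x ![0, 0, 1] f) = 0 := by
    rw [derivative_alongLine, Fin.sum_univ_three]
    simp [hW]
  have hc := Polynomial.eq_C_of_derivative_eq_zero hd
  have e : ∀ σ, eval (fun i => x i + ![0, 0, 1] i * σ) f = (alongLine x ![0, 0, 1] f).coeff 0 := by
    intro σ
    rw [← eval_alongLine, hc]; simp
  have e0 := e 0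
  have e1 := e (y 2 - x 2)
  have hx : (fun i => x i + (![0, 0, 1] : Fin 3 → ℝ) i * 0) = x := by funext i; simp
  have hy : (fun i => x i + (![0, 0, 1] : Fin 3 → ℝ) i * (y 2 - x 2)) = y := by
    funext i; fin_cases i <;> simp [h0, h1]
  rw [hx] at e0
  rw [hy] at e1
  rw [e0, e1]

lemma totalDegree_eq_one_of_cylinder {f : P3} (hf : Irreducible f) (hW : pderiv 2 f = 0) {l : Line}
    (hl : restr l f = 0) : f.totalDegree = 1 := by
  set h : P3 := C l.1.1 * X 0 + C 1 * X 1 + C 0 * X 2 + C (-l.2.1) with hh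
  have h0 : h ≠ 0 := by
    intro e
    have := congrArg (eval ![0, l.2.1 + 1, 0]) e
    simp [hh] at this
  set m : ℕ → Line := fun k => ((l.1.1, (k : ℝ)), (l.2.1, 0)) with hm
  have hinj : Function.Injective m := by
    intro a b hab
    simpa [hm] using hab
  refine totalDegree_eq_one_of_dvd hf ?_ h0 (totalDegree_linear_le _ _ _ _)
  apply dvd_of_infinite_lines hf (Set.infinite_range_of_injective hinj)
  · rintro _ ⟨k, rfl⟩
    rw [restr_eq_zero_iff] at hl ⊢
    intro t
    rw [← hl t]
    apply eval_eq_of_pderiv_two hW <;> simp [pt, hm]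
  · rintro _ ⟨k, rfl⟩
    rw [restr_eq_zero_iff]
    intro t
    simp [hh, pt, hm]

lemma ev_eq_zero_of_mem_span {s : Set PT} {x : Fin 3 → ℝ} {t : ℝ} (h : ∀ g ∈ s, ev x t g = 0) :
    ∀ g ∈ Ideal.span s, ev x t g = 0 := by
  have : Ideal.span s ≤ RingHom.ker (ev x t) := Ideal.span_le.2 h
  exact this

lemma sat_dd_of_span {f : P3} {s : Set PT} {w : PT}
    (h : ∀ g ∈ s, Sat (Ideal.span s) w (dd f g)) : ∀ g ∈ Ideal.span s, Sat (Ideal.span s) w (dd f g) := by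
  intro g hg
  induction hg using Submodule.span_induction with
  | mem x hx => exact h x hx
  | zero => exact Sat.of_mem (by simp [dd])
  | add x y _ _ hx hy => rw [dd_add]; exact hx.add hy
  | smul a x hx ih =>
    rw [smul_eq_mul, dd_mul]
    exact (Sat.of_mem (Ideal.mul_mem_left _ _ hx)).add (ih.mul_left a)

lemma totalDegree_eq_one_of_planar {f : P3} (hf : Irreducible f)
    (hq : iterD f 2 f ∈ Ideal.span {emb f}) {x : Fin 3 → ℝ} (hx : eval x f = 0)
    (hW : eval x (pderiv 2 f) ≠ 0) : f.totalDegree = 1 := by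
  have hfm : emb f ∈ Ideal.span {emb f} := Ideal.subset_span rfl
  have hI : ∀ g ∈ Ideal.span {emb f}, Sat (Ideal.span {emb f}) (emb (pderiv 2 f)) (dd f g) := by
    apply sat_dd_of_span
    rintro _ rfl
    rw [dd_emb, iterD_one_self]
    exact Sat.of_mem (by simp)
  have hline : ∀ τ, restr (tline f x τ) f = 0 := by
    intro τ
    apply restr_tline_eq_zero hW
    intro n
    apply (sat_iterD hI dvd_rfl hfm hq n).ev_eq_zero
    · apply ev_eq_zero_of_mem_span
      rintro _ rfl
      rw [ev_emb, hx]
    · rwa [ev_emb]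
  set a := eval x (pderiv 0 f)
  set b := eval x (pderiv 1 f)
  set c := eval x (pderiv 2 f) with hc
  set h : P3 := C a * X 0 + C b * X 1 + C c * X 2 + C (-(a * x 0 + b * x 1 + c * x 2)) with hh
  have h0 : h ≠ 0 := by
    intro e
    have := congrArg (eval ![x 0, x 1, x 2 + 1]) e
    simp [hh] at this
    apply hW
    linarith
  have hinj : Function.Injective (tline f x) := by
    intro a b hab
    exact congrArg (fun l : Line => l.1.1) hab
  refine totalDegree_eq_one_of_dvd hf ?_ h0 (totalDegree_linear_le _ _ _ _)
  apply dvd_of_infinite_lines hf (Set.infinite_range_of_injective hinj)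
  · rintro _ ⟨τ, rfl⟩
    exact hline τ
  · rintro _ ⟨τ, rfl⟩
    rw [restr_eq_zero_iff]
    intro s
    simp [hh, pt, tline]
    rw [← hc]
    field_simp
    ring

/-- `h` vanishes wherever two lines of the surface `f = 0` with different base slopes meet. -/
def CrossVanish (f h : P3) : Prop :=
  ∀ (l l' : Line) t, restr l f = 0 → restr l' f = 0 → l.1.1 ≠ l'.1.1 → pt l t = pt l' t →
    eval (pt l t) h = 0

lemma crossVanish_of_linear {f r0 r1 : P3} (h : ∀ l t, restr l f = 0 →
    eval (pt l t) r0 + eval (pt l t) r1 * l.1.1 = 0) : CrossVanish f r0 ∧ CrossVanish f r1 := by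
  have key : CrossVanish f r1 := by
    intro l l' t hl hl' hne hpt
    have h1 := h l t hl
    have h2 := h l' t hl'
    rw [← hpt] at h2
    apply mul_left_cancel₀ (sub_ne_zero.2 hne)
    linear_combination h1 - h2
  refine ⟨?_, key⟩
  intro l l' t hl hl' hne hpt
  have := h l t hl
  rw [key l l' t hl hl' hne hpt] at this
  linarith

lemma totalDegree_mul_sub_mul_le {a b c e : P3} {m n : ℕ} (ha : a.totalDegree ≤ m)
    (hb : b.totalDegree ≤ n) (hc : c.totalDegree ≤ n) (he : e.totalDegree ≤ m) :
    (a * b - c * e).totalDegree ≤ m + n := by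
  refine (totalDegree_sub _ _).trans (max_le ?_ ?_)
  · exact (totalDegree_mul _ _).trans (add_le_add ha hb)
  · rw [add_comm]; exact (totalDegree_mul _ _).trans (add_le_add hc he)

lemma emb_mem_span {f g : P3} {s : Set PT} (hs : emb f ∈ s) (h : f ∣ g) : emb g ∈ Ideal.span s := by
  obtain ⟨k, rfl⟩ := h
  rw [map_mul]
  exact Ideal.mul_mem_right _ _ (Ideal.subset_span hs)

lemma ruled_of_mem {f q0 q1 q2 : P3} (hq : iterD f 2 f = emb q0 + emb q1 * T + emb q2 * T ^ 2)
    (h3 : emb (q2 ^ 2) * iterD f 3 f ∈ Ideal.span {emb f, iterD f 2 f}) : Ruled f q0 q1 q2 := by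
  set I := Ideal.span {emb f, iterD f 2 f} with hIdef
  set w : PT := emb (pderiv 2 f) * emb q2 with hw
  have hfm : emb f ∈ I := Ideal.subset_span (by simp)
  have hqm : iterD f 2 f ∈ I := Ideal.subset_span (by simp)
  have hsq : Sat I w (dd f (iterD f 2 f)) := by
    apply Sat.of_mul (u := emb (pderiv 2 f)) ⟨emb q2, rfl⟩
    rw [mul_dd_iterD f 1 f]
    have s3 : Sat I w (iterD f 3 f) := by
      apply Sat.of_mul (u := emb q2) ⟨emb (pderiv 2 f), mul_comm _ _⟩
      apply Sat.of_mul (u := emb q2) ⟨emb (pderiv 2 f), mul_comm _ _⟩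
      apply Sat.of_mem
      rw [← mul_assoc, ← map_mul, ← sq]
      exact h3
    refine (s3.mul_left _).add (Sat.of_mem (I.mul_mem_left _ (I.sub_mem ?_ ?_)))
    · exact I.mul_mem_left _ hqm
    · exact I.mul_mem_right _ hqm
  have hI : ∀ g ∈ I, Sat I w (dd f g) := by
    apply sat_dd_of_span
    rintro g (rfl | rfl)
    · rw [dd_emb, iterD_one_self]
      exact Sat.of_mem (by simp)
    · exact hsq
  constructor
  · intro l hl t
    have := ev_iterD_eq_zero_of_line hl t 2
    rw [hq] at this
    simpa [ev_emb] using this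
  · intro x t hx hW h2 hroot
    apply restr_tline_eq_zero hW
    intro n
    apply (sat_iterD hI ⟨emb q2, rfl⟩ hfm hqm n).ev_eq_zero
    · apply ev_eq_zero_of_mem_span
      rintro g (rfl | rfl)
      · rw [ev_emb, hx]
      · rw [hq]; simpa [ev_emb] using hroot
    · rw [hw, map_mul, ev_emb, ev_emb]
      exact mul_ne_zero hW h2

/-- Every irreducible surface either has its crossing points contained in a further surface of
comparable degree, or is a plane, or is a quadric with explicit rulings. -/
theorem exists_witness {f : P3} (hf : Irreducible f) :
    ∃ h : P3, ¬ f ∣ h ∧ h.totalDegree ≤ 11 * f.totalDegree ∧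
      (CrossVanish f h ∨ f.totalDegree = 1 ∨ (f.totalDegree = 2 ∧ ∃ q0 q1 q2 : P3,
        q0.totalDegree ≤ 6 ∧ q1.totalDegree ≤ 6 ∧ q2.totalDegree ≤ 6 ∧ h = pderiv 2 f * q2 ∧
        Ruled f q0 q1 q2)) := by
  have hd1 := one_le_totalDegree hf
  have hone : ¬ f ∣ 1 := fun h => hf.not_isUnit (isUnit_of_dvd_one h)
  by_cases hplane : f.totalDegree = 1
  · exact ⟨1, hone, by simp, Or.inr (Or.inl hplane)⟩
  have hWd := totalDegree_pderiv_le 2 f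
  by_cases hfW : f ∣ pderiv 2 f
  · have hW0 : pderiv 2 f = 0 := by
      by_contra h
      have := totalDegree_le_of_dvd hfW h
      omega
    refine ⟨1, hone, by simp, Or.inl ?_⟩
    intro l l' t hl _ _ _
    exact absurd (totalDegree_eq_one_of_cylinder hf hW0 hl) hplane
  obtain ⟨q, hqd, hq⟩ := rep_iterD f 2 f
  obtain ⟨c, hcd, hc⟩ := rep_iterD f 3 f
  simp only [Finset.sum_range_succ, Finset.sum_range_zero, zero_add, pow_zero, pow_one, mul_one]
    at hq hc
  have hqr : ∀ l t, restr l f = 0 → eval (pt l t) (q 0) + eval (pt l t) (q 1) * l.1.1 +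
      eval (pt l t) (q 2) * l.1.1 ^ 2 = 0 := by
    intro l t hl
    have := ev_iterD_eq_zero_of_line hl t 2
    rw [hq] at this
    simpa [ev_emb] using this
  have hcr : ∀ l t, restr l f = 0 → eval (pt l t) (c 0) + eval (pt l t) (c 1) * l.1.1 +
      eval (pt l t) (c 2) * l.1.1 ^ 2 + eval (pt l t) (c 3) * l.1.1 ^ 3 = 0 := by
    intro l t hl
    have := ev_iterD_eq_zero_of_line hl t 3
    rw [hc] at this
    simpa [ev_emb] using this
  by_cases hq2 : f ∣ q 2
  · have hq2v : ∀ l t, restr l f = 0 → eval (pt l t) (q 2) = 0 := by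
      intro l t hl
      obtain ⟨k, hk⟩ := hq2
      rw [hk, map_mul, (restr_eq_zero_iff l f).1 hl t, zero_mul]
    obtain ⟨hv0, hv1⟩ := crossVanish_of_linear (f := f) (r0 := q 0) (r1 := q 1) (by
      intro l t hl
      have := hqr l t hl
      rw [hq2v l t hl] at this
      linarith)
    by_cases hq0 : f ∣ q 0
    · by_cases hq1 : f ∣ q 1
      · refine ⟨pderiv 2 f, hfW, by omega, Or.inl ?_⟩
        intro l l' t hl _ _ _
        by_contra hne
        refine hplane (totalDegree_eq_one_of_planar hf ?_ ((restr_eq_zero_iff l f).1 hl t) hne)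
        rw [hq]
        exact add_mem (add_mem (emb_mem_span rfl hq0) (Ideal.mul_mem_right _ _ (emb_mem_span rfl hq1)))
          (Ideal.mul_mem_right _ _ (emb_mem_span rfl hq2))
      · exact ⟨q 1, hq1, (hqd 1).trans (by omega), Or.inl hv1⟩
    · exact ⟨q 0, hq0, (hqd 0).trans (by omega), Or.inl hv0⟩
  set e2 := q 2 * c 2 - c 3 * q 1 with he2
  set e1 := q 2 * c 1 - c 3 * q 0 with he1
  set e0 := q 2 * c 0 with he0
  set r1 := q 2 * e1 - e2 * q 1 with hr1
  set r0 := q 2 * e0 - e2 * q 0 with hr0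
  set d := f.totalDegree with hd
  have he2d : e2.totalDegree ≤ (2 * d + d) + (3 * d + d) :=
    totalDegree_mul_sub_mul_le (hqd 2) (hcd 2) (hcd 3) (hqd 1)
  have he1d : e1.totalDegree ≤ (2 * d + d) + (3 * d + d) :=
    totalDegree_mul_sub_mul_le (hqd 2) (hcd 1) (hcd 3) (hqd 0)
  have he0d : e0.totalDegree ≤ (2 * d + d) + (3 * d + d) :=
    (totalDegree_mul _ _).trans (add_le_add (hqd 2) (hcd 0))
  have hr1d : r1.totalDegree ≤ 11 * d :=
    (totalDegree_mul_sub_mul_le (hqd 2) he1d he2d (hqd 1)).trans (by omega)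
  have hr0d : r0.totalDegree ≤ 11 * d :=
    (totalDegree_mul_sub_mul_le (hqd 2) he0d he2d (hqd 0)).trans (by omega)
  obtain ⟨hv0, hv1⟩ := crossVanish_of_linear (f := f) (r0 := r0) (r1 := r1) (by
    intro l t hl
    have h1 := hqr l t hl
    have h2 := hcr l t hl
    simp only [hr1, hr0, he0, he1, he2, map_sub, map_mul]
    linear_combination (eval (pt l t) (q 2)) ^ 2 * h2 - (eval (pt l t) (q 2) * eval (pt l t) (c 3) * l.1.1 +
      (eval (pt l t) (q 2) * eval (pt l t) (c 2) - eval (pt l t) (c 3) * eval (pt l t) (q 1))) * h1)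
  by_cases hf1 : f ∣ r1
  swap
  · exact ⟨r1, hf1, hr1d, Or.inl hv1⟩
  by_cases hf0 : f ∣ r0
  swap
  · exact ⟨r0, hf0, hr0d, Or.inl hv0⟩
  have hruled : Ruled f (q 0) (q 1) (q 2) := by
    apply ruled_of_mem hq
    have e : emb (q 2 ^ 2) * iterD f 3 f = (emb (q 2 * c 3) * T + emb e2) * iterD f 2 f +
        (emb r1 * T + emb r0) := by
      rw [hc, hq]
      simp only [hr1, hr0, he0, he1, he2, map_sub, map_mul, map_pow]
      ring
    rw [e]
    refine add_mem (Ideal.mul_mem_left _ _ (Ideal.subset_span (by simp))) (add_mem ?_ ?_)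
    · exact Ideal.mul_mem_right _ _ (emb_mem_span (by simp) hf1)
    · exact emb_mem_span (by simp) hf0
  have hndvd : ¬ f ∣ pderiv 2 f * q 2 := by
    intro h
    rcases hf.prime.dvd_or_dvd h with h | h
    · exact hfW h
    · exact hq2 h
  have hhd : (pderiv 2 f * q 2).totalDegree ≤ 11 * d := by
    have := totalDegree_mul (pderiv 2 f) (q 2)
    have := hqd 2
    omega
  refine ⟨pderiv 2 f * q 2, hndvd, hhd, ?_⟩
  by_cases hcv : CrossVanish f (pderiv 2 f * q 2)
  · exact Or.inl hcv
  unfold CrossVanish at hcv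
  push Not at hcv
  obtain ⟨l, l', t, hl, hl', hne, hpt, hnz⟩ := hcv
  rw [map_mul] at hnz
  obtain ⟨Q, hQ0, hQ2, hfQ⟩ := exists_quadric_multiple hf hruled hl hl' hne hpt
    (left_ne_zero_of_mul hnz) (right_ne_zero_of_mul hnz)
  have := totalDegree_le_of_dvd hfQ hQ0
  have hd2 : d = 2 := by omega
  have hqd' : ∀ k, (q k).totalDegree ≤ 6 := fun k => (hqd k).trans (by omega)
  exact Or.inr (Or.inr ⟨hd2, q 0, q 1, q 2, hqd' 0, hqd' 1, hqd' 2, rfl, hruled⟩)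

/-- The base points of `l` and `l'` differ in both coordinates. -/
def ND (l l' : Line) : Prop := l.1.1 ≠ l'.1.1 ∧ l.1.2 ≠ l'.1.2

lemma card_le_of_roots {g : Polynomial ℝ} (hg : g ≠ 0) {T : Finset ℝ}
    (h : ∀ t ∈ T, g.eval t = 0) : T.card ≤ g.natDegree := by
  by_contra hcon
  exact hg (Polynomial.eq_zero_of_natDegree_lt_card_of_eval_eq_zero' g T h (by omega))

lemma cross_unique {l l' : Line} (h : l.1.1 ≠ l'.1.1) {a b : ℝ} (ha : pt l' a = pt l a)
    (hb : pt l' b = pt l b) : a = b := by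
  by_contra hab
  exact h (slope_eq_of_two_points hab ha.symm hb.symm)

lemma plane_sub {f : P3} (hd : f.totalDegree = 1) (x y : Fin 3 → ℝ) :
    eval x f - eval y f = ∑ i, eval 0 (pderiv i f) * (x i - y i) := by
  have hg : ∀ i z, eval z (pderiv i f) = eval 0 (pderiv i f) := by
    intro i z
    have h0 := totalDegree_pderiv_le i f
    have h1 : (pderiv i f).totalDegree = 0 := by omega
    rw [totalDegree_eq_zero_iff_eq_C] at h1
    rw [h1]; simp
  set v : Fin 3 → ℝ := fun i => x i - y i with hv
  set s := ∑ i, eval 0 (pderiv i f) * (x i - y i) with hs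
  have hder : Polynomial.derivative (alongLine y v f - Polynomial.C s * Polynomial.X) = 0 := by
    apply eq_zero_of_eval_zero
    intro t
    rw [Polynomial.derivative_sub, derivative_alongLine, Polynomial.eval_sub,
      Polynomial.eval_finsetSum]
    simp only [Polynomial.eval_mul, Polynomial.eval_C, eval_alongLine, hg]
    simp [hs, hv, Fin.sum_univ_three]
    ring
  have hc := Polynomial.eq_C_of_derivative_eq_zero hder
  have h0 := congrArg (Polynomial.eval 0) hc
  have h1 := congrArg (Polynomial.eval 1) hc
  simp only [Polynomial.eval_sub, Polynomial.eval_mul, Polynomial.eval_C, Polynomial.eval_X,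
    eval_alongLine] at h0 h1
  have e0 : (fun i => y i + v i * 0) = y := by funext i; simp
  have e1 : (fun i => y i + v i * 1) = x := by funext i; simp [hv]
  rw [e0] at h0
  rw [e1] at h1
  linarith

lemma plane_line_unique {f : P3} (hf : f ≠ 0) (hd : f.totalDegree = 1) {l l' l'' : Line}
    (hl : restr l f = 0) (hl' : restr l' f = 0) (hl'' : restr l'' f = 0) (hnd : ND l l')
    {t : ℝ} (ht : pt l' t = pt l t) (hp : l'.1 = l''.1) : l' = l'' := by
  rw [restr_eq_zero_iff] at hl hl' hl''
  have hq : l.2.2 ≠ l'.2.2 := by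
    intro e
    have := congrFun ht 2
    simp [pt, e] at this
    exact hnd.2 this.symm
  have key : ∀ m : Line, (∀ t, eval (pt m t) f = 0) → eval 0 (pderiv 0 f) -
      eval 0 (pderiv 1 f) * m.1.1 + eval 0 (pderiv 2 f) * m.2.2 = 0 := by
    intro m hm
    have := plane_sub hd (pt m 1) (pt m 0)
    rw [hm, hm, Fin.sum_univ_three] at this
    simp [pt] at this ⊢
    linarith
  have h1 := key l hl
  have h2 := key l' hl'
  have h3 := key l'' hl''
  rw [← hp] at h3
  set a := eval 0 (pderiv 0 f)
  set b := eval 0 (pderiv 1 f)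
  set c := eval 0 (pderiv 2 f)
  have hbc : b * (l'.1.1 - l.1.1) = c * (l'.2.2 - l.2.2) := by linarith
  have hne : ¬ (b = 0 ∧ c = 0) := by
    rintro ⟨hb, hc⟩
    have ha : a = 0 := by rw [hb, hc] at h1; linarith
    apply hf
    apply MvPolynomial.funext
    intro x
    rw [map_zero]
    have := plane_sub hd x (pt l 0)
    rw [hl, Fin.sum_univ_three] at this
    change _ = a * _ + b * _ + c * _ at this
    rw [ha, hb, hc] at this
    linarith
  have hb : b ≠ 0 := by
    intro hb
    rw [hb, zero_mul] at hbc
    exact hne ⟨hb, (mul_eq_zero.1 hbc.symm).resolve_right (sub_ne_zero.2 hq.symm)⟩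
  have hc : c ≠ 0 := by
    intro hc
    rw [hc, zero_mul] at hbc
    exact hne ⟨(mul_eq_zero.1 hbc).resolve_right (sub_ne_zero.2 hnd.1.symm), hc⟩
  have e2 : l'.2.2 = l''.2.2 := mul_left_cancel₀ hc (by linarith)
  have h4 := plane_sub hd (pt l' 0) (pt l'' 0)
  rw [hl', hl'', Fin.sum_univ_three] at h4
  change _ = a * _ + b * _ + c * _ at h4
  simp [pt, hp] at h4
  have e1 : l'.2.1 = l''.2.1 := sub_eq_zero.1 (h4.resolve_left hb)
  exact Prod.ext hp (Prod.ext e1 e2)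

lemma card_cross_quadric {f q0 q1 q2 : P3} (hd : f.totalDegree = 2) (h0 : q0.totalDegree ≤ 6)
    (h1 : q1.totalDegree ≤ 6) (h2 : q2.totalDegree ≤ 6) (hr : Ruled f q0 q1 q2)
    {A B : Finset Pt} {n : ℕ} (hA : A.card ≤ n) (hB : B.card ≤ n) {l : Line}
    (hl : restr l f = 0) (hh : restr l (pderiv 2 f * q2) ≠ 0) {T : Finset ℝ} {m : ℝ → Line}
    (hm : ∀ t ∈ T, m t ∈ A ×ˢ B ∧ ND l (m t) ∧ pt (m t) t = pt l t ∧ restr (m t) f = 0) :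
    T.card ≤ 7 * n := by
  classical
  set E : Pt → P3 := fun p => X 0 * pderiv 0 f - C p.1 * X 0 * pderiv 1 f +
    (X 2 + C p.2) * pderiv 2 f with hE
  set Q : Pt → P3 := fun p => q0 + C p.1 * q1 + C (p.1 ^ 2) * q2 with hQ
  have hEd : ∀ p, (E p).totalDegree ≤ 6 := by
    intro p
    have hp := fun i => totalDegree_pderiv_le i f
    have hXC : (X 2 + C p.2 : P3).totalDegree ≤ 1 :=
      (totalDegree_add _ _).trans (max_le (by simp) (by simp))
    have hCX : (C p.1 * X 0 : P3).totalDegree ≤ 1 := (totalDegree_mul _ _).trans (by simp)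
    refine (totalDegree_add _ _).trans (max_le ((totalDegree_sub _ _).trans (max_le ?_ ?_)) ?_)
    · refine (totalDegree_mul _ _).trans ?_
      have := hp 0
      simp; omega
    · refine (totalDegree_mul _ _).trans ?_
      have := hp 1
      omega
    · refine (totalDegree_mul _ _).trans ?_
      have := hp 2
      omega
  have hQd : ∀ p, (Q p).totalDegree ≤ 6 := by
    intro p
    refine (totalDegree_add _ _).trans (max_le ((totalDegree_add _ _).trans (max_le h0 ?_)) ?_)
    · exact (totalDegree_mul _ _).trans (by rw [totalDegree_C, zero_add]; exact h1)
    · exact (totalDegree_mul _ _).trans (by rw [totalDegree_C, zero_add]; exact h2)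
  have hEz : ∀ t ∈ T, (restr l (E (m t).1)).eval t = 0 := by
    intro t ht
    obtain ⟨-, -, hpt, hz⟩ := hm t ht
    have h3 := tangent_of_restr_eq_zero hz t
    rw [hpt] at h3
    have h4 := congrFun hpt 2
    have h5 : pt l t 0 = t := by simp [pt]
    have h6 : pt (m t) t 2 = (m t).2.2 * t - (m t).1.2 := by simp [pt]
    rw [eval_restr]
    simp only [hE, map_add, map_sub, map_mul, eval_X, eval_C]
    rw [h5, ← h4, h6]
    linear_combination t * h3
  have hQz : ∀ t ∈ T, (restr l (Q (m t).1)).eval t = 0 := by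
    intro t ht
    obtain ⟨-, -, hpt, hz⟩ := hm t ht
    have h3 := hr.root _ hz t
    rw [hpt] at h3
    rw [eval_restr]
    simp only [hQ, map_add, map_mul, eval_C]
    linear_combination h3
  set Sp : Finset Pt := A.filter fun p => p.1 ≠ l.1.1 ∧ restr l (E p) = 0 ∧ restr l (Q p) = 0
    with hSp
  have hSp1 : Sp.card ≤ 1 := by
    rw [Finset.card_le_one]
    intro p hp p' hp'
    rw [hSp, Finset.mem_filter] at hp hp'
    obtain ⟨-, hp1, hpE, hpQ⟩ := hp
    obtain ⟨-, hp1', hpE', hpQ'⟩ := hp'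
    have : ∃ t, (restr l (pderiv 2 f * q2)).eval t ≠ 0 := by
      by_contra hcon
      push Not at hcon
      exact hh (eq_zero_of_eval_zero hcon)
    obtain ⟨t, ht⟩ := this
    rw [eval_restr, map_mul] at ht
    have hW := left_ne_zero_of_mul ht
    have hq2 := right_ne_zero_of_mul ht
    rw [restr_eq_zero_iff] at hpE hpQ hpE' hpQ'
    have a1 := hpE t
    have a2 := hpE' t
    have b1 := hpQ t
    have b2 := hpQ' t
    have b3 := hr.root l hl t
    simp only [hE, hQ, map_add, map_sub, map_mul, eval_X, eval_C] at a1 a2 b1 b2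
    have c1 : eval (pt l t) q1 + eval (pt l t) q2 * (p.1 + l.1.1) = 0 := by
      apply mul_left_cancel₀ (sub_ne_zero.2 hp1)
      linear_combination b1 - b3
    have c2 : eval (pt l t) q1 + eval (pt l t) q2 * (p'.1 + l.1.1) = 0 := by
      apply mul_left_cancel₀ (sub_ne_zero.2 hp1')
      linear_combination b2 - b3
    have e1 : p.1 = p'.1 := by
      apply mul_left_cancel₀ hq2
      linear_combination c1 - c2
    rw [e1] at a1
    exact Prod.ext e1 (mul_left_cancel₀ hW (by linear_combination a1 - a2))
  have hfib : ∀ p ∈ A, (T.filter fun t => (m t).1 = p).card ≤ 6 + if p ∈ Sp then n else 0 := by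
    intro p hp
    rcases (T.filter fun t => (m t).1 = p).eq_empty_or_nonempty with he | ⟨t₀, ht₀⟩
    · rw [he]; simp
    by_cases hE0 : restr l (E p) = 0
    · by_cases hQ0 : restr l (Q p) = 0
      · have hmem : p ∈ Sp := by
          rw [Finset.mem_filter] at ht₀
          rw [hSp, Finset.mem_filter]
          refine ⟨hp, ?_, hE0, hQ0⟩
          rw [← ht₀.2]
          exact (hm t₀ ht₀.1).2.1.1.symm
        rw [if_pos hmem]
        have : (T.filter fun t => (m t).1 = p).card ≤ B.card := by
          apply Finset.card_le_card_of_injOn fun t => (m t).2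
          · intro t ht
            rw [Finset.mem_coe, Finset.mem_filter] at ht
            exact (Finset.mem_product.1 (hm t ht.1).1).2
          · intro a ha b hb hab
            rw [Finset.mem_coe, Finset.mem_filter] at ha hb
            have e : m a = m b := Prod.ext (ha.2.trans hb.2.symm) hab
            have h3 := hm a ha.1
            have h4 := hm b hb.1
            rw [← e] at h4
            exact cross_unique h3.2.1.1 h3.2.2.1 h4.2.2.1
        omega
      · have := card_le_of_roots hQ0 (T := T.filter fun t => (m t).1 = p) (by
          intro t ht
          rw [Finset.mem_filter] at ht
          rw [← ht.2]; exact hQz t ht.1)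
        have := natDegree_restr_le l (Q p)
        have := hQd p
        omega
    · have := card_le_of_roots hE0 (T := T.filter fun t => (m t).1 = p) (by
        intro t ht
        rw [Finset.mem_filter] at ht
        rw [← ht.2]; exact hEz t ht.1)
      have := natDegree_restr_le l (E p)
      have := hEd p
      omega
  rw [Finset.card_eq_sum_card_fiberwise (f := fun t => (m t).1) (t := A)
    (fun t ht => (Finset.mem_product.1 (hm t ht).1).1)]
  refine (Finset.sum_le_sum hfib).trans ?_
  rw [Finset.sum_add_distrib, ← Finset.sum_filter]
  simp only [Finset.sum_const, smul_eq_mul]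
  have h5 : (A.filter fun p => p ∈ Sp).card ≤ 1 :=
    (Finset.card_le_card fun p hp => (Finset.mem_filter.1 hp).2).trans hSp1
  nlinarith

lemma card_cross_le {f h : P3} (hf : Irreducible f) (hhd : h.totalDegree ≤ 11 * f.totalDegree)
    (hh : CrossVanish f h ∨ f.totalDegree = 1 ∨ (f.totalDegree = 2 ∧ ∃ q0 q1 q2 : P3,
        q0.totalDegree ≤ 6 ∧ q1.totalDegree ≤ 6 ∧ q2.totalDegree ≤ 6 ∧ h = pderiv 2 f * q2 ∧
        Ruled f q0 q1 q2))
    {A B : Finset Pt} {n : ℕ} (hA : A.card ≤ n) (hB : B.card ≤ n) {l : Line}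
    (hl : restr l f = 0) (hlh : restr l h ≠ 0) {T : Finset ℝ} {m : ℝ → Line}
    (hm : ∀ t ∈ T, m t ∈ A ×ˢ B ∧ ND l (m t) ∧ pt (m t) t = pt l t ∧ restr (m t) f = 0) :
    T.card ≤ 11 * f.totalDegree + 7 * n := by
  rcases hh with hcv | hd | ⟨hd, q0, q1, q2, h0, h1, h2, rfl, hr⟩
  · have := card_le_of_roots hlh (T := T) (by
      intro t ht
      obtain ⟨-, hnd, hpt, hz⟩ := hm t ht
      rw [eval_restr]
      exact hcv l (m t) t hl hz hnd.1 hpt.symm)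
    have := natDegree_restr_le l h
    omega
  · have : T.card ≤ A.card := by
      apply Finset.card_le_card_of_injOn fun t => (m t).1
      · intro t ht
        exact (Finset.mem_product.1 (hm t ht).1).1
      · intro a ha b hb hab
        have h3 := hm a ha
        have h4 := hm b hb
        rw [← plane_line_unique hf.ne_zero hd hl h3.2.2.2 h4.2.2.2 h3.2.1 h3.2.2.1 hab] at h4
        exact cross_unique h3.2.1.1 h3.2.2.1 h4.2.2.1
    omega
  · have := card_cross_quadric hd h0 h1 h2 hr hA hB hl hlh hm
    omega

lemma exists_factors (f : P3) (hf : f ≠ 0) : ∃ F : Finset P3, (∀ g ∈ F, Irreducible g) ∧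
    (∀ g ∈ F, ∀ h ∈ F, g ≠ h → ¬ g ∣ h) ∧ ∑ g ∈ F, g.totalDegree ≤ f.totalDegree ∧
    ∀ l, restr l f = 0 → ∃ g ∈ F, restr l g = 0 := by
  classical
  induction f using WfDvdMonoid.induction_on_irreducible with
  | zero => contradiction
  | unit u hu =>
    refine ⟨∅, by simp, by simp, by simp, fun l hl => ?_⟩
    have := hu.map (restr l)
    rw [hl] at this
    exact absurd this not_isUnit_zero
  | mul a i ha hi ih =>
    obtain ⟨F, h1, h2, h3, h4⟩ := ih ha
    have hdeg : (i * a).totalDegree = i.totalDegree + a.totalDegree :=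
      totalDegree_mul_of_isDomain hi.ne_zero ha
    by_cases hex : ∃ g ∈ F, Associated g i
    · obtain ⟨g, hgF, hgi⟩ := hex
      refine ⟨F, h1, h2, by omega, fun l hl => ?_⟩
      rw [map_mul, mul_eq_zero] at hl
      rcases hl with hl | hl
      · refine ⟨g, hgF, ?_⟩
        have := map_dvd (restr l) hgi.symm.dvd
        rw [hl] at this
        exact zero_dvd_iff.1 this
      · exact h4 l hl
    · push Not at hex
      have hi_not : i ∉ F := fun h => hex i h (Associated.refl i)
      refine ⟨insert i F, ?_, ?_, ?_, fun l hl => ?_⟩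
      · intro g hg
        rcases Finset.mem_insert.1 hg with rfl | hg
        · exact hi
        · exact h1 g hg
      · intro g hg h hh hne hdvd
        rcases Finset.mem_insert.1 hg with rfl | hg' <;>
          rcases Finset.mem_insert.1 hh with rfl | hh'
        · exact hne rfl
        · exact hex h hh' (hi.associated_of_dvd (h1 h hh') hdvd).symm
        · exact hex g hg' ((h1 g hg').associated_of_dvd hi hdvd)
        · exact h2 g hg' h hh' hne hdvd
      · rw [Finset.sum_insert hi_not]; omega
      · rw [map_mul, mul_eq_zero] at hl
        rcases hl with hl | hl
        · exact ⟨i, Finset.mem_insert_self _ _, hl⟩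
        · obtain ⟨g, hg, hgl⟩ := h4 l hl
          exact ⟨g, Finset.mem_insert_of_mem hg, hgl⟩

lemma exists_vanishing_of_rich (D m : ℕ) (S : Finset Line) (Tl : Line → Finset ℝ)
    (M : Line → ℝ → Line) (hcard : ∀ l ∈ S, m ≤ (Tl l).card)
    (hM : ∀ l ∈ S, ∀ t ∈ Tl l, M l t ∈ S ∧ ND l (M l t) ∧ pt (M l t) t = pt l t)
    (hD : 3 * S.card < (D + 3) * (m + 1)) :
    ∃ f : P3, f ≠ 0 ∧ f.totalDegree ≤ D ∧ ∀ l ∈ S, restr l f = 0 := by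
  classical
  set Par : Line → Finset Line := fun l => if l ∈ S then (Tl l).image (M l) else ∅ with hPar
  have hmem : ∀ l l', l' ∈ Par l → l ∈ S ∧ ∃ t ∈ Tl l, M l t = l' := by
    intro l l' h
    by_cases hl : l ∈ S
    · simp only [hPar, if_pos hl] at h
      exact ⟨hl, Finset.mem_image.1 h⟩
    · simp [hPar, if_neg hl] at h
  set τ : Line → Line → ℝ := fun l l' => (l.2.1 - l'.2.1) / (l.1.1 - l'.1.1) with hτ
  have hτe : ∀ l ∈ S, ∀ t ∈ Tl l, τ l (M l t) = t := by
    intro l hl t ht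
    obtain ⟨-, hnd, hpt⟩ := hM l hl t ht
    have := congrFun hpt 1
    simp [pt] at this
    simp only [hτ]
    rw [div_eq_iff (sub_ne_zero.2 hnd.1)]
    linarith
  have hinj : ∀ l ∈ S, Set.InjOn (M l) (Tl l) := by
    intro l hl a ha b hb hab
    rw [← hτe l hl a ha, ← hτe l hl b hb, hab]
  apply exists_poly_vanishing D m S Par (τ := τ) _ _ _ _ _ hD
  · intro l hl
    obtain ⟨hS, t, ht, e⟩ := hmem l l hl
    have := (hM l hS t ht).2.1.1
    rw [e] at this
    exact this rfl
  · intro l l' h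
    obtain ⟨hS, t, ht, rfl⟩ := hmem l l' h
    exact (hM l hS t ht).1
  · intro l hl
    simp only [hPar, if_pos hl]
    rw [Finset.card_image_of_injOn (hinj l hl)]
    exact hcard l hl
  · intro l a ha b hb hab
    obtain ⟨hS, t, ht, rfl⟩ := hmem l a ha
    obtain ⟨-, t', ht', rfl⟩ := hmem l b hb
    rw [hτe l hS t ht, hτe l hS t' ht'] at hab
    rw [hab]
  · intro l l' h
    obtain ⟨hS, t, ht, rfl⟩ := hmem l l' h
    exact ⟨t, by rw [hτe l hS t ht]; exact (hM l hS t ht).2.2⟩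

lemma exists_poor_line {A B : Finset Pt} {n : ℕ} (hA : A.card ≤ n) (hB : B.card ≤ n)
    {S : Finset Line} (hS : S ⊆ A ×ˢ B) (hne : S.Nonempty) :
    ∃ l ∈ S, ∀ T : Finset ℝ, (∀ t ∈ T, ∃ l' ∈ S, ND l l' ∧ pt l' t = pt l t) →
      T.card ≤ 12 * n := by
  classical
  by_contra hcon
  push Not at hcon
  have h1 : ∀ l, ∃ T : Finset ℝ, ∃ M : ℝ → Line, l ∈ S → 12 * n < T.card ∧
      ∀ t ∈ T, M t ∈ S ∧ ND l (M t) ∧ pt (M t) t = pt l t := by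
    intro l
    by_cases hl : l ∈ S
    · obtain ⟨T, hT, hTc⟩ := hcon l hl
      choose! M hM using hT
      exact ⟨T, M, fun _ => ⟨hTc, hM⟩⟩
    · exact ⟨∅, fun _ => l, fun h => absurd h hl⟩
  choose Tl M hTM using h1
  have hScard : S.card ≤ n * n :=
    (Finset.card_le_card hS).trans (by rw [Finset.card_product]; exact Nat.mul_le_mul hA hB)
  have hSpos := hne.card_pos
  have hn : 0 < n := by
    by_contra h
    have : n = 0 := by omega
    subst this; omega
  set D := 3 * S.card / (12 * n + 2) with hD
  have hDle : D * (12 * n + 2) ≤ 3 * S.card := Nat.div_mul_le_self _ _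
  have hDlt : 3 * S.card < (D + 1) * (12 * n + 2) := by
    have := Nat.lt_div_mul_add (a := 3 * S.card) (b := 12 * n + 2) (by omega)
    rw [← hD] at this
    linarith
  obtain ⟨f, hf0, hfd, hfS⟩ := exists_vanishing_of_rich D (12 * n + 1) S Tl M
    (fun l hl => (hTM l hl).1) (fun l hl => (hTM l hl).2) (by nlinarith)
  obtain ⟨F, hFirr, hFdvd, hFd, hFl⟩ := exists_factors f hf0
  have hDF : ∑ g ∈ F, g.totalDegree ≤ D := hFd.trans hfd
  have hw : ∀ g : P3, ∃ h : P3, Irreducible g → ¬ g ∣ h ∧ h.totalDegree ≤ 11 * g.totalDegree ∧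
      (CrossVanish g h ∨ g.totalDegree = 1 ∨ (g.totalDegree = 2 ∧ ∃ q0 q1 q2 : P3,
        q0.totalDegree ≤ 6 ∧ q1.totalDegree ≤ 6 ∧ q2.totalDegree ≤ 6 ∧ h = pderiv 2 g * q2 ∧
        Ruled g q0 q1 q2)) := by
    intro g
    by_cases hg : Irreducible g
    · obtain ⟨h, hh⟩ := exists_witness hg
      exact ⟨h, fun _ => hh⟩
    · exact ⟨0, fun h => absurd h hg⟩
  choose H hH using hw
  set P : P3 × P3 → P3 := fun z => if z.1 = z.2 then H z.1 else z.2 with hP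
  have hPz : ∀ z ∈ F ×ˢ F, ¬ z.1 ∣ P z ∧ (P z).totalDegree ≤ 11 * z.2.totalDegree := by
    rintro ⟨g, k⟩ hz
    rw [Finset.mem_product] at hz
    by_cases h : g = k
    · subst h
      simp only [hP, if_true]
      exact ⟨(hH g (hFirr g hz.1)).1, (hH g (hFirr g hz.1)).2.1⟩
    · simp only [hP, if_neg h]
      exact ⟨hFdvd g hz.1 k hz.2 h, by omega⟩
  set Bad := (F ×ˢ F).biUnion fun z => S.filter fun l => restr l z.1 = 0 ∧ restr l (P z) = 0
    with hBad
  have hBadc : Bad.card ≤ 11 * (D * D) := by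
    have h2 : Bad.card ≤ ∑ z ∈ F ×ˢ F, z.1.totalDegree * (11 * z.2.totalDegree) := by
      refine Finset.card_biUnion_le.trans (Finset.sum_le_sum fun z hz => ?_)
      have h3 := hPz z hz
      have h4 := hFirr z.1 (Finset.mem_product.1 hz).1
      refine (card_lines_le h4 h3.1 _ ?_ ?_).trans (Nat.mul_le_mul_left _ h3.2)
      · intro l hl; exact (Finset.mem_filter.1 hl).2.1
      · intro l hl; exact (Finset.mem_filter.1 hl).2.2
    have h5 : ∑ z ∈ F ×ˢ F, z.1.totalDegree * (11 * z.2.totalDegree) =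
        11 * ((∑ g ∈ F, g.totalDegree) * ∑ g ∈ F, g.totalDegree) := by
      rw [Finset.sum_mul_sum, Finset.sum_product, Finset.mul_sum]
      refine Finset.sum_congr rfl fun g _ => ?_
      rw [Finset.mul_sum]
      exact Finset.sum_congr rfl fun k _ => by ring
    rw [h5] at h2
    exact h2.trans (Nat.mul_le_mul_left _ (Nat.mul_le_mul hDF hDF))
  have hDn : 12 * D ≤ 3 * n := by
    have : 12 * D * n ≤ 3 * n * n := by nlinarith
    exact Nat.le_of_mul_le_mul_right this hn
  have hBadlt : Bad.card < S.card := by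
    refine lt_of_le_of_lt hBadc ?_
    have : 11 * (D * D) * n < S.card * n := by
      have h6 : 12 * D * D ≤ 3 * n * D := Nat.mul_le_mul_right _ hDn
      have h7 : 0 < S.card * n := Nat.mul_pos hSpos hn
      have h8 : 12 * D * D * (12 * n + 2) ≤ 3 * n * (3 * S.card) := by
        calc 12 * D * D * (12 * n + 2) ≤ 3 * n * D * (12 * n + 2) := Nat.mul_le_mul_right _ h6
          _ = 3 * n * (D * (12 * n + 2)) := by ring
          _ ≤ _ := Nat.mul_le_mul_left _ hDle
      nlinarith
    exact lt_of_mul_lt_mul_right this (Nat.zero_le n)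
  obtain ⟨l, hlS, hlB⟩ := Finset.exists_mem_notMem_of_card_lt_card hBadlt
  obtain ⟨g, hgF, hgl⟩ := hFl l (hfS l hlS)
  have hgood : ∀ k ∈ F, restr l (P (g, k)) ≠ 0 := by
    intro k hk h
    apply hlB
    rw [hBad, Finset.mem_biUnion]
    exact ⟨(g, k), Finset.mem_product.2 ⟨hgF, hk⟩, Finset.mem_filter.2 ⟨hlS, hgl, h⟩⟩
  have hHg : restr l (H g) ≠ 0 := by simpa [hP] using hgood g hgF
  obtain ⟨hTc, hTm⟩ := hTM l hlS
  set R : Polynomial ℝ := ∏ k ∈ F.erase g, restr l k with hR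
  have hR0 : R ≠ 0 := by
    rw [hR, Finset.prod_ne_zero_iff]
    intro k hk
    obtain ⟨hne, hkF⟩ := Finset.mem_erase.1 hk
    simpa [hP, hne.symm] using hgood k hkF
  have hRd : R.natDegree ≤ D := by
    refine (Polynomial.natDegree_prod_le _ _).trans (le_trans ?_ hDF)
    exact (Finset.sum_le_sum fun k _ => natDegree_restr_le l k).trans
      (Finset.sum_le_sum_of_subset (Finset.erase_subset _ _))
  have hc1 : ((Tl l).filter fun t => R.eval t = 0).card ≤ D :=
    (card_le_of_roots hR0 fun t ht => (Finset.mem_filter.1 ht).2).trans hRd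
  have hgd : g.totalDegree ≤ D := (Finset.single_le_sum (f := fun g : P3 => g.totalDegree)
    (fun _ _ => Nat.zero_le _) hgF).trans hDF
  have hc2 : ((Tl l).filter fun t => ¬ R.eval t = 0).card ≤ 11 * g.totalDegree + 7 * n := by
    apply card_cross_le (hFirr g hgF) (hH g (hFirr g hgF)).2.1 (hH g (hFirr g hgF)).2.2 hA hB hgl hHg
      (m := M l)
    intro t ht
    rw [Finset.mem_filter] at ht
    obtain ⟨hmS, hnd, hpt⟩ := hTm t ht.1
    refine ⟨hS hmS, hnd, hpt, ?_⟩
    obtain ⟨k, hkF, hk⟩ := hFl _ (hfS _ hmS)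
    by_cases hkg : k = g
    · rwa [← hkg]
    · exfalso
      apply ht.2
      rw [hR, Polynomial.eval_prod]
      apply Finset.prod_eq_zero (Finset.mem_erase.2 ⟨hkg, hkF⟩)
      rw [eval_restr, ← hpt, (restr_eq_zero_iff _ _).1 hk]
  have := Finset.card_filter_add_card_filter_not (s := Tl l) (fun t => R.eval t = 0)
  omega

/-- The two-rich case of the incidence bound. -/
theorem card_crossings_le {A B : Finset Pt} {n : ℕ} (hA : A.card ≤ n) (hB : B.card ≤ n)
    (G : Finset (Fin 3 → ℝ)) (hG : ∀ x ∈ G, ∃ l ∈ A ×ˢ B, ∃ l' ∈ A ×ˢ B, ND l l' ∧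
      pt l (x 0) = x ∧ pt l' (x 0) = x) : G.card ≤ 12 * n ^ 3 := by
  classical
  have key : ∀ (k : ℕ) (S : Finset Line), S.card = k → S ⊆ A ×ˢ B → ∀ G : Finset (Fin 3 → ℝ),
      (∀ x ∈ G, ∃ l ∈ S, ∃ l' ∈ S, ND l l' ∧ pt l (x 0) = x ∧ pt l' (x 0) = x) →
      G.card ≤ 12 * n * k := by
    intro k
    induction k with
    | zero =>
      intro S hS _ G hG
      rw [Finset.card_eq_zero] at hS
      subst hS
      have : G = ∅ := Finset.eq_empty_of_forall_notMem fun x hx => by simpa using hG x hx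
      simp [this]
    | succ k ih =>
      intro S hS hSA G hG
      obtain ⟨l, hl, hpoor⟩ := exists_poor_line hA hB hSA (Finset.card_pos.1 (by omega))
      set p : (Fin 3 → ℝ) → Prop := fun x => ∃ l' ∈ S, ND l l' ∧ pt l (x 0) = x ∧ pt l' (x 0) = x
        with hp
      have h1 : (G.filter p).card ≤ 12 * n := by
        have hinj : Set.InjOn (fun x : Fin 3 → ℝ => x 0) (G.filter p) := by
          intro x hx y hy hxy
          obtain ⟨-, l₁, -, -, e, -⟩ := Finset.mem_filter.1 hx
          obtain ⟨-, l₂, -, -, e', -⟩ := Finset.mem_filter.1 hy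
          dsimp only at hxy
          rw [← e, ← e', hxy]
        rw [← Finset.card_image_of_injOn hinj]
        apply hpoor
        intro t ht
        obtain ⟨x, hx, rfl⟩ := Finset.mem_image.1 ht
        obtain ⟨-, l', hl', hnd, e, e'⟩ := Finset.mem_filter.1 hx
        exact ⟨l', hl', hnd, e'.trans e.symm⟩
      have h2 : (G.filter fun x => ¬ p x).card ≤ 12 * n * k := by
        apply ih (S.erase l) (by rw [Finset.card_erase_of_mem hl, hS]; rfl)
          ((Finset.erase_subset _ _).trans hSA)
        intro x hx
        rw [Finset.mem_filter] at hx
        obtain ⟨a, ha, b, hb, hnd, ea, eb⟩ := hG x hx.1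
        refine ⟨a, Finset.mem_erase.2 ⟨?_, ha⟩, b, Finset.mem_erase.2 ⟨?_, hb⟩, hnd, ea, eb⟩
        · rintro rfl
          exact hx.2 ⟨b, hb, hnd, ea, eb⟩
        · rintro rfl
          exact hx.2 ⟨a, ha, ⟨hnd.1.symm, hnd.2.symm⟩, eb, ea⟩
      rw [← Finset.card_filter_add_card_filter_not p]
      rw [mul_add, mul_one]
      omega
  refine (key _ _ rfl le_rfl G hG).trans ?_
  have : (A ×ˢ B).card ≤ n * n := by rw [Finset.card_product]; exact Nat.mul_le_mul hA hB
  calc 12 * n * (A ×ˢ B).card ≤ 12 * n * (n * n) := Nat.mul_le_mul_left _ this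
    _ = _ := by ring

/-- Parameters `(λ, s, u)` of a transformation preserving rectangular areas. -/
abbrev Mot := ℝ × ℝ × ℝ

def Rel (g : Mot) (z : Line) : Prop :=
  z.2.1 = g.1 * z.1.1 + g.2.1 ∧ g.1 * z.2.2 = z.1.2 + g.2.2

theorem card_motions_le {A B : Finset Pt} {n : ℕ} (hA : A.card ≤ n) (hB : B.card ≤ n)
    (G : Finset Mot) (hG : ∀ g ∈ G, ∃ z ∈ A ×ˢ B, ∃ z' ∈ A ×ˢ B, ND z z' ∧ Rel g z ∧ Rel g z') :
    G.card ≤ 12 * n ^ 3 := by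
  classical
  set φ : Mot → Fin 3 → ℝ := fun g => ![g.1, g.2.1, g.2.2] with hφ
  have hinj : Function.Injective φ := by
    intro g h e
    have e0 := congrFun e 0
    have e1 := congrFun e 1
    have e2 := congrFun e 2
    simp [hφ] at e0 e1 e2
    exact Prod.ext e0 (Prod.ext e1 e2)
  have hpt : ∀ g z, Rel g z → pt z (φ g 0) = φ g := by
    intro g z hz
    funext i
    have h1 := hz.1
    have h2 := hz.2
    fin_cases i <;> simp [pt, hφ] <;> linarith
  rw [← Finset.card_image_of_injective G hinj]
  apply card_crossings_le hA hB
  intro x hx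
  obtain ⟨g, hg, rfl⟩ := Finset.mem_image.1 hx
  obtain ⟨z, hz, z', hz', hnd, h1, h2⟩ := hG g hg
  exact ⟨z, hz, z', hz', hnd, hpt g z h1, hpt g z' h2⟩

lemma card_image_chain_le {ι κ : Type*} [Fintype κ] [DecidableEq κ] (s : Finset ι)
    (f : ι → κ → ℕ) (X : κ → ℕ) (hX : ∀ i ∈ s, ∀ a, f i a ≤ X a)
    (hf : ∀ i ∈ s, ∀ j ∈ s, f i ≤ f j ∨ f j ≤ f i) : (s.image f).card ≤ ∑ a, X a + 1 := by
  have key : ∀ i j, f i ≤ f j → ∑ a, f i a = ∑ a, f j a → f i = f j := by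
    intro i j hij e
    funext a
    exact (Finset.sum_eq_sum_iff_of_le fun a _ => hij a).1 e a (Finset.mem_univ a)
  have : (s.image f).card ≤ (Finset.range (∑ a, X a + 1)).card := by
    apply Finset.card_le_card_of_injOn fun v => ∑ a, v a
    · intro v hv
      obtain ⟨i, hi, rfl⟩ := Finset.mem_image.1 hv
      rw [Finset.mem_coe, Finset.mem_range, Nat.lt_succ_iff]
      exact Finset.sum_le_sum fun a _ => hX i hi a
    · intro v hv w hw e
      obtain ⟨i, hi, rfl⟩ := Finset.mem_image.1 hv
      obtain ⟨j, hj, rfl⟩ := Finset.mem_image.1 hw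
      rcases hf i hi j hj with h | h
      · exact key i j h e
      · exact (key j i h e.symm).symm
  rwa [Finset.card_range] at this

section Rank

variable {α : Type*} [LinearOrder α]

def rank (s : Finset α) (a : α) : ℕ := (s.filter (· < a)).card

lemma rank_mono (s : Finset α) : Monotone (rank s) := fun _ _ h =>
  Finset.card_le_card (Finset.monotone_filter_right s fun _ _ hx => lt_of_lt_of_le hx h)

lemma rank_lt (s : Finset α) {a b : α} (ha : a ∈ s) (h : a < b) : rank s a < rank s b := by
  apply Finset.card_lt_card
  refine Finset.ssubset_iff_subset_ne.2 ⟨fun x hx => ?_, fun e => ?_⟩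
  · rw [Finset.mem_filter] at hx ⊢
    exact ⟨hx.1, hx.2.trans h⟩
  · have : a ∈ s.filter (· < b) := Finset.mem_filter.2 ⟨ha, h⟩
    rw [← e, Finset.mem_filter] at this
    exact lt_irrefl a this.2

lemma rank_injOn (s : Finset α) : Set.InjOn (rank s) s := by
  intro a ha b hb e
  rcases lt_trichotomy a b with h | h | h
  · exact absurd e (rank_lt s ha h).ne
  · exact h
  · exact absurd e (rank_lt s hb h).ne'

lemma rank_lt_card (s : Finset α) {a : α} (ha : a ∈ s) : rank s a < s.card := by
  apply Finset.card_lt_card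
  refine Finset.ssubset_iff_subset_ne.2 ⟨Finset.filter_subset _ _, fun e => ?_⟩
  rw [← e, Finset.mem_filter] at ha
  exact lt_irrefl a ha.2

lemma card_block_le (s : Finset α) {h : ℕ} (hh : 0 < h) (i : ℕ) :
    (s.filter fun a => rank s a / h = i).card ≤ h := by
  have : (s.filter fun a => rank s a / h = i).card ≤ (Finset.Ico (i * h) (i * h + h)).card := by
    apply Finset.card_le_card_of_injOn (rank s)
    · intro a ha
      have ha := (Finset.mem_filter.1 ha).2
      rw [Finset.mem_coe, Finset.mem_Ico, ← ha]
      exact ⟨Nat.div_mul_le_self _ _, Nat.lt_div_mul_add hh⟩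
    · exact (rank_injOn s).mono fun x hx => (Finset.mem_filter.1 hx).1
  simpa using this

end Rank

/-- Incidences between an increasing affine map and `A × B`. -/
noncomputable def inc (A B : Finset ℝ) (f : ℝ × ℝ) : Finset (ℝ × ℝ) := by
  classical exact (A ×ˢ B).filter fun z => z.2 = f.1 * z.1 + f.2

lemma mem_inc {A B : Finset ℝ} {f z : ℝ × ℝ} :
    z ∈ inc A B f ↔ z.1 ∈ A ∧ z.2 ∈ B ∧ z.2 = f.1 * z.1 + f.2 := by
  simp [inc, and_assoc]

lemma card_inc_le (A B : Finset ℝ) (f : ℝ × ℝ) : (inc A B f).card ≤ A.card := by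
  apply Finset.card_le_card_of_injOn Prod.fst
  · intro z hz; exact (mem_inc.1 hz).1
  · intro z hz w hw e
    have h1 := (mem_inc.1 hz).2.2
    have h2 := (mem_inc.1 hw).2.2
    exact Prod.ext e (by rw [h1, h2, e])

lemma card_inc_le' (A B : Finset ℝ) {f : ℝ × ℝ} (hf : 0 < f.1) : (inc A B f).card ≤ B.card := by
  apply Finset.card_le_card_of_injOn Prod.snd
  · intro z hz; exact (mem_inc.1 hz).2.1
  · intro z hz w hw e
    have h1 := (mem_inc.1 hz).2.2
    have h2 := (mem_inc.1 hw).2.2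
    exact Prod.ext (mul_left_cancel₀ hf.ne' (by linarith)) e

lemma sum_sq_blocks_le {ι : Type*} [DecidableEq ι] (s : Finset ι) (b : ι → ℕ) (h : ℕ)
    (hb : ∀ i, (s.filter fun a => b a = i).card ≤ h) :
    ((s ×ˢ s).filter fun z => b z.1 = b z.2).card ≤ s.card * h := by
  rw [Finset.card_eq_sum_card_fiberwise (f := Prod.fst) (t := s)
    (fun z hz => (Finset.mem_product.1 (Finset.mem_filter.1 hz).1).1)]
  refine Finset.sum_le_card_nsmul _ _ _ fun a ha => ?_
  refine le_trans ?_ (hb (b a))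
  apply Finset.card_le_card_of_injOn Prod.snd
  · intro z hz
    rw [Finset.mem_coe, Finset.mem_filter, Finset.mem_filter, Finset.mem_product] at hz
    rw [Finset.mem_coe, Finset.mem_filter, ← hz.2, hz.1.2]
    exact ⟨hz.1.1.2, rfl⟩
  · intro z hz w hw e
    rw [Finset.mem_coe, Finset.mem_filter] at hz hw
    exact Prod.ext (hz.2.trans hw.2.symm) e

lemma card_le_card_image_add {ι κ : Type*} [DecidableEq ι] [DecidableEq κ] (s : Finset ι)
    (b : ι → κ) : s.card ≤ (s.image b).card +
      ((s ×ˢ s).filter fun z => z.1 ≠ z.2 ∧ b z.1 = b z.2).card := by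
  obtain ⟨t, hts, ht, hinj⟩ : ∃ t ⊆ s, t.image b = s.image b ∧ Set.InjOn b t := by
    obtain ⟨t, h1, h2⟩ := Finset.subset_image_iff.1 (Finset.Subset.refl (s.image b))
    obtain ⟨t', h3, h4⟩ := Set.SurjOn.exists_bijOn_subset (f := b) (s := (s : Set ι))
      (t := (s.image b : Finset κ)) (by intro y hy; simpa using hy)
    have hfin : t'.Finite := s.finite_toSet.subset h3
    refine ⟨hfin.toFinset, by simpa [Set.Finite.toFinset_subset] using h3, ?_, ?_⟩
    · apply Finset.coe_injective
      rw [Finset.coe_image, Set.Finite.coe_toFinset]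
      exact h4.image_eq
    · rw [Set.Finite.coe_toFinset]
      exact h4.injOn
  have hr : ∀ a, ∃ r, a ∈ s → r ∈ t ∧ b r = b a := fun a => by
    by_cases ha : a ∈ s
    · have := Finset.mem_image_of_mem b ha
      rw [← ht] at this
      obtain ⟨r, h, e⟩ := Finset.mem_image.1 this
      exact ⟨r, fun _ => ⟨h, e⟩⟩
    · exact ⟨a, fun h => absurd h ha⟩
  choose r hr using hr
  have h1 : (s \ t).card ≤ ((s ×ˢ s).filter fun z => z.1 ≠ z.2 ∧ b z.1 = b z.2).card := by
    apply Finset.card_le_card_of_injOn fun a => (a, r a)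
    · intro a ha
      rw [Finset.mem_coe, Finset.mem_sdiff] at ha
      have := hr a ha.1
      rw [Finset.mem_coe, Finset.mem_filter, Finset.mem_product]
      refine ⟨⟨ha.1, hts this.1⟩, fun e => ha.2 ?_, this.2.symm⟩
      have e : a = r a := e
      rw [e]
      exact this.1
    · intro a _ c _ e
      exact congrArg Prod.fst e
  have h2 : (s.image b).card = t.card := by rw [← ht, Finset.card_image_of_injOn hinj]
  have h3 := Finset.card_sdiff_add_card_eq_card hts
  omega

lemma sub_one_div_le {a k : ℕ} (hk : 0 < k) : a / (8 * a / k + 1) ≤ k / 8 := by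
  rw [Nat.le_div_iff_mul_le (by norm_num)]
  by_contra! h
  have h1 := Nat.div_mul_le_self a (8 * a / k + 1)
  have h2 := Nat.lt_div_mul_add (a := 8 * a) hk
  have h3 : 8 * a < (8 * a / k + 1) * k := by linarith
  nlinarith

lemma block_size_mul_le {a k : ℕ} (hk : k ≤ a) : (8 * a / k + 1) * k ≤ 9 * a := by
  have h1 := Nat.div_mul_le_self (8 * a) k
  linarith

/-- A Szemerédi–Trotter type bound for increasing affine maps on a grid. -/
theorem sum_card_inc_le (A B : Finset ℝ) (F : Finset (ℝ × ℝ)) (hpos : ∀ f ∈ F, 0 < f.1) {k : ℕ}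
    (hk : 2 ≤ k) (hF : ∀ f ∈ F, k ≤ (inc A B f).card) :
    (∑ f ∈ F, (inc A B f).card) * k ^ 2 ≤ 162 * A.card ^ 2 * B.card ^ 2 := by
  classical
  rcases F.eq_empty_or_nonempty with rfl | ⟨f₀, hf₀⟩
  · simp
  have hkA : k ≤ A.card := (hF f₀ hf₀).trans (card_inc_le A B f₀)
  have hkB : k ≤ B.card := (hF f₀ hf₀).trans (card_inc_le' A B (hpos f₀ hf₀))
  set hA := 8 * A.card / k + 1 with hhA
  set hB := 8 * B.card / k + 1 with hhB
  set b : ℝ × ℝ → Fin 2 → ℕ := fun z => ![rank A z.1 / hA, rank B z.2 / hB] with hb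
  set S : ℝ × ℝ → Finset ((ℝ × ℝ) × ℝ × ℝ) := fun f =>
    ((inc A B f) ×ˢ (inc A B f)).filter fun z => z.1 ≠ z.2 ∧ b z.1 = b z.2 with hS
  have himg : ∀ f ∈ F, ((inc A B f).image b).card * 2 ≤ k := by
    intro f hf
    have h1 := card_image_chain_le (inc A B f) b ![k / 8, k / 8] (by
        intro z hz i
        have hz := mem_inc.1 hz
        have e1 := (Nat.div_le_div_right (c := hA) (rank_lt_card A hz.1).le).trans
          (sub_one_div_le (by omega))
        have e2 := (Nat.div_le_div_right (c := hB) (rank_lt_card B hz.2.1).le).trans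
          (sub_one_div_le (by omega))
        fin_cases i
        · exact e1
        · exact e2) (by
        have key : ∀ z ∈ inc A B f, ∀ w ∈ inc A B f, z.1 ≤ w.1 → b z ≤ b w := by
          intro z hz w hw h i
          have hz := mem_inc.1 hz
          have hw := mem_inc.1 hw
          have h2 : z.2 ≤ w.2 := by
            rw [hz.2.2, hw.2.2]
            have := mul_le_mul_of_nonneg_left h (hpos f hf).le
            linarith
          fin_cases i
          · exact Nat.div_le_div_right (rank_mono A h)
          · exact Nat.div_le_div_right (rank_mono B h2)
        intro z hz w hw
        rcases le_total z.1 w.1 with h | h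
        · exact Or.inl (key z hz w hw h)
        · exact Or.inr (key w hw z hz h))
    rw [Fin.sum_univ_two] at h1
    simp only [Matrix.cons_val_zero, Matrix.cons_val_one] at h1
    omega
  have hcard : ∀ f ∈ F, (inc A B f).card ≤ 2 * (S f).card := by
    intro f hf
    have h1 := card_le_card_image_add (inc A B f) b
    have h2 := himg f hf
    have h3 := hF f hf
    simp only [hS]
    omega
  set U := (((A ×ˢ A).filter fun z => rank A z.1 / hA = rank A z.2 / hA) ×ˢ
    ((B ×ˢ B).filter fun z => rank B z.1 / hB = rank B z.2 / hB)) with hU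
  have hUcard : U.card ≤ (A.card * hA) * (B.card * hB) := by
    rw [hU, Finset.card_product]
    exact Nat.mul_le_mul
      (sum_sq_blocks_le A (fun a => rank A a / hA) hA (card_block_le A (Nat.succ_pos _)))
      (sum_sq_blocks_le B (fun a => rank B a / hB) hB (card_block_le B (Nat.succ_pos _)))
  have hsum : ∑ f ∈ F, (S f).card ≤ U.card := by
    rw [← Finset.card_sigma]
    apply Finset.card_le_card_of_injOn
      fun x => ((x.2.1.1, x.2.2.1), (x.2.1.2, x.2.2.2))
    · rintro ⟨f, z, w⟩ hx
      simp only [Finset.coe_sigma, Set.mem_sigma_iff, Finset.mem_coe, hS, Finset.mem_filter,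
        Finset.mem_product] at hx
      obtain ⟨hf, ⟨hz, hw⟩, hne, e⟩ := hx
      have hz := mem_inc.1 hz
      have hw := mem_inc.1 hw
      simp only [hU, Finset.mem_coe, Finset.mem_product, Finset.mem_filter]
      exact ⟨⟨⟨hz.1, hw.1⟩, congrFun e 0⟩, ⟨⟨hz.2.1, hw.2.1⟩, congrFun e 1⟩⟩
    · rintro ⟨f, z, w⟩ hx ⟨f', z', w'⟩ hx' e
      simp only [Finset.coe_sigma, Set.mem_sigma_iff, Finset.mem_coe, hS, Finset.mem_filter,
        Finset.mem_product] at hx hx'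
      simp only [Prod.mk.injEq] at e
      obtain ⟨⟨e1, e2⟩, e3, e4⟩ := e
      have ez : z = z' := Prod.ext e1 e3
      have ew : w = w' := Prod.ext e2 e4
      subst ez ew
      have hz := (mem_inc.1 hx.2.1.1).2.2
      have hw := (mem_inc.1 hx.2.1.2).2.2
      have hz' := (mem_inc.1 hx'.2.1.1).2.2
      have hw' := (mem_inc.1 hx'.2.1.2).2.2
      have hne : z.1 - w.1 ≠ 0 := fun h => hx.2.2.1 (Prod.ext (sub_eq_zero.1 h) (by
        rw [hz, hw, sub_eq_zero.1 h]))
      have e1 : f.1 = f'.1 := by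
        apply mul_right_cancel₀ hne
        linarith
      have e2 : f.2 = f'.2 := by rw [e1] at hz; linarith
      have : f = f' := Prod.ext e1 e2
      subst this
      rfl
  have htot : ∑ f ∈ F, (inc A B f).card ≤ 2 * U.card :=
    (Finset.sum_le_sum hcard).trans (by rw [← Finset.mul_sum]; omega)
  have hmA := block_size_mul_le hkA
  have hmB := block_size_mul_le hkB
  calc (∑ f ∈ F, (inc A B f).card) * k ^ 2
      ≤ (2 * ((A.card * hA) * (B.card * hB))) * k ^ 2 :=
        Nat.mul_le_mul_right _ (htot.trans (Nat.mul_le_mul_left _ hUcard))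
    _ = 2 * (A.card * (hA * k)) * (B.card * (hB * k)) := by ring
    _ ≤ 2 * (A.card * (9 * A.card)) * (B.card * (9 * B.card)) := by gcongr
    _ = _ := by ring

lemma mul_sum_card_inc_le (A B : Finset ℝ) (F : Finset (ℝ × ℝ)) (hpos : ∀ f ∈ F, 0 < f.1) {v : ℝ}
    (hF : ∀ f ∈ F, 2 ≤ (inc A B f).card) (hv : ∀ f ∈ F, v ≤ ((inc A B f).card : ℝ) ^ 2) :
    v * ∑ f ∈ F, ((inc A B f).card : ℝ) ≤ 162 * (A.card : ℝ) ^ 2 * (B.card : ℝ) ^ 2 := by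
  rcases F.eq_empty_or_nonempty with rfl | hne
  · simp; positivity
  obtain ⟨f₀, hf₀, hmin⟩ := Finset.exists_min_image F (fun f => (inc A B f).card) hne
  have h1 := sum_card_inc_le A B F hpos (hF f₀ hf₀) hmin
  have h2 : (∑ f ∈ F, ((inc A B f).card : ℝ)) * ((inc A B f₀).card : ℝ) ^ 2 ≤
      162 * (A.card : ℝ) ^ 2 * (B.card : ℝ) ^ 2 := by exact_mod_cast h1
  refine le_trans ?_ h2
  rw [mul_comm]
  exact mul_le_mul_of_nonneg_left (hv f₀ hf₀) (Finset.sum_nonneg fun _ _ => Nat.cast_nonneg _)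

/-- Pairs of points matched by the motion `g`. -/
noncomputable def mset (P P' : Finset Pt) (g : Mot) : Finset Line := by
  classical exact (P ×ˢ P').filter (Rel g)

lemma mem_mset {P P' : Finset Pt} {g : Mot} {z : Line} :
    z ∈ mset P P' g ↔ z.1 ∈ P ∧ z.2 ∈ P' ∧ Rel g z := by
  simp [mset, and_assoc]

lemma Rel.eq_of_fst {g : Mot} {z w : Line} (hg : g.1 ≠ 0) (hz : Rel g z) (hw : Rel g w)
    (h : z.1 = w.1) : z = w := by
  refine Prod.ext h (Prod.ext ?_ ?_)
  · rw [hz.1, hw.1, h]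
  · apply mul_left_cancel₀ hg
    rw [hz.2, hw.2, h]

lemma card_mset_le {P P' : Finset Pt} {g : Mot} (hg : g.1 ≠ 0) :
    (mset P P' g).card ≤ P.card :=
  Finset.card_le_card_of_injOn Prod.fst (fun _ hz => (mem_mset.1 hz).1) fun _ hz _ hw e =>
    (mem_mset.1 hz).2.2.eq_of_fst hg (mem_mset.1 hw).2.2 e

noncomputable def lexRank (P : Finset Pt) (p : Pt) : ℕ := rank (P.map toLex.toEmbedding) (toLex p)

lemma lexRank_le_of_fst_lt (P : Finset Pt) {p q : Pt} (h : p.1 < q.1) :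
    lexRank P p ≤ lexRank P q :=
  rank_mono _ (Prod.Lex.toLex_le_toLex.2 (Or.inl h))

lemma lexRank_injOn (P : Finset Pt) : Set.InjOn (lexRank P) P := by
  intro p hp q hq e
  have h1 : toLex p ∈ P.map toLex.toEmbedding := Finset.mem_map_of_mem toLex.toEmbedding hp
  have h2 : toLex q ∈ P.map toLex.toEmbedding := Finset.mem_map_of_mem toLex.toEmbedding hq
  exact toLex.injective (rank_injOn (P.map toLex.toEmbedding) h1 h2 e)

lemma lexRank_lt_card (P : Finset Pt) {p : Pt} (hp : p ∈ P) : lexRank P p < P.card := by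
  have h1 : toLex p ∈ P.map toLex.toEmbedding := Finset.mem_map_of_mem toLex.toEmbedding hp
  have := rank_lt_card _ h1
  rwa [Finset.card_map] at this

lemma card_lexBlock_le (P : Finset Pt) {h : ℕ} (hh : 0 < h) (i : ℕ) :
    (P.filter fun p => lexRank P p / h = i).card ≤ h := by
  refine le_trans ?_ (card_block_le (P.map toLex.toEmbedding) hh i)
  apply Finset.card_le_card_of_injOn toLex
  · intro p hp
    rw [Finset.mem_coe, Finset.mem_filter] at hp ⊢
    exact ⟨Finset.mem_map_of_mem toLex.toEmbedding hp.1, hp.2⟩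
  · exact toLex.injective.injOn

/-- Pair of dyadic blocks of level `e` containing a pair of points. -/
noncomputable def blk (P P' : Finset Pt) (e : ℕ) (z : Line) : Fin 2 → ℕ :=
  ![lexRank P z.1 / 2 ^ e, lexRank P' z.2 / 2 ^ e]

noncomputable def richBlk (P P' : Finset Pt) (L : Finset Line) (e : ℕ) : Finset (Fin 2 → ℕ) := by
  classical exact (L.image (blk P P' e)).filter fun y =>
    ∃ z ∈ L, ∃ w ∈ L, z ≠ w ∧ blk P P' e z = y ∧ blk P P' e w = y

lemma mem_richBlk {P P' : Finset Pt} {L : Finset Line} {e : ℕ} {y : Fin 2 → ℕ} :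
    y ∈ richBlk P P' L e ↔ ∃ z ∈ L, ∃ w ∈ L, z ≠ w ∧ blk P P' e z = y ∧ blk P P' e w = y := by
  simp only [richBlk, Finset.mem_filter, Finset.mem_image, and_iff_right_iff_imp]
  rintro ⟨z, hz, _, _, _, h, _⟩
  exact ⟨z, hz, h⟩

lemma blk_succ (P P' : Finset Pt) (e : ℕ) (z : Line) (i : Fin 2) :
    blk P P' (e + 1) z i = blk P P' e z i / 2 := by
  fin_cases i <;> simp [blk, Nat.div_div_eq_div_mul, pow_succ]

lemma card_image_blk_step (P P' : Finset Pt) (L : Finset Line) (e : ℕ) :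
    (L.image (blk P P' e)).card ≤
      (L.image (blk P P' (e + 1))).card + 3 * (richBlk P P' L (e + 1)).card := by
  classical
  set half : (Fin 2 → ℕ) → Fin 2 → ℕ := fun y i => y i / 2
  have hhalf : ∀ z, half (blk P P' e z) = blk P P' (e + 1) z := fun z =>
    funext fun i => (blk_succ P P' e z i).symm
  rw [Finset.card_eq_sum_card_fiberwise (f := half) (t := L.image (blk P P' (e + 1)))]
  · have h1 : ∀ y ∈ L.image (blk P P' (e + 1)),
        ((L.image (blk P P' e)).filter fun x => half x = y).card ≤
          1 + if y ∈ richBlk P P' L (e + 1) then 3 else 0 := by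
      intro y hy
      split_ifs with hr
      · have : ((L.image (blk P P' e)).filter fun x => half x = y) ⊆
            Finset.image (fun b : Fin 2 × Fin 2 => ![2 * y 0 + b.1, 2 * y 1 + b.2])
              Finset.univ := by
          intro x hx
          have hx := (Finset.mem_filter.1 hx).2
          have h0 : x 0 / 2 = y 0 := congrFun hx 0
          have h1 : x 1 / 2 = y 1 := congrFun hx 1
          rw [Finset.mem_image]
          refine ⟨(⟨x 0 % 2, Nat.mod_lt _ (by norm_num)⟩, ⟨x 1 % 2, Nat.mod_lt _ (by norm_num)⟩),
            Finset.mem_univ _, ?_⟩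
          funext i
          fin_cases i
          · simp; omega
          · simp; omega
        exact (Finset.card_le_card this).trans (Finset.card_image_le.trans (by simp))
      · rw [add_zero, Finset.card_le_one]
        intro x hx x' hx'
        rw [Finset.mem_filter, Finset.mem_image] at hx hx'
        obtain ⟨⟨z, hz, rfl⟩, h⟩ := hx
        obtain ⟨⟨w, hw, rfl⟩, h'⟩ := hx'
        rw [hhalf] at h h'
        by_contra hne
        exact hr (mem_richBlk.2 ⟨z, hz, w, hw, fun e => hne (by rw [e]), h, h'⟩)
    refine (Finset.sum_le_sum h1).trans ?_
    rw [Finset.sum_add_distrib, ← Finset.sum_filter, Finset.sum_const, Finset.sum_const]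
    simp only [smul_eq_mul, mul_one]
    have := Finset.card_le_card (show (L.image (blk P P' (e + 1))).filter
      (fun y => y ∈ richBlk P P' L (e + 1)) ⊆ richBlk P P' L (e + 1) from
        fun y hy => (Finset.mem_filter.1 hy).2)
    omega
  · intro x hx
    rw [Finset.mem_coe, Finset.mem_image] at hx ⊢
    obtain ⟨z, hz, rfl⟩ := hx
    exact ⟨z, hz, (hhalf z).symm⟩

lemma card_image_blk_le (P P' : Finset Pt) (L : Finset Line) (E : ℕ) :
    (L.image (blk P P' 0)).card ≤ (L.image (blk P P' E)).card +
      3 * ∑ e ∈ Finset.range E, (richBlk P P' L (e + 1)).card := by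
  induction E with
  | zero => simp
  | succ E ih =>
    rw [Finset.sum_range_succ]
    have := card_image_blk_step P P' L E
    omega

lemma sum_card_richBlk_le {P P' : Finset Pt} {N : ℕ} (hP : P.card ≤ N) (hP' : P'.card ≤ N)
    (G : Finset Mot) (L : Mot → Finset Line) (hL : ∀ g ∈ G, L g ⊆ mset P P' g)
    (hnd : ∀ g ∈ G, ∀ z ∈ L g, ∀ w ∈ L g, z ≠ w → ND z w) (e : ℕ) :
    ∑ g ∈ G, (richBlk P P' (L g) e).card ≤ (N / 2 ^ e + 1) ^ 2 * (12 * (2 ^ e) ^ 3) := by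
  classical
  set Y : Finset (Fin 2 → ℕ) := Fintype.piFinset fun _ => Finset.range (N / 2 ^ e + 1) with hY
  have hYcard : Y.card = (N / 2 ^ e + 1) ^ 2 := by simp [hY, Fintype.card_piFinset]
  have hsub : ∀ g ∈ G, richBlk P P' (L g) e ⊆ Y := by
    intro g hg y hy
    obtain ⟨z, hz, _, _, _, rfl, _⟩ := mem_richBlk.1 hy
    have hz := mem_mset.1 (hL g hg hz)
    rw [hY, Fintype.mem_piFinset]
    intro i
    rw [Finset.mem_range, Nat.lt_succ_iff]
    fin_cases i
    · exact Nat.div_le_div_right ((lexRank_lt_card P hz.1).le.trans hP)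
    · exact Nat.div_le_div_right ((lexRank_lt_card P' hz.2.1).le.trans hP')
  have h1 : ∀ g ∈ G, (richBlk P P' (L g) e).card =
      (Y.filter fun y => y ∈ richBlk P P' (L g) e).card := fun g hg => by
    rw [Finset.filter_mem_eq_inter, Finset.inter_eq_right.2 (hsub g hg)]
  rw [Finset.sum_congr rfl h1, ← hYcard]
  have := Finset.sum_card_bipartiteAbove_eq_sum_card_bipartiteBelow (s := G) (t := Y)
    fun g y => y ∈ richBlk P P' (L g) e
  simp only [Finset.bipartiteAbove, Finset.bipartiteBelow] at this
  rw [this]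
  refine Finset.sum_le_card_nsmul _ _ _ fun y _ => ?_
  apply card_motions_le (card_lexBlock_le P (by positivity) (y 0))
    (card_lexBlock_le P' (by positivity) (y 1))
  intro g hg
  rw [Finset.mem_filter] at hg
  obtain ⟨z, hz, w, hw, hne, e1, e2⟩ := mem_richBlk.1 hg.2
  have hz' := mem_mset.1 (hL g hg.1 hz)
  have hw' := mem_mset.1 (hL g hg.1 hw)
  refine ⟨z, ?_, w, ?_, hnd g hg.1 z hz w hw hne, hz'.2.2, hw'.2.2⟩
  · rw [Finset.mem_product, Finset.mem_filter, Finset.mem_filter]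
    exact ⟨⟨hz'.1, congrFun e1 0⟩, hz'.2.1, congrFun e1 1⟩
  · rw [Finset.mem_product, Finset.mem_filter, Finset.mem_filter]
    exact ⟨⟨hw'.1, congrFun e2 0⟩, hw'.2.1, congrFun e2 1⟩

/-- Few motions match many pairs that are pairwise in general position. -/
theorem card_mul_sq_le_of_ND {P P' : Finset Pt} {N K : ℕ} (hP : P.card ≤ N) (hP' : P'.card ≤ N)
    (G : Finset Mot) (hpos : ∀ g ∈ G, 0 < g.1)
    (L : Mot → Finset Line) (hL : ∀ g ∈ G, L g ⊆ mset P P' g)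
    (hnd : ∀ g ∈ G, ∀ z ∈ L g, ∀ w ∈ L g, z ≠ w → ND z w) (hK : 4 ≤ K)
    (hcard : ∀ g ∈ G, K ≤ (L g).card) : G.card * K ^ 2 ≤ 57600 * N ^ 3 := by
  classical
  rcases G.eq_empty_or_nonempty with rfl | ⟨g₀, hg₀⟩
  · simp
  have hKN : K ≤ N := (hcard g₀ hg₀).trans
    ((Finset.card_le_card (hL g₀ hg₀)).trans ((card_mset_le (hpos g₀ hg₀).ne').trans hP))
  obtain ⟨E, hE1, hE2⟩ : ∃ E, 8 * N ≤ 2 ^ E * K ∧ 2 ^ E * K ≤ 16 * N := by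
    have hex : ∃ E, 8 * N ≤ 2 ^ E * K :=
      ⟨8 * N, Nat.lt_two_pow_self.le.trans (Nat.le_mul_of_pos_right _ (by omega))⟩
    refine ⟨Nat.find hex, Nat.find_spec hex, ?_⟩
    rcases h : Nat.find hex with _ | m
    · omega
    · have := Nat.find_min hex (m := m) (by omega)
      rw [pow_succ]
      linarith
  have hone : ∀ g ∈ G, K ≤ 6 * ∑ e ∈ Finset.range E, (richBlk P P' (L g) (e + 1)).card := by
    intro g hg
    have h0 : ((L g).image (blk P P' 0)).card = (L g).card := by
      apply Finset.card_image_of_injOn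
      intro z hz w hw e
      have hz := mem_mset.1 (hL g hg hz)
      have hw := mem_mset.1 (hL g hg hw)
      have e0 := congrFun e 0
      simp [blk] at e0
      exact hz.2.2.eq_of_fst (hpos g hg).ne' hw.2.2 (lexRank_injOn P hz.1 hw.1 e0)
    have hEE := card_image_chain_le (L g) (blk P P' E) ![N / 2 ^ E, N / 2 ^ E] (by
      intro z hz i
      have hz := mem_mset.1 (hL g hg hz)
      fin_cases i
      · exact Nat.div_le_div_right ((lexRank_lt_card P hz.1).le.trans hP)
      · exact Nat.div_le_div_right ((lexRank_lt_card P' hz.2.1).le.trans hP')) (by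
      have key : ∀ z ∈ L g, ∀ w ∈ L g, z.1.1 < w.1.1 → blk P P' E z ≤ blk P P' E w := by
        intro z hz w hw h i
        have hz := mem_mset.1 (hL g hg hz)
        have hw := mem_mset.1 (hL g hg hw)
        have h2 : z.2.1 < w.2.1 := by
          rw [hz.2.2.1, hw.2.2.1]
          have := mul_lt_mul_of_pos_left h (hpos g hg)
          linarith
        fin_cases i
        · exact Nat.div_le_div_right (lexRank_le_of_fst_lt P h)
        · exact Nat.div_le_div_right (lexRank_le_of_fst_lt P' h2)
      intro z hz w hw
      by_cases hzw : z = w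
      · exact Or.inl (by rw [hzw])
      rcases lt_or_gt_of_ne (hnd g hg z hz w hw hzw).1 with h | h
      · exact Or.inl (key z hz w hw h)
      · exact Or.inr (key w hw z hz h))
    rw [Fin.sum_univ_two] at hEE
    simp only [Matrix.cons_val_zero, Matrix.cons_val_one] at hEE
    have h1 := card_image_blk_le P P' (L g) E
    have h2 := hcard g hg
    have h3 : N / 2 ^ E * 8 ≤ K := by
      have := Nat.div_mul_le_self N (2 ^ E)
      have h4 : 0 < 2 ^ E := by positivity
      by_contra! h
      nlinarith
    omega
  have hsum : G.card * K ≤ 6 * ∑ e ∈ Finset.range E,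
      (N / 2 ^ (e + 1) + 1) ^ 2 * (12 * (2 ^ (e + 1)) ^ 3) := by
    rw [← smul_eq_mul]
    refine (Finset.card_nsmul_le_sum G _ K hone).trans ?_
    rw [← Finset.mul_sum, Finset.sum_comm]
    exact Nat.mul_le_mul_left _ (Finset.sum_le_sum fun e _ =>
      sum_card_richBlk_le hP hP' G L hL hnd (e + 1))
  have hterm : ∀ e ∈ Finset.range E, (N / 2 ^ (e + 1) + 1) ^ 2 * (12 * (2 ^ (e + 1)) ^ 3) ≤
      600 * N ^ 2 * 2 ^ e := by
    intro e he
    have h1 : 2 ^ (e + 1) ≤ 2 ^ E := Nat.pow_le_pow_right (by norm_num)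
      (Finset.mem_range.1 he)
    have h2 : 2 ^ (e + 1) ≤ 4 * N := by nlinarith
    have h3 : (N / 2 ^ (e + 1) + 1) * 2 ^ (e + 1) ≤ 5 * N := by
      have := Nat.div_mul_le_self N (2 ^ (e + 1))
      linarith
    calc _ = ((N / 2 ^ (e + 1) + 1) * 2 ^ (e + 1)) ^ 2 * (12 * 2 ^ (e + 1)) := by ring
      _ ≤ (5 * N) ^ 2 * (12 * 2 ^ (e + 1)) := by gcongr
      _ = _ := by ring
  have hgeo : ∑ e ∈ Finset.range E, 600 * N ^ 2 * 2 ^ e ≤ 600 * N ^ 2 * 2 ^ E := by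
    rw [← Finset.mul_sum]
    have := Nat.geomSum_eq (le_refl 2) E
    exact Nat.mul_le_mul_left _ (by rw [this]; simp)
  have h5 : G.card * K ≤ 6 * (600 * N ^ 2 * 2 ^ E) :=
    hsum.trans (Nat.mul_le_mul_left _ ((Finset.sum_le_sum hterm).trans hgeo))
  calc G.card * K ^ 2 = G.card * K * K := by ring
    _ ≤ 6 * (600 * N ^ 2 * 2 ^ E) * K := Nat.mul_le_mul_right _ h5
    _ = 3600 * N ^ 2 * (2 ^ E * K) := by ring
    _ ≤ 3600 * N ^ 2 * (16 * N) := Nat.mul_le_mul_left _ hE2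
    _ = _ := by ring

noncomputable def col (P : Finset Pt) (c : ℝ) : Finset Pt := by
  classical exact P.filter fun p => p.1 = c

lemma mem_col {P : Finset Pt} {c : ℝ} {p : Pt} : p ∈ col P c ↔ p ∈ P ∧ p.1 = c := by
  simp [col]

/-- Matched pairs in the column `c` of `P` and the column `d` of `P'`. -/
noncomputable def colM (P P' : Finset Pt) (g : Mot) (x : ℝ × ℝ) : Finset Line := by
  classical exact (mset P P' g).filter fun z => (z.1.1, z.2.1) = x

lemma mem_colM {P P' : Finset Pt} {g : Mot} {x : ℝ × ℝ} {z : Line} :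
    z ∈ colM P P' g x ↔ z ∈ mset P P' g ∧ z.1.1 = x.1 ∧ z.2.1 = x.2 := by
  simp [colM, Prod.ext_iff]

noncomputable def wt (P P' : Finset Pt) (x : ℝ × ℝ) : ℕ := (col P x.1).card * (col P' x.2).card

noncomputable def xs (P : Finset Pt) : Finset ℝ := P.image Prod.fst

lemma mem_xs {P : Finset Pt} {p : Pt} (hp : p ∈ P) : p.1 ∈ xs P := Finset.mem_image_of_mem _ hp

lemma sum_card_col (P : Finset Pt) : ∑ c ∈ xs P, (col P c).card = P.card := by
  classical
  rw [Finset.card_eq_sum_card_fiberwise (f := Prod.fst) (t := xs P) fun p hp => mem_xs hp]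
  exact Finset.sum_congr rfl fun c _ => by
    congr 1

lemma sum_wt (P P' : Finset Pt) : ∑ x ∈ xs P ×ˢ xs P', wt P P' x = P.card * P'.card := by
  rw [Finset.sum_product, ← sum_card_col P, ← sum_card_col P', Finset.sum_mul_sum]
  rfl

lemma colM_rel {P P' : Finset Pt} {g : Mot} {x : ℝ × ℝ} (h : (colM P P' g x).Nonempty) :
    x.2 = g.1 * x.1 + g.2.1 := by
  obtain ⟨z, hz⟩ := h
  have hz := mem_colM.1 hz
  rw [← hz.2.1, ← hz.2.2]
  exact (mem_mset.1 hz.1).2.2.1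

lemma mem_xs_of_colM {P P' : Finset Pt} {g : Mot} {x : ℝ × ℝ} (h : (colM P P' g x).Nonempty) :
    x ∈ xs P ×ˢ xs P' := by
  obtain ⟨z, hz⟩ := h
  have hz := mem_colM.1 hz
  have h1 := mem_mset.1 hz.1
  rw [Finset.mem_product, ← hz.2.1, ← hz.2.2]
  exact ⟨mem_xs h1.1, mem_xs h1.2.1⟩

noncomputable def ys (P : Finset Pt) (c : ℝ) : Finset ℝ := (col P c).image Prod.snd

lemma card_ys (P : Finset Pt) (c : ℝ) : (ys P c).card = (col P c).card := by
  apply Finset.card_image_of_injOn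
  intro p hp q hq e
  exact Prod.ext ((mem_col.1 hp).2.trans (mem_col.1 hq).2.symm) e

lemma card_inc_ys {P P' : Finset Pt} {g : Mot} {x : ℝ × ℝ} (hg : g.1 ≠ 0)
    (h : x.2 = g.1 * x.1 + g.2.1) :
    (inc (ys P' x.2) (ys P x.1) (g.1, -g.2.2)).card = (colM P P' g x).card := by
  symm
  refine Finset.card_bij (fun z _ => (z.2.2, z.1.2)) ?_ ?_ ?_
  · intro z hz
    have hz := mem_colM.1 hz
    have h1 := mem_mset.1 hz.1
    refine mem_inc.2 ⟨?_, ?_, ?_⟩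
    · exact Finset.mem_image.2 ⟨z.2, mem_col.2 ⟨h1.2.1, hz.2.2⟩, rfl⟩
    · exact Finset.mem_image.2 ⟨z.1, mem_col.2 ⟨h1.1, hz.2.1⟩, rfl⟩
    · have := h1.2.2.2
      simp only
      linarith
  · intro z hz w hw e
    have hz := mem_colM.1 hz
    have hw := mem_colM.1 hw
    exact (mem_mset.1 hz.1).2.2.eq_of_fst hg (mem_mset.1 hw.1).2.2
      (Prod.ext (hz.2.1.trans hw.2.1.symm) (Prod.mk.inj e).2)
  · intro y hy
    obtain ⟨h1, h2, h3⟩ := mem_inc.1 hy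
    obtain ⟨q, hq, e1⟩ := Finset.mem_image.1 h1
    obtain ⟨p, hp, e2⟩ := Finset.mem_image.1 h2
    have hq := mem_col.1 hq
    have hp := mem_col.1 hp
    refine ⟨(p, q), mem_colM.2 ⟨mem_mset.2 ⟨hp.1, hq.1, ?_, ?_⟩, hp.2, hq.2⟩, ?_⟩
    · simp only [hq.2, hp.2, h]
    · simp only at h3 ⊢
      rw [e1, e2]; linarith
    · exact Prod.ext e1 e2

lemma mul_sum_card_colM_le (P P' : Finset Pt) (G : Finset Mot) (hpos : ∀ g ∈ G, 0 < g.1)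
    (x : ℝ × ℝ) {v : ℝ} (h2 : ∀ g ∈ G, 2 ≤ (colM P P' g x).card)
    (hv : ∀ g ∈ G, v ≤ ((colM P P' g x).card : ℝ) ^ 2) :
    v * ∑ g ∈ G, ((colM P P' g x).card : ℝ) ≤ 162 * (wt P P' x : ℝ) ^ 2 := by
  classical
  have hrel : ∀ g ∈ G, x.2 = g.1 * x.1 + g.2.1 := fun g hg =>
    colM_rel (Finset.card_pos.1 (lt_of_lt_of_le two_pos (h2 g hg)))
  set φ : Mot → ℝ × ℝ := fun g => (g.1, -g.2.2) with hφ
  have hinj : Set.InjOn φ G := by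
    intro g hg g' hg' e
    simp only [hφ, Prod.mk.injEq, neg_inj] at e
    have e1 := hrel g hg
    have e2 := hrel g' hg'
    rw [e.1] at e1
    exact Prod.ext e.1 (Prod.ext (by linarith) e.2)
  have hc : ∀ g ∈ G, (inc (ys P' x.2) (ys P x.1) (φ g)).card = (colM P P' g x).card :=
    fun g hg => card_inc_ys (hpos g hg).ne' (hrel g hg)
  have := mul_sum_card_inc_le (ys P' x.2) (ys P x.1) (G.image φ) (v := v)
    (by
      intro f hf
      obtain ⟨g, hg, rfl⟩ := Finset.mem_image.1 hf
      exact hpos g hg)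
    (by
      intro f hf
      obtain ⟨g, hg, rfl⟩ := Finset.mem_image.1 hf
      rw [hc g hg]; exact h2 g hg)
    (by
      intro f hf
      obtain ⟨g, hg, rfl⟩ := Finset.mem_image.1 hf
      rw [hc g hg]; exact hv g hg)
  rw [Finset.sum_image hinj, card_ys, card_ys] at this
  rw [Finset.sum_congr rfl fun g hg => by rw [← hc g hg]]
  refine this.trans (le_of_eq ?_)
  simp only [wt]
  push_cast
  ring

lemma sum_card_sdiff_colM_le (P P' : Finset Pt) (G : Finset Mot) (x : ℝ × ℝ)
    (hx : ∀ g ∈ G, (colM P P' g x).Nonempty) :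
    ∑ g ∈ G, (mset P P' g \ colM P P' g x).card ≤ P.card * P'.card := by
  classical
  rw [← Finset.card_sigma, ← Finset.card_product]
  apply Finset.card_le_card_of_injOn fun y => y.2
  · rintro ⟨g, z⟩ hy
    simp only [Finset.mem_coe, Finset.mem_sigma, Finset.mem_sdiff] at hy
    have := mem_mset.1 hy.2.1
    exact Finset.mem_product.2 ⟨this.1, this.2.1⟩
  · rintro ⟨g, z⟩ hy ⟨g', z'⟩ hy' e
    simp only [Finset.mem_coe, Finset.mem_sigma, Finset.mem_sdiff] at hy hy'
    have e : z = z' := e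
    subst e
    obtain ⟨hg, hz, hn⟩ := hy
    obtain ⟨hg', hz', -⟩ := hy'
    have r1 := colM_rel (hx g hg)
    have r2 := colM_rel (hx g' hg')
    have s1 := (mem_mset.1 hz).2.2
    have s2 := (mem_mset.1 hz').2.2
    have hne : z.1.1 - x.1 ≠ 0 := by
      intro h
      have h : z.1.1 = x.1 := sub_eq_zero.1 h
      exact hn (mem_colM.2 ⟨hz, h, by rw [s1.1, h, r1]⟩)
    have e1 : g.1 = g'.1 := by
      apply mul_right_cancel₀ hne
      linarith [s1.1, s2.1]
    have e2 : g.2.1 = g'.2.1 := by rw [e1] at r1; linarith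
    have e3 : g.2.2 = g'.2.2 := by
      have h1 := s1.2
      have h2 := s2.2
      rw [e1] at h1; linarith
    have : g = g' := Prod.ext e1 (Prod.ext e2 e3)
    subst this
    rfl

/-- Nondegenerate pairs of matched pairs. -/
noncomputable def ndM (P P' : Finset Pt) (g : Mot) : Finset (Line × Line) := by
  classical exact (mset P P' g ×ˢ mset P P' g).filter fun z => ND z.1 z.2

lemma mem_ndM {P P' : Finset Pt} {g : Mot} {z : Line × Line} :
    z ∈ ndM P P' g ↔ z.1 ∈ mset P P' g ∧ z.2 ∈ mset P P' g ∧ ND z.1 z.2 := by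
  simp [ndM, and_assoc]

lemma card_ndM_le_sq (P P' : Finset Pt) (g : Mot) :
    (ndM P P' g).card ≤ (mset P P' g).card ^ 2 := by
  rw [sq, ← Finset.card_product]
  exact Finset.card_le_card fun z hz =>
    Finset.mem_product.2 ⟨(mem_ndM.1 hz).1, (mem_ndM.1 hz).2.1⟩

lemma card_ndM_le (P P' : Finset Pt) (g : Mot) (x : ℝ × ℝ) :
    (ndM P P' g).card ≤ 2 * (mset P P' g).card * (mset P P' g \ colM P P' g x).card := by
  classical
  have : ndM P P' g ⊆ (mset P P' g ×ˢ (mset P P' g \ colM P P' g x)) ∪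
      ((mset P P' g \ colM P P' g x) ×ˢ mset P P' g) := by
    intro z hz
    obtain ⟨h1, h2, h3⟩ := mem_ndM.1 hz
    simp only [Finset.mem_union, Finset.mem_product, Finset.mem_sdiff, mem_colM]
    by_contra hn
    have a1 : z.1.1.1 = x.1 := by tauto
    have a2 : z.2.1.1 = x.1 := by tauto
    exact h3.1 (a1.trans a2.symm)
  refine (Finset.card_le_card this).trans ((Finset.card_union_le _ _).trans ?_)
  rw [Finset.card_product, Finset.card_product]
  exact le_of_eq (by ring)

lemma sum_card_ndM_le_of_col {P P' : Finset Pt} {N k : ℕ} (hP : P.card ≤ N) (hP' : P'.card ≤ N)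
    (hk : 8 ≤ k) (G : Finset Mot) (hpos : ∀ g ∈ G, 0 < g.1)
    (hGk : ∀ g ∈ G, k ≤ (mset P P' g).card) (hG2k : ∀ g ∈ G, (mset P P' g).card ≤ 2 * k)
    (x : ℝ × ℝ) (hx : ∀ g ∈ G, (mset P P' g).card ≤ 4 * (colM P P' g x).card) :
    ∑ g ∈ G, ((ndM P P' g).card : ℝ) ≤ 576 * N * wt P P' x := by
  classical
  have hk0 : (0 : ℝ) < k := by exact_mod_cast (by omega : 0 < k)
  have h2 : ∀ g ∈ G, 2 ≤ (colM P P' g x).card := fun g hg => by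
    have := hx g hg
    have := hGk g hg
    omega
  have hκ : ∀ g ∈ G, (k : ℝ) / 4 ≤ ((colM P P' g x).card : ℝ) := fun g hg => by
    have h1 := (hGk g hg).trans (hx g hg)
    have : (k : ℝ) ≤ 4 * ((colM P P' g x).card : ℝ) := by exact_mod_cast h1
    linarith
  set J : ℝ := ∑ g ∈ G, ((mset P P' g \ colM P P' g x).card : ℝ) with hJ
  have hJ0 : 0 ≤ J := Finset.sum_nonneg fun _ _ => Nat.cast_nonneg _
  have hJ1 : J ≤ (N : ℝ) ^ 2 := by
    have h1 := (sum_card_sdiff_colM_le P P' G x fun g hg =>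
      Finset.card_pos.1 (lt_of_lt_of_le two_pos (h2 g hg))).trans (Nat.mul_le_mul hP hP')
    rw [← sq] at h1
    rw [hJ]
    exact_mod_cast h1
  have hJ2 : J ≤ G.card * (2 * k) := by
    rw [hJ, ← nsmul_eq_mul]
    refine Finset.sum_le_card_nsmul _ _ _ fun g hg => ?_
    exact_mod_cast (Finset.card_le_card Finset.sdiff_subset).trans (hG2k g hg)
  have hn : (G.card : ℝ) * (k / 4) ^ 3 ≤ 162 * (wt P P' x : ℝ) ^ 2 := by
    refine le_trans ?_ (mul_sum_card_colM_le P P' G hpos x (v := ((k : ℝ) / 4) ^ 2) h2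
      fun g hg => pow_le_pow_left₀ (by positivity) (hκ g hg) 2)
    have := Finset.card_nsmul_le_sum G (fun g => ((colM P P' g x).card : ℝ)) _ hκ
    rw [nsmul_eq_mul] at this
    calc _ = ((k : ℝ) / 4) ^ 2 * (G.card * (k / 4)) := by ring
      _ ≤ _ := mul_le_mul_of_nonneg_left this (by positivity)
  have hJk : J * k ≤ 144 * N * wt P P' x := by
    refine (pow_le_pow_iff_left₀ (mul_nonneg hJ0 hk0.le) (by positivity) two_ne_zero).1 ?_
    calc (J * k) ^ 2 = J * J * k ^ 2 := by ring
      _ ≤ (N : ℝ) ^ 2 * (G.card * (2 * k)) * k ^ 2 :=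
        mul_le_mul_of_nonneg_right (mul_le_mul hJ1 hJ2 hJ0 (by positivity)) (by positivity)
      _ = 128 * (N : ℝ) ^ 2 * (G.card * (k / 4) ^ 3) := by ring
      _ ≤ 128 * (N : ℝ) ^ 2 * (162 * (wt P P' x : ℝ) ^ 2) :=
        mul_le_mul_of_nonneg_left hn (by positivity)
      _ = _ := by ring
  calc ∑ g ∈ G, ((ndM P P' g).card : ℝ)
      ≤ ∑ g ∈ G, 4 * k * ((mset P P' g \ colM P P' g x).card : ℝ) := by
        refine Finset.sum_le_sum fun g hg => ?_
        have h1 := (card_ndM_le P P' g x).trans (Nat.mul_le_mul_right _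
          (Nat.mul_le_mul_left 2 (hG2k g hg)))
        rw [← mul_assoc] at h1
        exact_mod_cast h1
    _ = 4 * (J * k) := by rw [← Finset.mul_sum, ← hJ]; ring
    _ ≤ 4 * (144 * N * wt P P' x) := by gcongr
    _ = _ := by ring

/-- Contribution of motions having a dominant column. -/
theorem sum_card_ndM_le_of_dominant {P P' : Finset Pt} {N k : ℕ} (hP : P.card ≤ N)
    (hP' : P'.card ≤ N) (hk : 8 ≤ k) (G : Finset Mot) (hpos : ∀ g ∈ G, 0 < g.1)
    (hGk : ∀ g ∈ G, k ≤ (mset P P' g).card) (hG2k : ∀ g ∈ G, (mset P P' g).card ≤ 2 * k)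
    (hx : ∀ g ∈ G, ∃ x, (mset P P' g).card ≤ 4 * (colM P P' g x).card) :
    ∑ g ∈ G, ((ndM P P' g).card : ℝ) ≤ 576 * (N : ℝ) ^ 3 := by
  classical
  have hx' : ∀ g, ∃ x, g ∈ G → (mset P P' g).card ≤ 4 * (colM P P' g x).card := fun g => by
    by_cases hg : g ∈ G
    · obtain ⟨x, h⟩ := hx g hg
      exact ⟨x, fun _ => h⟩
    · exact ⟨0, fun h => absurd h hg⟩
  choose x hx using hx'
  rw [← Finset.sum_fiberwise_of_maps_to (g := x) (t := xs P ×ˢ xs P')]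
  · calc _ ≤ ∑ y ∈ xs P ×ˢ xs P', 576 * (N : ℝ) * wt P P' y := by
          refine Finset.sum_le_sum fun y _ => ?_
          apply sum_card_ndM_le_of_col hP hP' hk
          · exact fun g hg => hpos g (Finset.mem_filter.1 hg).1
          · exact fun g hg => hGk g (Finset.mem_filter.1 hg).1
          · exact fun g hg => hG2k g (Finset.mem_filter.1 hg).1
          · intro g hg
            have := hx g (Finset.mem_filter.1 hg).1
            rwa [(Finset.mem_filter.1 hg).2] at this
      _ = 576 * (N : ℝ) * (P.card * P'.card : ℕ) := by
          rw [← Finset.mul_sum, ← sum_wt]; push_cast; rfl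
      _ ≤ 576 * (N : ℝ) * (N * N : ℕ) := by gcongr
      _ = _ := by push_cast; ring
  · intro g hg
    have h1 := hx g hg
    have h2 := hGk g hg
    have h3 : 0 < (colM P P' g (x g)).card := by omega
    exact mem_xs_of_colM (Finset.card_pos.1 h3)

lemma sum_le_of_geometric {ι : Type*} (s : Finset ι) (J : ι → ℕ) (h : ι → ℝ) {B : ℝ} (hB : 0 ≤ B)
    (hJ : ∀ j, ∑ i ∈ s.filter (fun i => J i = j), h i ≤ B * (1 / 2) ^ j) :
    ∑ i ∈ s, h i ≤ 2 * B := by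
  rw [← Finset.sum_fiberwise_of_maps_to (g := J) (t := Finset.range (s.sup J + 1))]
  · calc _ ≤ ∑ j ∈ Finset.range (s.sup J + 1), B * (1 / 2 : ℝ) ^ j :=
          Finset.sum_le_sum fun j _ => hJ j
      _ ≤ B * 2 := by
          rw [← Finset.mul_sum]
          exact mul_le_mul_of_nonneg_left (sum_geometric_two_le _) hB
      _ = _ := mul_comm _ _
  · intro i hi
    rw [Finset.mem_range, Nat.lt_succ_iff]
    exact Finset.le_sup hi

noncomputable def lev (v : ℝ) : ℕ := Nat.log 16 ⌊v⌋₊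

lemma lev_lower {v : ℝ} (hv : 1 ≤ v) : (16 : ℝ) ^ lev v ≤ v := by
  have h0 : ⌊v⌋₊ ≠ 0 := (Nat.floor_pos.2 hv).ne'
  have h1 : (16 : ℕ) ^ lev v ≤ ⌊v⌋₊ := Nat.pow_log_le_self 16 h0
  have h2 : ((16 ^ lev v : ℕ) : ℝ) ≤ ⌊v⌋₊ := by exact_mod_cast h1
  have h3 := Nat.floor_le (by linarith : 0 ≤ v)
  push_cast at h2
  linarith

lemma lev_upper (v : ℝ) : v < (16 : ℝ) ^ (lev v + 1) := by
  have h1 : ⌊v⌋₊ < 16 ^ (lev v + 1) := Nat.lt_pow_succ_log_self (by norm_num) _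
  have h2 := Nat.lt_floor_add_one v
  have h3 : ((⌊v⌋₊ + 1 : ℕ) : ℝ) ≤ ((16 ^ (lev v + 1) : ℕ) : ℝ) := by exact_mod_cast h1
  push_cast at h3
  linarith

lemma lev_of_lt_one {v : ℝ} (hv : v < 1) : lev v = 0 := by
  rw [lev, Nat.floor_eq_zero.2 hv, Nat.log_zero_right]

lemma sum_mul_min_one_le {ι : Type*} (s : Finset ι) (v : ι → ℝ) (hv : ∀ i ∈ s, 0 < v i) {A : ℝ}
    (hA : 0 ≤ A)
    (hcount : ∀ τ : ℝ, 0 < τ → ((s.filter fun i => τ ≤ 2 ^ lev (v i) * v i).card : ℝ) ≤ A / τ) :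
    ∑ i ∈ s, v i * min (v i) 1 ≤ 36 * A := by
  classical
  rw [← Finset.sum_filter_add_sum_filter_not s fun i => 1 ≤ v i]
  have hbig : ∑ i ∈ s.filter (fun i => 1 ≤ v i), v i * min (v i) 1 ≤ 2 * (16 * A) := by
    apply sum_le_of_geometric _ (fun i => lev (v i)) _ (by positivity)
    intro j
    have h1 := Finset.sum_le_card_nsmul
      ((s.filter fun i => 1 ≤ v i).filter fun i => lev (v i) = j)
      (fun i => v i * min (v i) 1) (16 ^ (j + 1)) (by
        intro i hi
        simp only [Finset.mem_filter] at hi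
        rw [min_eq_right hi.1.2, mul_one, ← hi.2]
        exact (lev_upper _).le)
    rw [nsmul_eq_mul] at h1
    have h2 : ((s.filter fun i => 1 ≤ v i).filter fun i => lev (v i) = j).card ≤
        (s.filter fun i => (32 : ℝ) ^ j ≤ 2 ^ lev (v i) * v i).card := by
      apply Finset.card_le_card
      intro i hi
      simp only [Finset.mem_filter] at hi ⊢
      refine ⟨hi.1.1, ?_⟩
      have := lev_lower hi.1.2
      rw [hi.2] at this ⊢
      calc (32 : ℝ) ^ j = 2 ^ j * 16 ^ j := by rw [← mul_pow]; norm_num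
        _ ≤ _ := by gcongr
    have h3 : (((s.filter fun i => 1 ≤ v i).filter fun i => lev (v i) = j).card : ℝ) ≤
        A / 32 ^ j := le_trans (by exact_mod_cast h2) (hcount (32 ^ j) (by positivity))
    calc _ ≤ A / 32 ^ j * 16 ^ (j + 1) :=
          h1.trans (mul_le_mul_of_nonneg_right h3 (by positivity))
      _ = _ := by
          rw [show (32 : ℝ) = 16 * 2 by norm_num, mul_pow, pow_succ, one_div, inv_pow]
          field_simp
  have hsmall : ∑ i ∈ s.filter (fun i => ¬ 1 ≤ v i), v i * min (v i) 1 ≤ 2 * (2 * A) := by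
    apply sum_le_of_geometric _ (fun i => Nat.log 2 ⌊(v i)⁻¹⌋₊) _ (by positivity)
    intro j
    have key : ∀ i ∈ (s.filter fun i => ¬ 1 ≤ v i).filter (fun i => Nat.log 2 ⌊(v i)⁻¹⌋₊ = j),
        v i ≤ (1 / 2) ^ j ∧ (1 / 2) ^ (j + 1) ≤ v i := by
      intro i hi
      simp only [Finset.mem_filter, not_le] at hi
      have hp := hv i hi.1.1
      have hinv : 1 ≤ (v i)⁻¹ := (one_le_inv₀ hp).2 hi.1.2.le
      have h0 : ⌊(v i)⁻¹⌋₊ ≠ 0 := (Nat.floor_pos.2 hinv).ne'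
      have h1 := Nat.pow_log_le_self 2 h0
      have h2 := Nat.lt_pow_succ_log_self (b := 2) (by norm_num) ⌊(v i)⁻¹⌋₊
      rw [hi.2] at h1 h2
      have h1' : ((2 ^ j : ℕ) : ℝ) ≤ ⌊(v i)⁻¹⌋₊ := by exact_mod_cast h1
      have h2' : ((⌊(v i)⁻¹⌋₊ + 1 : ℕ) : ℝ) ≤ ((2 ^ (j + 1) : ℕ) : ℝ) := by exact_mod_cast h2
      have h3 := Nat.floor_le (by positivity : 0 ≤ (v i)⁻¹)
      have h4 := Nat.lt_floor_add_one (v i)⁻¹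
      push_cast at h1' h2'
      rw [one_div, inv_pow, inv_pow]
      constructor
      · rw [le_inv_comm₀ hp (by positivity)]
        linarith
      · rw [inv_le_comm₀ (by positivity) hp]
        linarith
    have h1 := Finset.sum_le_card_nsmul
      ((s.filter fun i => ¬ 1 ≤ v i).filter fun i => Nat.log 2 ⌊(v i)⁻¹⌋₊ = j)
      (fun i => v i * min (v i) 1) (((1 / 2) ^ j) ^ 2) (by
        intro i hi
        have hk := key i hi
        simp only [Finset.mem_filter, not_le] at hi
        have hp := hv i hi.1.1
        rw [min_eq_left hi.1.2.le, ← sq]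
        exact pow_le_pow_left₀ hp.le hk.1 2)
    rw [nsmul_eq_mul] at h1
    have h2 : ((s.filter fun i => ¬ 1 ≤ v i).filter fun i => Nat.log 2 ⌊(v i)⁻¹⌋₊ = j).card ≤
        (s.filter fun i => ((1 : ℝ) / 2) ^ (j + 1) ≤ 2 ^ lev (v i) * v i).card := by
      apply Finset.card_le_card
      intro i hi
      have hk := key i hi
      simp only [Finset.mem_filter, not_le] at hi ⊢
      refine ⟨hi.1.1, ?_⟩
      rw [lev_of_lt_one hi.1.2, pow_zero, one_mul]
      exact hk.2
    have h3 : (((s.filter fun i => ¬ 1 ≤ v i).filter fun i =>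
        Nat.log 2 ⌊(v i)⁻¹⌋₊ = j).card : ℝ) ≤ A / (1 / 2) ^ (j + 1) :=
      le_trans (by exact_mod_cast h2) (hcount ((1 / 2) ^ (j + 1)) (by positivity))
    calc _ ≤ A / (1 / 2) ^ (j + 1) * ((1 / 2) ^ j) ^ 2 :=
          h1.trans (mul_le_mul_of_nonneg_right h3 (by positivity))
      _ = _ := by
          rw [pow_succ]
          field_simp
  linarith

noncomputable def startPos (P : Finset Pt) (c : ℝ) : ℕ := by
  classical exact (P.filter fun p => p.1 < c).card

noncomputable def endPos (P : Finset Pt) (c : ℝ) : ℕ := by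
  classical exact (P.filter fun p => p.1 ≤ c).card

lemma startPos_mono (P : Finset Pt) : Monotone (startPos P) := fun _ _ h =>
  Finset.card_le_card (Finset.monotone_filter_right P fun _ _ hx => lt_of_lt_of_le hx h)

lemma endPos_mono (P : Finset Pt) : Monotone (endPos P) := fun _ _ h =>
  Finset.card_le_card (Finset.monotone_filter_right P fun _ _ hx => le_trans hx h)

lemma startPos_le (P : Finset Pt) (c : ℝ) : startPos P c ≤ P.card := Finset.card_filter_le _ _

lemma endPos_le (P : Finset Pt) (c : ℝ) : endPos P c ≤ P.card := Finset.card_filter_le _ _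

/-- The columns of `P` over `c` and `c'` occupy nearly the same positions from left to right. -/
def Near (P : Finset Pt) (δ c c' : ℝ) : Prop :=
  |(startPos P c : ℝ) - startPos P c'| < δ ∧ |(endPos P c : ℝ) - endPos P c'| < δ

lemma sum_card_col_eq (P : Finset Pt) (S : Finset ℝ) :
    ∑ c ∈ S, (col P c).card = (P.filter fun p => p.1 ∈ S).card := by
  classical
  rw [Finset.card_eq_sum_card_fiberwise (s := P.filter fun p => p.1 ∈ S) (f := Prod.fst) (t := S)
    fun p hp => (Finset.mem_filter.1 hp).2]
  refine Finset.sum_congr rfl fun c hc => ?_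
  congr 1
  ext p
  rw [mem_col, Finset.mem_filter, Finset.mem_filter]
  constructor
  · rintro ⟨h, rfl⟩; exact ⟨⟨h, hc⟩, rfl⟩
  · rintro ⟨⟨h, _⟩, e⟩; exact ⟨h, e⟩

lemma sum_card_col_right_le (P : Finset Pt) {δ c : ℝ} (hδ : 0 ≤ δ) (S : Finset ℝ)
    (hS : ∀ c' ∈ S, c < c' ∧ Near P δ c c') : ((∑ c' ∈ S, (col P c').card : ℕ) : ℝ) ≤ δ := by
  classical
  rcases S.eq_empty_or_nonempty with rfl | hne
  · simpa using hδ
  set m := S.max' hne with hm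
  have hmS := hS m (S.max'_mem hne)
  rw [sum_card_col_eq]
  have h1 : (P.filter fun p => p.1 ∈ S).card + endPos P c ≤ endPos P m := by
    rw [endPos, ← Finset.card_union_of_disjoint]
    · apply Finset.card_le_card
      intro p hp
      rw [Finset.mem_union, Finset.mem_filter, Finset.mem_filter] at hp
      rw [Finset.mem_filter]
      rcases hp with ⟨h, h'⟩ | ⟨h, h'⟩
      · exact ⟨h, S.le_max' _ h'⟩
      · exact ⟨h, h'.trans hmS.1.le⟩
    · rw [Finset.disjoint_left]
      intro p hp hp'
      rw [Finset.mem_filter] at hp hp'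
      exact absurd (hS _ hp.2).1 (not_lt.2 hp'.2)
  have h2 : (((P.filter fun p => p.1 ∈ S).card : ℕ) : ℝ) + endPos P c ≤ endPos P m := by
    exact_mod_cast h1
  have h3 := (abs_lt.1 hmS.2.2).1
  linarith

lemma sum_card_col_left_le (P : Finset Pt) {δ c : ℝ} (hδ : 0 ≤ δ) (S : Finset ℝ)
    (hS : ∀ c' ∈ S, c' < c ∧ Near P δ c c') : ((∑ c' ∈ S, (col P c').card : ℕ) : ℝ) ≤ δ := by
  classical
  rcases S.eq_empty_or_nonempty with rfl | hne
  · simpa using hδ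
  set m := S.min' hne with hm
  have hmS := hS m (S.min'_mem hne)
  rw [sum_card_col_eq]
  have h1 : (P.filter fun p => p.1 ∈ S).card + startPos P m ≤ startPos P c := by
    rw [startPos, ← Finset.card_union_of_disjoint]
    · apply Finset.card_le_card
      intro p hp
      rw [Finset.mem_union, Finset.mem_filter, Finset.mem_filter] at hp
      rw [Finset.mem_filter]
      rcases hp with ⟨h, h'⟩ | ⟨h, h'⟩
      · exact ⟨h, (hS _ h').1⟩
      · exact ⟨h, h'.trans hmS.1⟩
    · rw [Finset.disjoint_left]
      intro p hp hp'
      rw [Finset.mem_filter] at hp hp'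
      exact absurd (S.min'_le _ hp.2) (not_le.2 hp'.2)
  have h2 : (((P.filter fun p => p.1 ∈ S).card : ℕ) : ℝ) + startPos P m ≤ startPos P c := by
    exact_mod_cast h1
  have h3 := (abs_lt.1 hmS.2.1).2
  linarith

lemma sum_card_col_near_le (P : Finset Pt) {δ c : ℝ} (hδ : 0 ≤ δ) (S : Finset ℝ)
    (hS : ∀ c' ∈ S, c' ≠ c ∧ Near P δ c c') :
    ((∑ c' ∈ S, (col P c').card : ℕ) : ℝ) ≤ 2 * δ := by
  classical
  rw [← Finset.sum_filter_add_sum_filter_not S fun c' => c < c']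
  have h1 := sum_card_col_right_le P hδ (S.filter fun c' => c < c') fun c' hc => by
    rw [Finset.mem_filter] at hc
    exact ⟨hc.2, (hS c' hc.1).2⟩
  have h2 := sum_card_col_left_le P hδ (S.filter fun c' => ¬ c < c') fun c' hc => by
    rw [Finset.mem_filter] at hc
    exact ⟨lt_of_le_of_ne (not_lt.1 hc.2) (hS c' hc.1).1, (hS c' hc.1).2⟩
  push_cast at h1 h2 ⊢
  linarith

lemma card_near_mul_wt_le (P P' : Finset Pt) {δ : ℝ} (hδ : 0 ≤ δ) (x : ℝ × ℝ)
    (Y : Finset (ℝ × ℝ)) (hY : ∀ y ∈ Y, y.1 ≠ x.1 ∧ y.2 ≠ x.2 ∧ wt P P' x ≤ wt P P' y ∧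
      Near P δ x.1 y.1 ∧ Near P' δ x.2 y.2) : (Y.card : ℝ) * wt P P' x ≤ 4 * δ ^ 2 := by
  classical
  have h1 := sum_card_col_near_le P hδ (c := x.1) (Y.image Prod.fst) (by
    intro c hc
    obtain ⟨y, hy, rfl⟩ := Finset.mem_image.1 hc
    exact ⟨(hY y hy).1, (hY y hy).2.2.2.1⟩)
  have h2 := sum_card_col_near_le P' hδ (c := x.2) (Y.image Prod.snd) (by
    intro c hc
    obtain ⟨y, hy, rfl⟩ := Finset.mem_image.1 hc
    exact ⟨(hY y hy).2.1, (hY y hy).2.2.2.2⟩)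
  have h3 : Y.card * wt P P' x ≤ (∑ c ∈ Y.image Prod.fst, (col P c).card) *
      ∑ d ∈ Y.image Prod.snd, (col P' d).card := by
    rw [Finset.sum_mul_sum, ← Finset.sum_product', ← smul_eq_mul]
    refine (Finset.card_nsmul_le_sum Y (wt P P') _ fun y hy => (hY y hy).2.2.1).trans ?_
    refine Finset.sum_le_sum_of_subset (f := wt P P') fun y hy => ?_
    exact Finset.mem_product.2 ⟨Finset.mem_image_of_mem _ hy, Finset.mem_image_of_mem _ hy⟩
  calc (Y.card : ℝ) * wt P P' x = ((Y.card * wt P P' x : ℕ) : ℝ) := by push_cast; ring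
    _ ≤ (((∑ c ∈ Y.image Prod.fst, (col P c).card) *
      ∑ d ∈ Y.image Prod.snd, (col P' d).card : ℕ) : ℝ) := by exact_mod_cast h3
    _ ≤ (2 * δ) * (2 * δ) := by
        rw [Nat.cast_mul]
        exact mul_le_mul h1 h2 (Nat.cast_nonneg _) (by positivity)
    _ = _ := by ring

/-- Pairs of columns of `P` and `P'` matched by the affine map `l`. -/
noncomputable def cols (P P' : Finset Pt) (l : ℝ × ℝ) : Finset (ℝ × ℝ) := inc (xs P) (xs P') l

lemma wt_pos_of_mem {P P' : Finset Pt} {x : ℝ × ℝ} (hx : x ∈ xs P ×ˢ xs P') : 0 < wt P P' x := by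
  obtain ⟨h1, h2⟩ := Finset.mem_product.1 hx
  obtain ⟨p, hp, e1⟩ := Finset.mem_image.1 h1
  obtain ⟨q, hq, e2⟩ := Finset.mem_image.1 h2
  exact Nat.mul_pos (Finset.card_pos.2 ⟨p, mem_col.2 ⟨hp, e1⟩⟩)
    (Finset.card_pos.2 ⟨q, mem_col.2 ⟨hq, e2⟩⟩)

lemma mem_product_of_cols {P P' : Finset Pt} {l x : ℝ × ℝ} (hx : x ∈ cols P P' l) :
    x ∈ xs P ×ˢ xs P' :=
  Finset.mem_product.2 ⟨(mem_inc.1 hx).1, (mem_inc.1 hx).2.1⟩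

/-- Some other pair of columns matched by `l` is at least as heavy as `x` and close to it. -/
def Good (P P' : Finset Pt) (l : ℝ × ℝ) (δ : ℝ) (x : ℝ × ℝ) : Prop :=
  ∃ y ∈ cols P P' l, y ≠ x ∧ wt P P' x ≤ wt P P' y ∧ Near P δ x.1 y.1 ∧ Near P' δ x.2 y.2

lemma ne_and_ne_of_cols {P P' : Finset Pt} {l x y : ℝ × ℝ} (hl : 0 < l.1)
    (hx : x ∈ cols P P' l) (hy : y ∈ cols P P' l) (hne : y ≠ x) : y.1 ≠ x.1 ∧ y.2 ≠ x.2 := by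
  have h1 := (mem_inc.1 hx).2.2
  have h2 := (mem_inc.1 hy).2.2
  refine ⟨fun e => hne (Prod.ext e (by rw [h1, h2, e])), fun e => hne (Prod.ext ?_ e)⟩
  apply mul_left_cancel₀ hl.ne'
  linarith

lemma card_good_mul_wt_le (P P' : Finset Pt) {δ : ℝ} (hδ : 0 ≤ δ) (x : ℝ × ℝ)
    (Λ : Finset (ℝ × ℝ)) (hpos : ∀ l ∈ Λ, 0 < l.1)
    (hΛ : ∀ l ∈ Λ, x ∈ cols P P' l ∧ Good P P' l δ x) :
    (Λ.card : ℝ) * wt P P' x ≤ 4 * δ ^ 2 := by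
  classical
  have hex : ∀ l, ∃ y, l ∈ Λ → y ∈ cols P P' l ∧ y ≠ x ∧ wt P P' x ≤ wt P P' y ∧
      Near P δ x.1 y.1 ∧ Near P' δ x.2 y.2 := fun l => by
    by_cases hl : l ∈ Λ
    · obtain ⟨y, h1, h2⟩ := (hΛ l hl).2
      exact ⟨y, fun _ => ⟨h1, h2⟩⟩
    · exact ⟨0, fun h => absurd h hl⟩
  choose y hy using hex
  have hinj : Set.InjOn y Λ := by
    intro l hl l' hl' e
    have h1 := (mem_inc.1 (hΛ l hl).1).2.2
    have h2 := (mem_inc.1 (hy l hl).1).2.2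
    have h3 := (mem_inc.1 (hΛ l' hl').1).2.2
    have h4 := (mem_inc.1 (hy l' hl').1).2.2
    have hne := (ne_and_ne_of_cols (hpos l hl) (hΛ l hl).1 (hy l hl).1 (hy l hl).2.1).1
    rw [← e] at h4
    have e1 : l.1 = l'.1 := by
      apply mul_right_cancel₀ (sub_ne_zero.2 hne)
      linarith
    exact Prod.ext e1 (by rw [e1] at h1; linarith)
  rw [← Finset.card_image_of_injOn hinj]
  apply card_near_mul_wt_le P P' hδ
  intro z hz
  obtain ⟨l, hl, rfl⟩ := Finset.mem_image.1 hz
  have hne := ne_and_ne_of_cols (hpos l hl) (hΛ l hl).1 (hy l hl).1 (hy l hl).2.1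
  exact ⟨hne.1, hne.2, (hy l hl).2.2⟩

lemma sum_good_le (P P' : Finset Pt) {E : ℝ} (hE : 0 ≤ E) (x : ℝ × ℝ)
    (Λ : Finset (ℝ × ℝ)) (hpos : ∀ l ∈ Λ, 0 < l.1) (n : ℝ × ℝ → ℕ)
    (hΛ : ∀ l ∈ Λ, x ∈ cols P P' l ∧ Good P P' l (E * 2 ^ n l * √(wt P P' x)) x) :
    ∑ l ∈ Λ, (wt P P' x : ℝ) * (1 / 16) ^ n l ≤ 8 * E ^ 2 * wt P P' x := by
  classical
  have h := sum_le_of_geometric Λ n (fun l => (wt P P' x : ℝ) * (1 / 16) ^ n l)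
    (B := 4 * E ^ 2 * wt P P' x) (by positivity) (by
    intro j
    have h1 := card_good_mul_wt_le P P' (δ := E * 2 ^ j * √(wt P P' x)) (by positivity) x
      (Λ.filter fun l => n l = j) (fun l hl => hpos l (Finset.mem_filter.1 hl).1) (by
        intro l hl
        obtain ⟨hl, e⟩ := Finset.mem_filter.1 hl
        have := hΛ l hl
        rwa [e] at this)
    rw [mul_pow, mul_pow, Real.sq_sqrt (Nat.cast_nonneg _)] at h1
    have h2 : ∑ l ∈ Λ.filter (fun l => n l = j), (wt P P' x : ℝ) * (1 / 16) ^ n l =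
        ((Λ.filter fun l => n l = j).card : ℝ) * wt P P' x * (1 / 16) ^ j := by
      rw [Finset.sum_congr rfl fun l hl => by rw [(Finset.mem_filter.1 hl).2], Finset.sum_const,
        nsmul_eq_mul]
      ring
    rw [h2]
    calc _ ≤ 4 * (E ^ 2 * (2 ^ j) ^ 2 * wt P P' x) * (1 / 16) ^ j :=
          mul_le_mul_of_nonneg_right h1 (by positivity)
      _ = 4 * E ^ 2 * wt P P' x * (1 / 4) ^ j := by
          rw [show ((1 : ℝ) / 4) ^ j = (2 ^ j) ^ 2 * (1 / 16) ^ j by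
            rw [← pow_mul, mul_comm j 2, pow_mul, ← mul_pow]; norm_num]
          ring
      _ ≤ _ := by gcongr; norm_num)
  linarith

lemma card_not_good_le {P P' : Finset Pt} {N : ℕ} (hP : P.card ≤ N) (hP' : P'.card ≤ N)
    {l : ℝ × ℝ} (hl : 0 < l.1) {m : ℝ × ℝ} (hm : m ∈ cols P P' l)
    (hmax : ∀ x ∈ cols P P' l, wt P P' x ≤ wt P P' m) (Δ : ℝ × ℝ → ℝ) {δ : ℝ} (hδ : 0 < δ)
    (S : Finset (ℝ × ℝ)) (hS : ∀ x ∈ S, x ∈ cols P P' l ∧ x ≠ m ∧ ¬ Good P P' l (Δ x) x ∧ δ ≤ Δ x) :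
    (S.card : ℝ) ≤ 4 * N / δ := by
  classical
  set b : ℝ × ℝ → Fin 4 → ℕ := fun x => ![⌊(startPos P x.1 : ℝ) / δ⌋₊, ⌊(endPos P x.1 : ℝ) / δ⌋₊,
    ⌊(startPos P' x.2 : ℝ) / δ⌋₊, ⌊(endPos P' x.2 : ℝ) / δ⌋₊] with hb
  set U := insert m S with hU
  have hUcols : ∀ x ∈ U, x ∈ cols P P' l := by
    intro x hx
    rcases Finset.mem_insert.1 hx with rfl | hx
    · exact hm
    · exact (hS x hx).1
  have hfl : ∀ a c : ℕ, ⌊(a : ℝ) / δ⌋₊ = ⌊(c : ℝ) / δ⌋₊ → |(a : ℝ) - c| < δ := by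
    intro a c e
    have a1 := Nat.floor_le (by positivity : 0 ≤ (a : ℝ) / δ)
    have a2 := Nat.lt_floor_add_one ((a : ℝ) / δ)
    have c1 := Nat.floor_le (by positivity : 0 ≤ (c : ℝ) / δ)
    have c2 := Nat.lt_floor_add_one ((c : ℝ) / δ)
    rw [e] at a1 a2
    have h1 : (a : ℝ) / δ - c / δ < 1 := by linarith
    have h2 : (c : ℝ) / δ - a / δ < 1 := by linarith
    rw [← sub_div, div_lt_one hδ] at h1 h2
    rw [abs_lt]
    constructor <;> linarith
  have hbad : ∀ x ∈ S, ∀ y ∈ U, y ≠ x → wt P P' x ≤ wt P P' y → b x ≠ b y := by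
    intro x hx y hy hne hw e
    have h := hS x hx
    refine h.2.2.1 ⟨y, hUcols y hy, hne, hw, ⟨?_, ?_⟩, ?_, ?_⟩
    · exact (hfl _ _ (congrFun e 0)).trans_le h.2.2.2
    · exact (hfl _ _ (congrFun e 1)).trans_le h.2.2.2
    · exact (hfl _ _ (congrFun e 2)).trans_le h.2.2.2
    · exact (hfl _ _ (congrFun e 3)).trans_le h.2.2.2
  have hinj : Set.InjOn b U := by
    intro x hx y hy e
    by_contra hne
    rcases Finset.mem_insert.1 hx with rfl | hxS
    · rcases Finset.mem_insert.1 hy with rfl | hyS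
      · exact hne rfl
      · exact hbad y hyS x hx hne (hmax y (hS y hyS).1) e.symm
    · rcases Finset.mem_insert.1 hy with rfl | hyS
      · exact hbad x hxS y hy (Ne.symm hne) (hmax x (hS x hxS).1) e
      · rcases le_total (wt P P' x) (wt P P' y) with h | h
        · exact hbad x hxS y hy (Ne.symm hne) h e
        · exact hbad y hyS x hx hne h e.symm
  have hle : ∀ a : ℕ, a ≤ N → ⌊(a : ℝ) / δ⌋₊ ≤ ⌊(N : ℝ) / δ⌋₊ := fun a ha =>
    Nat.floor_le_floor (div_le_div_of_nonneg_right (by exact_mod_cast ha) hδ.le)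
  have hchain := card_image_chain_le U b (fun _ => ⌊(N : ℝ) / δ⌋₊) (by
    intro x _ i
    fin_cases i
    · exact hle _ ((startPos_le P _).trans hP)
    · exact hle _ ((endPos_le P _).trans hP)
    · exact hle _ ((startPos_le P' _).trans hP')
    · exact hle _ ((endPos_le P' _).trans hP')) (by
    have hmono : ∀ {a c : ℕ}, a ≤ c → ⌊(a : ℝ) / δ⌋₊ ≤ ⌊(c : ℝ) / δ⌋₊ := fun h =>
      Nat.floor_le_floor (div_le_div_of_nonneg_right (by exact_mod_cast h) hδ.le)
    have key : ∀ x ∈ U, ∀ y ∈ U, x.1 ≤ y.1 → b x ≤ b y := by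
      intro x hx y hy h i
      have h2 : x.2 ≤ y.2 := by
        rw [(mem_inc.1 (hUcols x hx)).2.2, (mem_inc.1 (hUcols y hy)).2.2]
        have := mul_le_mul_of_nonneg_left h hl.le
        linarith
      fin_cases i
      · exact hmono (startPos_mono P h)
      · exact hmono (endPos_mono P h)
      · exact hmono (startPos_mono P' h2)
      · exact hmono (endPos_mono P' h2)
    intro x hx y hy
    rcases le_total x.1 y.1 with h | h
    · exact Or.inl (key x hx y hy h)
    · exact Or.inr (key y hy x hx h))
  rw [Finset.card_image_of_injOn hinj, hU, Finset.card_insert_of_notMem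
    (fun h => (hS m h).2.1 rfl)] at hchain
  simp only [Finset.sum_const, Finset.card_univ, Fintype.card_fin, smul_eq_mul] at hchain
  have h1 : (S.card : ℝ) ≤ 4 * (⌊(N : ℝ) / δ⌋₊ : ℝ) := by
    exact_mod_cast Nat.le_of_succ_le_succ hchain
  have h2 := Nat.floor_le (by positivity : 0 ≤ (N : ℝ) / δ)
  rw [mul_div_assoc]
  linarith

lemma sum_not_good_le {P P' : Finset Pt} {N : ℕ} (hP : P.card ≤ N) (hP' : P'.card ≤ N)
    {l : ℝ × ℝ} (hl : 0 < l.1) {m : ℝ × ℝ} (hm : m ∈ cols P P' l)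
    (hmax : ∀ x ∈ cols P P' l, wt P P' x ≤ wt P P' m) {E t : ℝ} (hE : 0 < E) (ht : 0 < t)
    (S : Finset (ℝ × ℝ)) (hS : ∀ x ∈ S, x ∈ cols P P' l ∧ x ≠ m ∧
      ¬ Good P P' l (E * 2 ^ lev (√(wt P P' x) / t) * √(wt P P' x)) x) :
    ∑ x ∈ S, √(wt P P' x) * min (√(wt P P' x)) t ≤ 144 * N * t / E := by
  classical
  have h := sum_mul_min_one_le S (fun x => √(wt P P' x) / t) (by
    intro x hx
    have := wt_pos_of_mem (mem_product_of_cols (hS x hx).1)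
    have : (0 : ℝ) < wt P P' x := by exact_mod_cast this
    positivity) (A := 4 * N / (E * t)) (by positivity) (by
    intro τ hτ
    have := card_not_good_le hP hP' hl hm hmax
      (fun x => E * 2 ^ lev (√(wt P P' x) / t) * √(wt P P' x)) (δ := E * t * τ) (by positivity)
      (S.filter fun x => τ ≤ 2 ^ lev (√(wt P P' x) / t) * (√(wt P P' x) / t)) (by
        intro x hx
        obtain ⟨hx, hτx⟩ := Finset.mem_filter.1 hx
        refine ⟨(hS x hx).1, (hS x hx).2.1, (hS x hx).2.2, ?_⟩
        calc E * t * τ ≤ E * t * (2 ^ lev (√(wt P P' x) / t) * (√(wt P P' x) / t)) := by gcongr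
          _ = _ := by field_simp)
    rwa [div_div])
  have h2 : ∀ x ∈ S, √(wt P P' x) * min (√(wt P P' x)) t =
      t ^ 2 * (√(wt P P' x) / t * min (√(wt P P' x) / t) 1) := by
    intro x _
    have : min (√(wt P P' x)) t = t * min (√(wt P P' x) / t) 1 := by
      rw [mul_min_of_nonneg _ _ ht.le, mul_one, mul_div_cancel₀ _ ht.ne']
    rw [this]
    field_simp
  rw [Finset.sum_congr rfl h2, ← Finset.mul_sum]
  calc _ ≤ t ^ 2 * (36 * (4 * N / (E * t))) := mul_le_mul_of_nonneg_left h (by positivity)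
    _ = _ := by field_simp; ring

lemma sqrt_mul_min_le {w t : ℝ} (hw : 0 ≤ w) (ht : 0 < t) :
    √w * min (√w) t ≤ w * (1 / 16) ^ lev (√w / t) := by
  rcases lt_or_ge (√w / t) 1 with h | h
  · rw [lev_of_lt_one h, pow_zero, mul_one]
    calc √w * min (√w) t ≤ √w * √w := by gcongr; exact min_le_left _ _
      _ = w := Real.mul_self_sqrt hw
  · have h1 := lev_lower h
    rw [le_div_iff₀ ht] at h1
    have h2 : t ≤ √w * (1 / 16) ^ lev (√w / t) := by
      rw [one_div, inv_pow, ← div_eq_mul_inv, le_div_iff₀ (by positivity)]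
      linarith
    calc √w * min (√w) t ≤ √w * (√w * (1 / 16) ^ lev (√w / t)) :=
          mul_le_mul_of_nonneg_left ((min_le_right _ _).trans h2) (Real.sqrt_nonneg _)
      _ = _ := by rw [← mul_assoc, Real.mul_self_sqrt hw]

lemma sum_sqrt_mul_min_le {P P' : Finset Pt} {N : ℕ} (hP : P.card ≤ N) (hP' : P'.card ≤ N)
    {l : ℝ × ℝ} (hl : 0 < l.1) {m : ℝ × ℝ} (hm : m ∈ cols P P' l)
    (hmax : ∀ x ∈ cols P P' l, wt P P' x ≤ wt P P' m) {E t : ℝ} (hE : 0 < E) (ht : 0 < t) 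
    [DecidablePred fun x => Good P P' l (E * 2 ^ lev (√(wt P P' x) / t) * √(wt P P' x)) x] :
    ∑ x ∈ (cols P P' l).erase m, √(wt P P' x) * min (√(wt P P' x)) t ≤ 144 * N * t / E +
      ∑ x ∈ (cols P P' l).filter
        (fun x => Good P P' l (E * 2 ^ lev (√(wt P P' x) / t) * √(wt P P' x)) x),
        (wt P P' x : ℝ) * (1 / 16) ^ lev (√(wt P P' x) / t) := by
  classical
  rw [← Finset.sum_filter_add_sum_filter_not ((cols P P' l).erase m)
    fun x => Good P P' l (E * 2 ^ lev (√(wt P P' x) / t) * √(wt P P' x)) x, add_comm]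
  refine add_le_add ?_ ?_
  · apply sum_not_good_le hP hP' hl hm hmax hE ht
    intro x hx
    obtain ⟨h1, h2⟩ := Finset.mem_filter.1 hx
    exact ⟨Finset.mem_of_mem_erase h1, Finset.ne_of_mem_erase h1, h2⟩
  · refine (Finset.sum_le_sum fun x _ => sqrt_mul_min_le (Nat.cast_nonneg _) ht).trans ?_
    refine Finset.sum_le_sum_of_subset_of_nonneg ?_ fun _ _ _ => by positivity
    exact Finset.filter_subset_filter _ (Finset.erase_subset _ _)

lemma sum_wt_le {P P' : Finset Pt} {N : ℕ} (hP : P.card ≤ N) (hP' : P'.card ≤ N) :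
    ∑ x ∈ xs P ×ˢ xs P', (wt P P' x : ℝ) ≤ (N : ℝ) ^ 2 := by
  have := (sum_wt P P').le.trans (Nat.mul_le_mul hP hP')
  rw [← sq] at this
  exact_mod_cast this

/-- Contribution of motions for which many pairs lie in richly matched columns. -/
lemma card_mul_sq_le_of_dense {P P' : Finset Pt} {N k : ℕ} (hP : P.card ≤ N)
    (hP' : P'.card ≤ N) (hN : 0 < N) (hk : 0 < k) (G : Finset Mot) (hpos : ∀ g ∈ G, 0 < g.1)
    (hG : ∀ g ∈ G, (k : ℝ) ≤ 24 * ∑ x ∈ (xs P ×ˢ xs P').filter (fun x =>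
      2 ≤ (colM P P' g x).card ∧ (wt P P' x * k : ℝ) ≤ N * ((colM P P' g x).card : ℝ) ^ 2),
        ((colM P P' g x).card : ℝ)) : (G.card : ℝ) * k ^ 2 ≤ 3888 * (N : ℝ) ^ 3 := by
  classical
  have hN' : (0 : ℝ) < N := by exact_mod_cast hN
  have hk' : (0 : ℝ) < k := by exact_mod_cast hk
  have h1 := Finset.card_nsmul_le_sum G _ (k : ℝ) hG
  simp only [Finset.sum_filter] at h1
  rw [nsmul_eq_mul, ← Finset.mul_sum, Finset.sum_comm] at h1
  have h2 : ∀ x ∈ xs P ×ˢ xs P', ∑ g ∈ G, (if 2 ≤ (colM P P' g x).card ∧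
      (wt P P' x * k : ℝ) ≤ N * ((colM P P' g x).card : ℝ) ^ 2 then
        ((colM P P' g x).card : ℝ) else 0) ≤ 162 * N / k * wt P P' x := by
    intro x hx
    have hw : (0 : ℝ) < wt P P' x := by exact_mod_cast wt_pos_of_mem hx
    rw [← Finset.sum_filter]
    have := mul_sum_card_colM_le P P' (G.filter fun g => 2 ≤ (colM P P' g x).card ∧
      (wt P P' x * k : ℝ) ≤ N * ((colM P P' g x).card : ℝ) ^ 2)
      (fun g hg => hpos g (Finset.mem_filter.1 hg).1) x (v := wt P P' x * k / N)
      (fun g hg => (Finset.mem_filter.1 hg).2.1) (fun g hg => by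
        rw [div_le_iff₀ hN', mul_comm _ (N : ℝ)]
        exact (Finset.mem_filter.1 hg).2.2)
    rw [← le_div_iff₀' (by positivity)] at this
    refine this.trans (le_of_eq ?_)
    field_simp
  have h3 := (Finset.sum_le_sum h2).trans_eq (Finset.mul_sum _ _ _).symm
  have h4 : (G.card : ℝ) * k ≤ 24 * (162 * N / k * (N : ℝ) ^ 2) :=
    h1.trans (mul_le_mul_of_nonneg_left (h3.trans
      (mul_le_mul_of_nonneg_left (sum_wt_le hP hP') (by positivity))) (by norm_num))
  calc (G.card : ℝ) * k ^ 2 = G.card * k * k := by ring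
    _ ≤ 24 * (162 * N / k * (N : ℝ) ^ 2) * k := mul_le_mul_of_nonneg_right h4 hk'.le
    _ = _ := by field_simp; ring

lemma sum_card_colM_le_wt (P P' : Finset Pt) (H : Finset Mot) (l : ℝ × ℝ)
    (hl : ∀ g ∈ H, (g.1, g.2.1) = l) (x : ℝ × ℝ) :
    ∑ g ∈ H, (colM P P' g x).card ≤ wt P P' x := by
  classical
  rw [wt, ← Finset.card_sigma, ← Finset.card_product]
  apply Finset.card_le_card_of_injOn fun y => y.2
  · rintro ⟨g, z⟩ hy
    simp only [Finset.mem_coe, Finset.mem_sigma] at hy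
    have h1 := mem_colM.1 hy.2
    have h2 := mem_mset.1 h1.1
    exact Finset.mem_product.2 ⟨mem_col.2 ⟨h2.1, h1.2.1⟩, mem_col.2 ⟨h2.2.1, h1.2.2⟩⟩
  · rintro ⟨g, z⟩ hy ⟨g', z'⟩ hy' e
    simp only [Finset.mem_coe, Finset.mem_sigma] at hy hy'
    have e : z = z' := e
    subst e
    have e1 := (hl g hy.1).trans (hl g' hy'.1).symm
    rw [Prod.mk.injEq] at e1
    have s1 := (mem_mset.1 (mem_colM.1 hy.2).1).2.2.2
    have s2 := (mem_mset.1 (mem_colM.1 hy'.2).1).2.2.2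
    rw [e1.1] at s1
    have : g = g' := Prod.ext e1.1 (Prod.ext e1.2 (by linarith))
    subst this
    rfl

lemma card_mul_le_of_sparse {P P' : Finset Pt} {N k : ℕ} (hP : P.card ≤ N)
    (hP' : P'.card ≤ N) (hN : 0 < N) (hk : 0 < k) {l : ℝ × ℝ} (hl : 0 < l.1) {m : ℝ × ℝ}
    (hm : m ∈ cols P P' l) (hmax : ∀ x ∈ cols P P' l, wt P P' x ≤ wt P P' m)
    (H : Finset Mot) (hne : H.Nonempty) (hHl : ∀ g ∈ H, (g.1, g.2.1) = l)
    (hH : ∀ g ∈ H, (k : ℝ) ≤ 24 * ∑ x ∈ ((cols P P' l).erase m).filter (fun x =>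
      (N * ((colM P P' g x).card : ℝ) ^ 2 : ℝ) ≤ wt P P' x * k), ((colM P P' g x).card : ℝ))
    {E t : ℝ} (hE : E = 6912 * √(N / k)) (ht : t = H.card * √(k / N))
    [DecidablePred fun x => Good P P' l (E * 2 ^ lev (√(wt P P' x) / t) * √(wt P P' x)) x] :
    (H.card : ℝ) * k ≤ 48 * ∑ x ∈ (cols P P' l).filter
        (fun x => Good P P' l (E * 2 ^ lev (√(wt P P' x) / t) * √(wt P P' x)) x),
        (wt P P' x : ℝ) * (1 / 16) ^ lev (√(wt P P' x) / t) := by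
  classical
  have hN' : (0 : ℝ) < N := by exact_mod_cast hN
  have hk' : (0 : ℝ) < k := by exact_mod_cast hk
  have hHc : (0 : ℝ) < H.card := by exact_mod_cast Finset.card_pos.2 hne
  have hE0 : 0 < E := by rw [hE]; positivity
  have ht0 : 0 < t := by rw [ht]; positivity
  have h1 := Finset.card_nsmul_le_sum H _ (k : ℝ) hH
  simp only [Finset.sum_filter] at h1
  rw [nsmul_eq_mul, ← Finset.mul_sum, Finset.sum_comm] at h1
  have h2 : ∀ x ∈ (cols P P' l).erase m, ∑ g ∈ H,
      (if (N * ((colM P P' g x).card : ℝ) ^ 2 : ℝ) ≤ wt P P' x * k then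
        ((colM P P' g x).card : ℝ) else 0) ≤ √(wt P P' x) * min (√(wt P P' x)) t := by
    intro x _
    rw [mul_min_of_nonneg _ _ (Real.sqrt_nonneg _), Real.mul_self_sqrt (Nat.cast_nonneg _)]
    refine le_min ?_ ?_
    · calc _ ≤ ∑ g ∈ H, ((colM P P' g x).card : ℝ) := Finset.sum_le_sum fun g _ => by
            split_ifs
            · exact le_rfl
            · positivity
        _ ≤ _ := by exact_mod_cast sum_card_colM_le_wt P P' H l hHl x
    · calc _ ≤ ∑ g ∈ H, √(wt P P' x) * √(k / N) := Finset.sum_le_sum fun g _ => by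
            split_ifs with h
            · rw [← Real.sqrt_mul (Nat.cast_nonneg _)]
              apply Real.le_sqrt_of_sq_le
              rw [← mul_div_assoc, le_div_iff₀ hN']
              linarith
            · positivity
        _ = _ := by rw [Finset.sum_const, nsmul_eq_mul, ht]; ring
  have h3 := (h1.trans (mul_le_mul_of_nonneg_left (Finset.sum_le_sum h2) (by norm_num))).trans
    (mul_le_mul_of_nonneg_left (sum_sqrt_mul_min_le hP hP' hl hm hmax hE0 ht0) (by norm_num))
  have h4 : 144 * N * t / E = H.card * k / 48 := by
    have e1 : √((k : ℝ) / N) = k / N * √((N : ℝ) / k) := by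
      rw [Real.sqrt_eq_iff_mul_self_eq (by positivity) (by positivity)]
      rw [mul_mul_mul_comm, Real.mul_self_sqrt (by positivity)]
      field_simp
    have e2 : √((N : ℝ) / k) ≠ 0 := by positivity
    rw [hE, ht, e1]
    field_simp
    norm_num
  rw [h4] at h3
  linarith

/-- Contribution of motions for which many pairs lie in poorly matched columns. -/
lemma card_mul_sq_le_of_sparse {P P' : Finset Pt} {N k : ℕ} (hP : P.card ≤ N)
    (hP' : P'.card ≤ N) (hN : 0 < N) (hk : 0 < k) (G : Finset Mot) (hpos : ∀ g ∈ G, 0 < g.1)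
    (m : ℝ × ℝ → ℝ × ℝ) (hm : ∀ g ∈ G, m (g.1, g.2.1) ∈ cols P P' (g.1, g.2.1))
    (hmax : ∀ g ∈ G, ∀ x ∈ cols P P' (g.1, g.2.1), wt P P' x ≤ wt P P' (m (g.1, g.2.1)))
    (hG : ∀ g ∈ G, (k : ℝ) ≤ 24 * ∑ x ∈ ((cols P P' (g.1, g.2.1)).erase (m (g.1, g.2.1))).filter
      (fun x => (N * ((colM P P' g x).card : ℝ) ^ 2 : ℝ) ≤ wt P P' x * k),
        ((colM P P' g x).card : ℝ)) : (G.card : ℝ) * k ^ 2 ≤ 384 * 6912 ^ 2 * (N : ℝ) ^ 3 := by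
  classical
  have hN' : (0 : ℝ) < N := by exact_mod_cast hN
  have hk' : (0 : ℝ) < k := by exact_mod_cast hk
  obtain ⟨φ, hφ⟩ : ∃ φ : Mot → ℝ × ℝ, ∀ g, φ g = (g.1, g.2.1) := ⟨fun g => (g.1, g.2.1), fun _ => rfl⟩
  obtain ⟨E, hE⟩ : ∃ E : ℝ, E = 6912 * √(N / k) := ⟨_, rfl⟩
  obtain ⟨t, ht⟩ : ∃ t : ℝ × ℝ → ℝ, ∀ l, t l =
    ((G.filter fun g => φ g = l).card : ℝ) * √(k / N) := ⟨_, fun _ => rfl⟩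
  have hEsq : E ^ 2 = 6912 ^ 2 * (N / k) := by
    rw [hE, mul_pow, Real.sq_sqrt (by positivity)]
  have hE0 : 0 ≤ E := by rw [hE]; positivity
  have hone : ∀ l ∈ G.image φ, ((G.filter fun g => φ g = l).card : ℝ) * k ≤
      48 * ∑ x ∈ (cols P P' l).filter
        (fun x => Good P P' l (E * 2 ^ lev (√(wt P P' x) / t l) * √(wt P P' x)) x),
        (wt P P' x : ℝ) * (1 / 16) ^ lev (√(wt P P' x) / t l) := by
    intro l hl
    obtain ⟨g, hg, hgl⟩ := Finset.mem_image.1 hl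
    rw [hφ] at hgl
    refine card_mul_le_of_sparse (E := E) (t := t l) hP hP' hN hk (l := l) (m := m l) ?_ ?_ ?_
      (G.filter fun g => φ g = l) ⟨g, Finset.mem_filter.2 ⟨hg, (hφ g).trans hgl⟩⟩ ?_ ?_ hE (ht l)
    · rw [← hgl]
      exact hpos g hg
    · rw [← hgl]
      exact hm g hg
    · rw [← hgl]
      exact hmax g hg
    · intro g' hg'
      rw [← hφ]
      exact (Finset.mem_filter.1 hg').2
    · intro g' hg'
      obtain ⟨h1, h2⟩ := Finset.mem_filter.1 hg'
      have := hG g' h1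
      rw [hφ] at h2
      rwa [h2] at this
  have hcard : (G.card : ℝ) = ∑ l ∈ G.image φ, ((G.filter fun g => φ g = l).card : ℝ) := by
    exact_mod_cast Finset.card_eq_sum_card_image φ G
  have hsum : (G.card : ℝ) * k ≤ 48 * ∑ l ∈ G.image φ, ∑ x ∈ xs P ×ˢ xs P',
      if x ∈ cols P P' l ∧ Good P P' l (E * 2 ^ lev (√(wt P P' x) / t l) * √(wt P P' x)) x then
        (wt P P' x : ℝ) * (1 / 16) ^ lev (√(wt P P' x) / t l) else 0 := by
    rw [hcard, Finset.sum_mul, Finset.mul_sum]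
    refine Finset.sum_le_sum fun l hl => (hone l hl).trans (le_of_eq ?_)
    rw [← Finset.sum_filter]
    congr 2
    ext x
    simp only [Finset.mem_filter]
    exact ⟨fun h => ⟨mem_product_of_cols h.1, h⟩, fun h => h.2⟩
  rw [Finset.sum_comm] at hsum
  have h2 : ∀ x ∈ xs P ×ˢ xs P', ∑ l ∈ G.image φ, (if x ∈ cols P P' l ∧
      Good P P' l (E * 2 ^ lev (√(wt P P' x) / t l) * √(wt P P' x)) x then
        (wt P P' x : ℝ) * (1 / 16) ^ lev (√(wt P P' x) / t l) else 0) ≤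
      8 * E ^ 2 * wt P P' x := by
    intro x _
    rw [← Finset.sum_filter]
    apply sum_good_le P P' hE0 x _ _ (fun l => lev (√(wt P P' x) / t l))
    · intro l hl
      exact (Finset.mem_filter.1 hl).2
    · intro l hl
      obtain ⟨g, hg, hgl⟩ := Finset.mem_image.1 (Finset.mem_filter.1 hl).1
      rw [hφ] at hgl
      rw [← hgl]
      exact hpos g hg
  have h3 := (Finset.sum_le_sum h2).trans_eq (Finset.mul_sum _ _ _).symm
  have h4 : (G.card : ℝ) * k ≤ 48 * (8 * E ^ 2 * (N : ℝ) ^ 2) :=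
    hsum.trans (mul_le_mul_of_nonneg_left (h3.trans
      (mul_le_mul_of_nonneg_left (sum_wt_le hP hP') (by positivity))) (by norm_num))
  calc (G.card : ℝ) * k ^ 2 = G.card * k * k := by ring
    _ ≤ 48 * (8 * E ^ 2 * (N : ℝ) ^ 2) * k := mul_le_mul_of_nonneg_right h4 hk'.le
    _ = _ := by rw [hEsq]; field_simp; ring

/-- Few motions match many pairs in columns with repeated matches and without a dominant one. -/
theorem card_mul_sq_le_of_cols {P P' : Finset Pt} {N k : ℕ} (hP : P.card ≤ N)
    (hP' : P'.card ≤ N) (hk : 0 < k) (G : Finset Mot) (hpos : ∀ g ∈ G, 0 < g.1)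
    (hGk : ∀ g ∈ G, k ≤ (mset P P' g).card)
    (hdom : ∀ g ∈ G, ∀ x, 4 * (colM P P' g x).card ≤ (mset P P' g).card)
    (hcol : ∀ g ∈ G, (mset P P' g).card ≤ 3 * ∑ x ∈ (xs P ×ˢ xs P').filter
      (fun x => 2 ≤ (colM P P' g x).card), (colM P P' g x).card) :
    (G.card : ℝ) * k ^ 2 ≤ 2 * 10 ^ 10 * (N : ℝ) ^ 3 := by
  classical
  rcases G.eq_empty_or_nonempty with rfl | ⟨g₀, hg₀⟩
  · simp
  have hN : 0 < N := lt_of_lt_of_le hk ((hGk g₀ hg₀).trans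
    ((card_mset_le (hpos g₀ hg₀).ne').trans hP))
  have hex : ∀ l, ∃ m, (cols P P' l).Nonempty →
      m ∈ cols P P' l ∧ ∀ x ∈ cols P P' l, wt P P' x ≤ wt P P' m := fun l => by
    by_cases h : (cols P P' l).Nonempty
    · obtain ⟨m, hm⟩ := Finset.exists_max_image (cols P P' l) (wt P P') h
      exact ⟨m, fun _ => hm⟩
    · exact ⟨0, fun h' => absurd h' h⟩
  choose m hm using hex
  have hmemcols : ∀ g : Mot, ∀ x, 2 ≤ (colM P P' g x).card → x ∈ cols P P' (g.1, g.2.1) := by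
    intro g x hx
    have hne : (colM P P' g x).Nonempty := Finset.card_pos.1 (lt_of_lt_of_le two_pos hx)
    have h1 := Finset.mem_product.1 (mem_xs_of_colM hne)
    exact mem_inc.2 ⟨h1.1, h1.2, colM_rel hne⟩
  have hne : ∀ g ∈ G, (cols P P' (g.1, g.2.1)).Nonempty := by
    intro g hg
    by_contra hemp
    rw [Finset.not_nonempty_iff_eq_empty] at hemp
    have h1 := hcol g hg
    have h2 := hGk g hg
    rw [Finset.sum_eq_zero] at h1
    · omega
    · intro x hx
      have := hmemcols g x (Finset.mem_filter.1 hx).2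
      rw [hemp] at this
      simp at this
  set dense : Mot → Prop := fun g => (k : ℝ) ≤ 24 * ∑ x ∈ (xs P ×ˢ xs P').filter (fun x =>
      2 ≤ (colM P P' g x).card ∧ (wt P P' x * k : ℝ) ≤ N * ((colM P P' g x).card : ℝ) ^ 2),
        ((colM P P' g x).card : ℝ) with hdense
  have h1 := card_mul_sq_le_of_dense hP hP' hN hk (G.filter dense)
    (fun g hg => hpos g (Finset.mem_filter.1 hg).1) (fun g hg => (Finset.mem_filter.1 hg).2)
  have h2 := card_mul_sq_le_of_sparse hP hP' hN hk (G.filter fun g => ¬ dense g)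
    (fun g hg => hpos g (Finset.mem_filter.1 hg).1) m
    (fun g hg => (hm _ (hne g (Finset.mem_filter.1 hg).1)).1)
    (fun g hg => (hm _ (hne g (Finset.mem_filter.1 hg).1)).2) (by
    intro g hg
    obtain ⟨hg, hnd⟩ := Finset.mem_filter.1 hg
    simp only [hdense, not_le] at hnd
    set M := m (g.1, g.2.1)
    have a1 : ((mset P P' g).card : ℝ) ≤ 3 * ∑ x ∈ (xs P ×ˢ xs P').filter
      (fun x => 2 ≤ (colM P P' g x).card), ((colM P P' g x).card : ℝ) := by
      exact_mod_cast hcol g hg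
    have a2 : (4 : ℝ) * (colM P P' g M).card ≤ (mset P P' g).card := by
      exact_mod_cast hdom g hg M
    have a3 : (k : ℝ) ≤ (mset P P' g).card := by exact_mod_cast hGk g hg
    have a4 : ∑ x ∈ (xs P ×ˢ xs P').filter (fun x => 2 ≤ (colM P P' g x).card),
        ((colM P P' g x).card : ℝ) ≤
        ∑ x ∈ (xs P ×ˢ xs P').filter (fun x => 2 ≤ (colM P P' g x).card ∧
          (wt P P' x * k : ℝ) ≤ N * ((colM P P' g x).card : ℝ) ^ 2), ((colM P P' g x).card : ℝ) +
        ((colM P P' g M).card + ∑ x ∈ ((cols P P' (g.1, g.2.1)).erase M).filter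
          (fun x => (N * ((colM P P' g x).card : ℝ) ^ 2 : ℝ) ≤ wt P P' x * k),
            ((colM P P' g x).card : ℝ)) := by
      rw [← Finset.sum_insert (f := fun x => ((colM P P' g x).card : ℝ)) (by simp)]
      rw [← Finset.sum_filter_add_sum_filter_not _
        fun x => (wt P P' x * k : ℝ) ≤ N * ((colM P P' g x).card : ℝ) ^ 2]
      rw [Finset.filter_filter]
      refine add_le_add_right (Finset.sum_le_sum_of_subset_of_nonneg ?_
        fun _ _ _ => Nat.cast_nonneg _) _
      intro x hx
      simp only [Finset.mem_filter, not_le] at hx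
      rw [Finset.mem_insert]
      by_cases h : x = M
      · exact Or.inl h
      · exact Or.inr (Finset.mem_filter.2 ⟨Finset.mem_erase.2 ⟨h, hmemcols g x hx.1.2⟩, hx.2.le⟩)
    linarith)
  have h3 : (G.card : ℝ) = (G.filter dense).card + (G.filter fun g => ¬ dense g).card := by
    exact_mod_cast (Finset.card_filter_add_card_filter_not dense).symm
  have h4 : (0 : ℝ) ≤ (N : ℝ) ^ 3 := by positivity
  rw [h3, add_mul]
  linarith

noncomputable def flip (P : Finset Pt) : Finset Pt := P.map (Equiv.prodComm ℝ ℝ).toEmbedding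

lemma mem_flip {P : Finset Pt} {p : Pt} : p ∈ flip P ↔ p.swap ∈ P := by
  simp [flip, Finset.mem_map_equiv]

lemma card_flip (P : Finset Pt) : (flip P).card = P.card := Finset.card_map _

/-- The symmetry exchanging rows and columns. -/
def lineFlip : Line ≃ Line where
  toFun z := (z.2.swap, z.1.swap)
  invFun z := (z.2.swap, z.1.swap)
  left_inv z := by simp
  right_inv z := by simp

def motFlip : Mot ≃ Mot where
  toFun g := (g.1, -g.2.2, -g.2.1)
  invFun g := (g.1, -g.2.2, -g.2.1)
  left_inv g := by simp
  right_inv g := by simp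

lemma rel_flip {g : Mot} {z : Line} : Rel (motFlip g) (lineFlip z) ↔ Rel g z := by
  simp only [Rel, motFlip, lineFlip, Equiv.coe_fn_mk, Prod.fst_swap, Prod.snd_swap]
  constructor <;> rintro ⟨h1, h2⟩ <;> constructor <;> linarith

lemma mem_mset_flip {P P' : Finset Pt} {g : Mot} {z : Line} :
    lineFlip z ∈ mset (flip P') (flip P) (motFlip g) ↔ z ∈ mset P P' g := by
  rw [mem_mset, mem_mset, rel_flip, mem_flip, mem_flip]
  simp only [lineFlip, Equiv.coe_fn_mk, Prod.swap_swap]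
  tauto

lemma mset_flip (P P' : Finset Pt) (g : Mot) :
    mset (flip P') (flip P) (motFlip g) = (mset P P' g).map lineFlip.toEmbedding := by
  ext z
  obtain ⟨w, rfl⟩ := lineFlip.surjective z
  rw [mem_mset_flip]
  simp

lemma card_mset_flip (P P' : Finset Pt) (g : Mot) :
    (mset (flip P') (flip P) (motFlip g)).card = (mset P P' g).card := by
  rw [mset_flip, Finset.card_map]

lemma fst_eq_iff {g : Mot} {z w : Line} (hg : g.1 ≠ 0) (hz : Rel g z) (hw : Rel g w) :
    z.1.1 = w.1.1 ↔ z.2.1 = w.2.1 := by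
  rw [hz.1, hw.1, add_left_inj, mul_right_inj' hg]

lemma snd_eq_iff {g : Mot} {z w : Line} (hg : g.1 ≠ 0) (hz : Rel g z) (hw : Rel g w) :
    z.1.2 = w.1.2 ↔ z.2.2 = w.2.2 := by
  rw [← mul_right_inj' (b := z.2.2) hg, hz.2, hw.2, add_left_inj]

lemma card_ndM_flip (P P' : Finset Pt) {g : Mot} (hg : g.1 ≠ 0) :
    (ndM (flip P') (flip P) (motFlip g)).card = (ndM P P' g).card := by
  have : ndM (flip P') (flip P) (motFlip g) =
      (ndM P P' g).map (lineFlip.prodCongr lineFlip).toEmbedding := by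
    ext z
    obtain ⟨w, rfl⟩ := (lineFlip.prodCongr lineFlip).surjective z
    rw [mem_ndM]
    simp only [Equiv.prodCongr_apply, Prod.map_fst, Prod.map_snd, mem_mset_flip,
      Finset.mem_map_equiv, mem_ndM]
    constructor
    · rintro ⟨h1, h2, h3, h4⟩
      refine ⟨h1, h2, fun e => h4 ?_, fun e => h3 ?_⟩
      · exact (fst_eq_iff hg (mem_mset.1 h1).2.2 (mem_mset.1 h2).2.2).1 e
      · exact (snd_eq_iff hg (mem_mset.1 h1).2.2 (mem_mset.1 h2).2.2).1 e
    · rintro ⟨h1, h2, h3, h4⟩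
      refine ⟨h1, h2, fun e => h4 ?_, fun e => h3 ?_⟩
      · exact (snd_eq_iff hg (mem_mset.1 h1).2.2 (mem_mset.1 h2).2.2).2 e
      · exact (fst_eq_iff hg (mem_mset.1 h1).2.2 (mem_mset.1 h2).2.2).2 e
  rw [this, Finset.card_map]

lemma card_repeated (P P' : Finset Pt) (g : Mot)
    [DecidablePred fun z : Line => 2 ≤ (colM P P' g (z.1.1, z.2.1)).card] :
    ((mset P P' g).filter fun z => 2 ≤ (colM P P' g (z.1.1, z.2.1)).card).card =
      ∑ x ∈ (xs P ×ˢ xs P').filter (fun x => 2 ≤ (colM P P' g x).card),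
        (colM P P' g x).card := by
  classical
  rw [Finset.card_eq_sum_card_fiberwise (f := fun z : Line => (z.1.1, z.2.1))
    (t := (xs P ×ˢ xs P').filter fun x => 2 ≤ (colM P P' g x).card)]
  · refine Finset.sum_congr rfl fun x hx => ?_
    congr 1
    ext z
    rw [Finset.mem_filter, Finset.mem_filter, mem_colM]
    constructor
    · rintro ⟨⟨h1, -⟩, h2⟩
      exact ⟨h1, (Prod.ext_iff.1 h2).1, (Prod.ext_iff.1 h2).2⟩
    · rintro ⟨h1, h2, h3⟩
      have e : (z.1.1, z.2.1) = x := Prod.ext h2 h3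
      refine ⟨⟨h1, ?_⟩, e⟩
      rw [e]
      exact (Finset.mem_filter.1 hx).2
  · intro z hz
    obtain ⟨h1, h2⟩ := Finset.mem_filter.1 hz
    have h1 := mem_mset.1 h1
    exact Finset.mem_filter.2 ⟨Finset.mk_mem_product (mem_xs h1.1) (mem_xs h1.2.1), h2⟩

/-- The matched pairs sharing neither a row nor a column with another one. -/
noncomputable def alone (P P' : Finset Pt) (g : Mot) : Finset Line := by
  classical exact (mset P P' g).filter fun z => ∀ w ∈ mset P P' g, z ≠ w → ND z w

lemma mem_alone {P P' : Finset Pt} {g : Mot} {z : Line} :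
    z ∈ alone P P' g ↔ z ∈ mset P P' g ∧ ∀ w ∈ mset P P' g, z ≠ w → ND z w := by
  simp [alone]

/-- The number of matched pairs sharing their column with another one. -/
noncomputable def rep (P P' : Finset Pt) (g : Mot) : ℕ :=
  ∑ x ∈ (xs P ×ˢ xs P').filter (fun x => 2 ≤ (colM P P' g x).card), (colM P P' g x).card

lemma two_le_card_colM {P P' : Finset Pt} {g : Mot} {z w : Line} (hz : z ∈ mset P P' g)
    (hw : w ∈ mset P P' g) (hzw : z ≠ w) (e : z.1.1 = w.1.1) :
    2 ≤ (colM P P' g (z.1.1, z.2.1)).card := by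
  have e' : z.2.1 = w.2.1 := by rw [(mem_mset.1 hz).2.2.1, (mem_mset.1 hw).2.2.1, e]
  exact Finset.one_lt_card.2 ⟨z, mem_colM.2 ⟨hz, rfl, rfl⟩, w, mem_colM.2 ⟨hw, e.symm, e'.symm⟩, hzw⟩

lemma card_mset_le_alone (P P' : Finset Pt) {g : Mot} (hg : g.1 ≠ 0) :
    (mset P P' g).card ≤
      (alone P P' g).card + rep P P' g + rep (flip P') (flip P) (motFlip g) := by
  classical
  have hsub : mset P P' g ⊆ (alone P P' g ∪
      (mset P P' g).filter fun z => 2 ≤ (colM P P' g (z.1.1, z.2.1)).card) ∪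
      ((mset (flip P') (flip P) (motFlip g)).filter fun z =>
        2 ≤ (colM (flip P') (flip P) (motFlip g) (z.1.1, z.2.1)).card).map
          lineFlip.symm.toEmbedding := by
    intro z hz
    by_contra hcon
    simp only [Finset.mem_union, not_or] at hcon
    obtain ⟨⟨h1, h2⟩, h3⟩ := hcon
    refine h1 (mem_alone.2 ⟨hz, fun w hw hzw => ⟨fun e => h2 ?_, fun e => h3 ?_⟩⟩)
    · exact Finset.mem_filter.2 ⟨hz, two_le_card_colM hz hw hzw e⟩
    · rw [Finset.mem_map_equiv, Equiv.symm_symm, Finset.mem_filter]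
      refine ⟨mem_mset_flip.2 hz, two_le_card_colM (mem_mset_flip.2 hz) (mem_mset_flip.2 hw)
        (lineFlip.injective.ne hzw) ?_⟩
      exact (snd_eq_iff hg (mem_mset.1 hz).2.2 (mem_mset.1 hw).2.2).1 e
  refine (Finset.card_le_card hsub).trans ((Finset.card_union_le _ _).trans ?_)
  rw [Finset.card_map, card_repeated]
  refine Nat.add_le_add ((Finset.card_union_le _ _).trans ?_) le_rfl
  rw [card_repeated]
  exact le_rfl

lemma sum_card_ndM_le_of_card {P P' : Finset Pt} {k : ℕ} {G : Finset Mot} {C : ℝ}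
    (hG2k : ∀ g ∈ G, (mset P P' g).card ≤ 2 * k) (hG : (G.card : ℝ) * k ^ 2 ≤ C) :
    ∑ g ∈ G, ((ndM P P' g).card : ℝ) ≤ 4 * C := by
  have : ∑ g ∈ G, ((ndM P P' g).card : ℝ) ≤ ∑ g ∈ G, (4 * (k : ℝ) ^ 2) := by
    refine Finset.sum_le_sum fun g hg => ?_
    have := (card_ndM_le_sq P P' g).trans (Nat.pow_le_pow_left (hG2k g hg) 2)
    have h : ((ndM P P' g).card : ℝ) ≤ ((2 * k : ℕ) : ℝ) ^ 2 := by exact_mod_cast this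
    push_cast at h
    linarith
  rw [Finset.sum_const, nsmul_eq_mul] at this
  linarith

/-- Motions with about `k` matched pairs contribute `O(N ^ 3)` nondegenerate pairs of pairs. -/
theorem sum_card_ndM_level_le {P P' : Finset Pt} {N k : ℕ} (hP : P.card ≤ N) (hP' : P'.card ≤ N)
    (G : Finset Mot) (hpos : ∀ g ∈ G, 0 < g.1) (hGk : ∀ g ∈ G, k ≤ (mset P P' g).card)
    (hG2k : ∀ g ∈ G, (mset P P' g).card ≤ 2 * k) (hnd : ∀ g ∈ G, (ndM P P' g).Nonempty) :
    ∑ g ∈ G, ((ndM P P' g).card : ℝ) ≤ 2 * 10 ^ 11 * (N : ℝ) ^ 3 := by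
  classical
  have hN : (0 : ℝ) ≤ (N : ℝ) ^ 3 := by positivity
  rcases lt_or_ge k 16 with hk | hk
  · have h1 : G.card ≤ 12 * N ^ 3 := by
      refine card_motions_le hP hP' G fun g hg => ?_
      obtain ⟨z, hz⟩ := hnd g hg
      obtain ⟨h1, h2, h3⟩ := mem_ndM.1 hz
      have h1 := mem_mset.1 h1
      have h2 := mem_mset.1 h2
      exact ⟨z.1, Finset.mem_product.2 ⟨h1.1, h1.2.1⟩, z.2, Finset.mem_product.2 ⟨h2.1, h2.2.1⟩,
        h3, h1.2.2, h2.2.2⟩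
    have h2 : G.card * k ^ 2 ≤ 12 * N ^ 3 * 16 ^ 2 :=
      Nat.mul_le_mul h1 (Nat.pow_le_pow_left hk.le 2)
    have h3 : (G.card : ℝ) * k ^ 2 ≤ 12 * N ^ 3 * 16 ^ 2 := by exact_mod_cast h2
    have := sum_card_ndM_le_of_card hG2k h3
    linarith
  set p₁ : Mot → Prop := fun g => ∃ x, (mset P P' g).card ≤ 4 * (colM P P' g x).card with hp₁
  set p₂ : Mot → Prop := fun g => ∃ x, (mset P P' g).card ≤
    4 * (colM (flip P') (flip P) (motFlip g) x).card with hp₂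
  set p₃ : Mot → Prop := fun g => (mset P P' g).card ≤ 3 * (alone P P' g).card with hp₃
  set p₄ : Mot → Prop := fun g => (mset P P' g).card ≤ 3 * rep P P' g with hp₄
  have hflip : ∀ H ⊆ G, ∑ g ∈ H, ((ndM P P' g).card : ℝ) =
      ∑ g ∈ H.map motFlip.toEmbedding, ((ndM (flip P') (flip P) g).card : ℝ) := by
    intro H hH
    rw [Finset.sum_map]
    exact Finset.sum_congr rfl fun g hg => by
      rw [Equiv.coe_toEmbedding, card_ndM_flip P P' (hpos g (hH hg)).ne']
  have hflip' : ∀ H ⊆ G, ∀ g ∈ H.map motFlip.toEmbedding, ∃ g' ∈ H, g' ∈ G ∧ motFlip g' = g := by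
    intro H hH g hg
    obtain ⟨g', hg', rfl⟩ := Finset.mem_map.1 hg
    exact ⟨g', hg', hH hg', rfl⟩
  have hposf : ∀ H ⊆ G, ∀ g ∈ H.map motFlip.toEmbedding, 0 < g.1 := by
    intro H hH g hg
    obtain ⟨g', -, hg', rfl⟩ := hflip' H hH g hg
    exact hpos g' hg'
  have hkf : ∀ H ⊆ G, ∀ g ∈ H.map motFlip.toEmbedding, k ≤ (mset (flip P') (flip P) g).card := by
    intro H hH g hg
    obtain ⟨g', -, hg', rfl⟩ := hflip' H hH g hg
    rw [card_mset_flip]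
    exact hGk g' hg'
  have h2kf : ∀ H ⊆ G, ∀ g ∈ H.map motFlip.toEmbedding,
      (mset (flip P') (flip P) g).card ≤ 2 * k := by
    intro H hH g hg
    obtain ⟨g', -, hg', rfl⟩ := hflip' H hH g hg
    rw [card_mset_flip]
    exact hG2k g' hg'
  have hPf : (flip P).card ≤ N := (card_flip P).trans_le hP
  have hPf' : (flip P').card ≤ N := (card_flip P').trans_le hP'
  have hG1 : G.filter p₁ ⊆ G := Finset.filter_subset _ _
  set G2 := G.filter fun g => ¬ p₁ g with hG2
  have hG2s : G2 ⊆ G := Finset.filter_subset _ _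
  have hG2p : G2.filter p₂ ⊆ G := (Finset.filter_subset _ _).trans hG2s
  set G3 := G2.filter fun g => ¬ p₂ g with hG3
  have hG3s : G3 ⊆ G := (Finset.filter_subset _ _).trans hG2s
  have hG3p : G3.filter p₃ ⊆ G := (Finset.filter_subset _ _).trans hG3s
  set G4 := G3.filter fun g => ¬ p₃ g with hG4
  have hG4s : G4 ⊆ G := (Finset.filter_subset _ _).trans hG3s
  have hG4p : G4.filter p₄ ⊆ G := (Finset.filter_subset _ _).trans hG4s
  set G5 := G4.filter fun g => ¬ p₄ g with hG5
  have hG5s : G5 ⊆ G := (Finset.filter_subset _ _).trans hG4s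
  have hdom : ∀ g ∈ G3, (∀ x, 4 * (colM P P' g x).card ≤ (mset P P' g).card) ∧
      ∀ x, 4 * (colM (flip P') (flip P) (motFlip g) x).card ≤ (mset P P' g).card := by
    intro g hg
    obtain ⟨h1, h2⟩ := Finset.mem_filter.1 hg
    have h1 := (Finset.mem_filter.1 h1).2
    simp only [hp₁, hp₂, not_exists, not_le] at h1 h2
    exact ⟨fun x => (h1 x).le, fun x => (h2 x).le⟩
  have b1 := sum_card_ndM_le_of_dominant hP hP' (by omega) (G.filter p₁)
    (fun g hg => hpos g (hG1 hg)) (fun g hg => hGk g (hG1 hg)) (fun g hg => hG2k g (hG1 hg))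
    (fun g hg => (Finset.mem_filter.1 hg).2)
  have b2 : ∑ g ∈ G2.filter p₂, ((ndM P P' g).card : ℝ) ≤ 576 * (N : ℝ) ^ 3 := by
    rw [hflip _ hG2p]
    refine sum_card_ndM_le_of_dominant hPf' hPf (k := k) (by omega) _ (hposf _ hG2p)
      (hkf _ hG2p) (h2kf _ hG2p) fun g hg => ?_
    obtain ⟨g', hg', -, rfl⟩ := hflip' _ hG2p g hg
    rw [card_mset_flip]
    exact (Finset.mem_filter.1 hg').2
  have b3 : ∑ g ∈ G3.filter p₃, ((ndM P P' g).card : ℝ) ≤ 4 * (9 * 57600 * (N : ℝ) ^ 3) := by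
    refine sum_card_ndM_le_of_card (k := k) (fun g hg => hG2k g (hG3p hg)) ?_
    have h1 := card_mul_sq_le_of_ND hP hP' (K := (k + 2) / 3) (G3.filter p₃)
      (fun g hg => hpos g (hG3p hg)) (alone P P') (fun g _ => Finset.filter_subset _ _)
      (fun g _ z hz w hw hzw => (mem_alone.1 hz).2 w (mem_alone.1 hw).1 hzw) (by omega)
      (fun g hg => by
        have h1 : (mset P P' g).card ≤ 3 * (alone P P' g).card := (Finset.mem_filter.1 hg).2
        have h2 := hGk g (hG3p hg)
        omega)
    have h2 : k ≤ 3 * ((k + 2) / 3) := by omega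
    have h3 : (k : ℝ) ≤ 3 * (((k + 2) / 3 : ℕ) : ℝ) := by exact_mod_cast h2
    have h4 : ((G3.filter p₃).card : ℝ) * (((k + 2) / 3 : ℕ) : ℝ) ^ 2 ≤ 57600 * (N : ℝ) ^ 3 := by
      exact_mod_cast h1
    calc ((G3.filter p₃).card : ℝ) * (k : ℝ) ^ 2
        ≤ (G3.filter p₃).card * (3 * (((k + 2) / 3 : ℕ) : ℝ)) ^ 2 := by gcongr
      _ = 9 * ((G3.filter p₃).card * (((k + 2) / 3 : ℕ) : ℝ) ^ 2) := by ring
      _ ≤ _ := by linarith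
  have b4 : ∑ g ∈ G4.filter p₄, ((ndM P P' g).card : ℝ) ≤ 4 * (2 * 10 ^ 10 * (N : ℝ) ^ 3) :=
    sum_card_ndM_le_of_card (k := k) (fun g hg => hG2k g (hG4p hg))
      (card_mul_sq_le_of_cols hP hP' (by omega) _ (fun g hg => hpos g (hG4p hg))
        (fun g hg => hGk g (hG4p hg))
        (fun g hg => (hdom g (Finset.mem_filter.1 (Finset.mem_filter.1 hg).1).1).1)
        (fun g hg => (Finset.mem_filter.1 hg).2))
  have b5 : ∑ g ∈ G5, ((ndM P P' g).card : ℝ) ≤ 4 * (2 * 10 ^ 10 * (N : ℝ) ^ 3) := by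
    rw [hflip _ hG5s]
    refine sum_card_ndM_le_of_card (k := k) (h2kf _ hG5s)
      (card_mul_sq_le_of_cols hPf' hPf (by omega) _ (hposf _ hG5s) (hkf _ hG5s) ?_ ?_)
    · intro g hg x
      obtain ⟨g', hg', -, rfl⟩ := hflip' _ hG5s g hg
      rw [card_mset_flip]
      exact (hdom g' (Finset.mem_filter.1 (Finset.mem_filter.1 hg').1).1).2 x
    · intro g hg
      obtain ⟨g', hg', hgG, rfl⟩ := hflip' _ hG5s g hg
      rw [card_mset_flip]
      obtain ⟨h1, h2⟩ := Finset.mem_filter.1 hg'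
      have h1 := (Finset.mem_filter.1 h1).2
      simp only [hp₃, hp₄, not_le] at h1 h2
      have h3 := card_mset_le_alone P P' (hpos g' hgG).ne'
      change _ ≤ 3 * rep (flip P') (flip P) (motFlip g')
      omega
  have s1 := Finset.sum_filter_add_sum_filter_not G p₁ fun g => ((ndM P P' g).card : ℝ)
  have s2 := Finset.sum_filter_add_sum_filter_not G2 p₂ fun g => ((ndM P P' g).card : ℝ)
  have s3 := Finset.sum_filter_add_sum_filter_not G3 p₃ fun g => ((ndM P P' g).card : ℝ)
  have s4 := Finset.sum_filter_add_sum_filter_not G4 p₄ fun g => ((ndM P P' g).card : ℝ)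
  rw [← hG2] at s1
  rw [← hG3] at s2
  rw [← hG4] at s3
  rw [← hG5] at s4
  linarith

theorem sum_card_ndM_le {P P' : Finset Pt} {N : ℕ} (hP : P.card ≤ N) (hP' : P'.card ≤ N)
    (G : Finset Mot) (hpos : ∀ g ∈ G, 0 < g.1) :
    ∑ g ∈ G, ((ndM P P' g).card : ℝ) ≤ 2 * 10 ^ 11 * (N : ℝ) ^ 3 * (Nat.log 2 N + 1) := by
  classical
  have h0 : ∑ g ∈ G, ((ndM P P' g).card : ℝ) =
      ∑ g ∈ G.filter fun g => (ndM P P' g).Nonempty, ((ndM P P' g).card : ℝ) := by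
    rw [Finset.sum_filter]
    refine Finset.sum_congr rfl fun g _ => ?_
    split_ifs with h
    · rfl
    · rw [Finset.not_nonempty_iff_eq_empty.1 h]
      simp
  rw [h0, ← Finset.sum_fiberwise_of_maps_to (t := Finset.range (Nat.log 2 N + 1))
    (g := fun g => Nat.log 2 (mset P P' g).card)]
  · refine (Finset.sum_le_card_nsmul _ _ (2 * 10 ^ 11 * (N : ℝ) ^ 3) fun j _ => ?_).trans_eq ?_
    · have hmem : ∀ g ∈ (G.filter fun g => (ndM P P' g).Nonempty).filter
          (fun g => Nat.log 2 (mset P P' g).card = j), g ∈ G ∧ (ndM P P' g).Nonempty ∧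
            2 ^ j ≤ (mset P P' g).card ∧ (mset P P' g).card ≤ 2 * 2 ^ j := by
        intro g hg
        obtain ⟨h1, h2⟩ := Finset.mem_filter.1 hg
        obtain ⟨h1, z, hz⟩ := Finset.mem_filter.1 h1
        have hne : (mset P P' g).card ≠ 0 := (Finset.card_pos.2 ⟨z.1, (mem_ndM.1 hz).1⟩).ne'
        refine ⟨h1, ⟨z, hz⟩, ?_, ?_⟩
        · rw [← h2]
          exact Nat.pow_log_le_self 2 hne
        · rw [← h2, ← pow_succ']
          exact (Nat.lt_pow_succ_log_self one_lt_two _).le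
      exact sum_card_ndM_level_le (k := 2 ^ j) hP hP' _ (fun g hg => hpos g (hmem g hg).1)
        (fun g hg => (hmem g hg).2.2.1) (fun g hg => (hmem g hg).2.2.2)
        (fun g hg => (hmem g hg).2.1)
    · rw [Finset.card_range, nsmul_eq_mul]
      push_cast
      ring
  · intro g hg
    refine Finset.mem_coe.2 (Finset.mem_range_succ_iff.2 (Nat.log_mono_right ?_))
    exact (card_mset_le (hpos g (Finset.mem_filter.1 hg).1).ne').trans hP

/-- Pairs of pairs of points spanning equal nonzero rectangular areas. -/
noncomputable def equalAreas (P P' : Finset Pt) : Finset ((Pt × Pt) × (Pt × Pt)) := by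
  classical exact ((P ×ˢ P) ×ˢ (P' ×ˢ P')).filter fun t =>
    rectArea t.1.1 t.1.2 = rectArea t.2.1 t.2.2 ∧ rectArea t.1.1 t.1.2 ≠ 0

lemma mem_equalAreas {P P' : Finset Pt} {t : (Pt × Pt) × (Pt × Pt)} :
    t ∈ equalAreas P P' ↔ ((t.1.1 ∈ P ∧ t.1.2 ∈ P) ∧ t.2.1 ∈ P' ∧ t.2.2 ∈ P') ∧
      rectArea t.1.1 t.1.2 = rectArea t.2.1 t.2.2 ∧ rectArea t.1.1 t.1.2 ≠ 0 := by
  simp only [equalAreas, Finset.mem_filter, Finset.mem_product]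

/-- The horizontal dilation factor of the motion taking the first pair to the second one. -/
noncomputable def dil (t : (Pt × Pt) × (Pt × Pt)) : ℝ :=
  (t.2.2.1 - t.2.1.1) / (t.1.2.1 - t.1.1.1)

noncomputable def motOf (t : (Pt × Pt) × (Pt × Pt)) : Mot :=
  (dil t, t.2.1.1 - dil t * t.1.1.1, dil t * t.2.1.2 - t.1.1.2)

lemma card_equalAreas_pos_le {P P' : Finset Pt} {N : ℕ} (hP : P.card ≤ N) (hP' : P'.card ≤ N) :
    (((equalAreas P P').filter fun t => 0 < dil t).card : ℝ) ≤
      2 * 10 ^ 11 * (N : ℝ) ^ 3 * (Nat.log 2 N + 1) := by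
  classical
  set T := (equalAreas P P').filter fun t => 0 < dil t with hT
  refine le_trans ?_ (sum_card_ndM_le hP hP' (T.image motOf) ?_)
  · rw [← Nat.cast_sum, Nat.cast_le, Finset.card_eq_sum_card_image motOf T]
    refine Finset.sum_le_sum fun g _ => ?_
    refine Finset.card_le_card_of_injOn (fun t => ((t.1.1, t.2.1), (t.1.2, t.2.2))) ?_ ?_
    · intro t ht
      obtain ⟨ht, hg⟩ := Finset.mem_filter.1 ht
      obtain ⟨⟨⟨h1, h2⟩, h3, h4⟩, h5, h6⟩ := mem_equalAreas.1 (Finset.mem_filter.1 ht).1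
      simp only [rectArea] at h5 h6
      obtain ⟨h6, h7⟩ := mul_ne_zero_iff.1 h6
      have hd : dil t * (t.1.2.1 - t.1.1.1) = t.2.2.1 - t.2.1.1 := div_mul_cancel₀ _ h6
      have hd' : dil t * (t.2.2.2 - t.2.1.2) = t.1.2.2 - t.1.1.2 := by
        apply mul_left_cancel₀ h6
        rw [h5, ← hd]
        ring
      subst hg
      refine mem_ndM.2 ⟨mem_mset.2 ⟨h1, h3, ?_, ?_⟩, mem_mset.2 ⟨h2, h4, ?_, ?_⟩,
        fun e => h6 ?_, fun e => h7 ?_⟩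
      · simp [motOf]
      · simp [motOf]
      · simp only [motOf]
        linarith
      · simp only [motOf]
        linarith
      · exact sub_eq_zero.2 e.symm
      · exact sub_eq_zero.2 e.symm
    · intro t _ t' _ e
      simp only [Prod.mk.injEq] at e
      exact Prod.ext (Prod.ext e.1.1 e.2.1) (Prod.ext e.1.2 e.2.2)
  · intro g hg
    obtain ⟨t, ht, rfl⟩ := Finset.mem_image.1 hg
    exact (Finset.mem_filter.1 ht).2

lemma card_equalAreas_le (P : Finset Pt) :
    ((equalAreas P P).card : ℝ) ≤ 4 * 10 ^ 11 * (P.card : ℝ) ^ 3 * (Nat.log 2 P.card + 1) := by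
  classical
  set P' : Finset Pt := P.map (Equiv.neg Pt).toEmbedding with hP'
  have h1 := card_equalAreas_pos_le (le_refl P.card) (le_refl P.card)
  have h2 := card_equalAreas_pos_le (P := P) (P' := P') le_rfl (Finset.card_map _).le
  have h3 : ((equalAreas P P).filter fun t => ¬ 0 < dil t).card ≤
      ((equalAreas P P').filter fun t => 0 < dil t).card := by
    refine Finset.card_le_card_of_injOn (fun t => (t.1, (-t.2.1, -t.2.2))) ?_ ?_
    · intro t ht
      obtain ⟨ht, hd⟩ := Finset.mem_filter.1 ht
      obtain ⟨⟨h12, h3, h4⟩, h5, h6⟩ := mem_equalAreas.1 ht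
      have e : rectArea (-t.2.1) (-t.2.2) = rectArea t.2.1 t.2.2 := by
        simp only [rectArea, Prod.fst_neg, Prod.snd_neg]
        ring
      have e' : dil (t.1, (-t.2.1, -t.2.2)) = -dil t := by
        simp only [dil, Prod.fst_neg]
        ring
      refine Finset.mem_filter.2 ⟨mem_equalAreas.2 ⟨⟨h12, ?_, ?_⟩, h5.trans e.symm, h6⟩, ?_⟩
      · simpa [hP', Finset.mem_map_equiv] using h3
      · simpa [hP', Finset.mem_map_equiv] using h4
      · rw [e', neg_pos]
        refine lt_of_le_of_ne (not_lt.1 hd) (div_ne_zero ?_ ?_)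
        · rw [h5] at h6
          exact (mul_ne_zero_iff.1 h6).1
        · exact (mul_ne_zero_iff.1 h6).1
    · intro t _ t' _ e
      simp only [Prod.mk.injEq, neg_inj] at e
      exact Prod.ext e.1 (Prod.ext e.2.1 e.2.2)
  have h4 := Finset.card_filter_add_card_filter_not (s := equalAreas P P) fun t => 0 < dil t
  have h5 : (((equalAreas P P).filter fun t => ¬ 0 < dil t).card : ℝ) ≤
      ((equalAreas P P').filter fun t => 0 < dil t).card := by exact_mod_cast h3
  rw [← h4]
  push_cast
  linarith

noncomputable def areas (P : Finset Pt) : Finset ℝ := by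
  classical exact (P ×ˢ P).image fun pq => rectArea pq.1 pq.2

lemma mem_areas {P : Finset Pt} {p q : Pt} (hp : p ∈ P) (hq : q ∈ P) : rectArea p q ∈ areas P :=
  Finset.mem_image.2 ⟨(p, q), Finset.mk_mem_product hp hq, rfl⟩

lemma card_col_le_card_areas {P : Finset Pt} {c : ℝ} (h : ∃ q ∈ P, q.1 ≠ c) :
    (col P c).card ≤ (areas P).card := by
  obtain ⟨q, hq, hqc⟩ := h
  refine Finset.card_le_card_of_injOn (rectArea q) (fun p hp => mem_areas hq (mem_col.1 hp).1) ?_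
  intro p hp p' hp' e
  have h1 := (mem_col.1 hp).2
  have h2 := (mem_col.1 hp').2
  simp only [rectArea, h1, h2] at e
  have := mul_left_cancel₀ (sub_ne_zero.2 hqc.symm) e
  exact Prod.ext (h1.trans h2.symm) (by linarith)

lemma card_areas_flip_le (P : Finset Pt) : (areas (flip P)).card ≤ (areas P).card := by
  refine Finset.card_le_card fun a ha => ?_
  obtain ⟨⟨p, q⟩, h, rfl⟩ := Finset.mem_image.1 ha
  obtain ⟨hp, hq⟩ := Finset.mem_product.1 h
  have := mem_areas (mem_flip.1 hp) (mem_flip.1 hq)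
  simp only [rectArea, Prod.fst_swap, Prod.snd_swap] at this ⊢
  rwa [mul_comm]

lemma sq_card_le_card_image_mul {α β : Type*} [DecidableEq β] (D : Finset α) (f : α → β) :
    D.card ^ 2 ≤ (D.image f).card * ((D ×ˢ D).filter fun t => f t.1 = f t.2).card := by
  classical
  have h : ((D ×ˢ D).filter fun t => f t.1 = f t.2).card =
      ∑ b ∈ D.image f, (D.filter fun a => f a = b).card ^ 2 := by
    rw [Finset.card_eq_sum_card_fiberwise (f := fun t => f t.1) (t := D.image f)]
    · refine Finset.sum_congr rfl fun b _ => ?_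
      rw [sq, ← Finset.card_product]
      congr 1
      ext t
      simp only [Finset.mem_filter, Finset.mem_product]
      constructor
      · rintro ⟨⟨⟨h1, h2⟩, h3⟩, h4⟩
        exact ⟨⟨h1, h4⟩, h2, h3.symm.trans h4⟩
      · rintro ⟨⟨h1, h4⟩, h2, h3⟩
        exact ⟨⟨⟨h1, h2⟩, h4.trans h3.symm⟩, h4⟩
    · intro t ht
      exact Finset.mem_image_of_mem f (Finset.mem_product.1 (Finset.mem_filter.1 ht).1).1
  rw [h, Finset.card_eq_sum_card_image f D]
  exact sq_sum_le_card_mul_sum_sq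

lemma sq_card_le_of_col_le {P : Finset Pt} (h1 : ∀ c, 4 * (col P c).card ≤ P.card)
    (h2 : ∀ c, 4 * (col (flip P) c).card ≤ P.card)
    [DecidablePred fun pq : Pt × Pt => rectArea pq.1 pq.2 ≠ 0] :
    P.card ^ 2 ≤ 2 * ((P ×ˢ P).filter fun pq => rectArea pq.1 pq.2 ≠ 0).card := by
  classical
  have hz : 2 * ((P ×ˢ P).filter fun pq => ¬ rectArea pq.1 pq.2 ≠ 0).card ≤ P.card ^ 2 := by
    have hsub : ((P ×ˢ P).filter fun pq => ¬ rectArea pq.1 pq.2 ≠ 0) ⊆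
        P.biUnion fun p => (col P p.1 ∪ flip (col (flip P) p.2)).image fun q => (p, q) := by
      rintro ⟨p, q⟩ h
      obtain ⟨h3, h4⟩ := Finset.mem_filter.1 h
      obtain ⟨hp, hq⟩ := Finset.mem_product.1 h3
      refine Finset.mem_biUnion.2 ⟨p, hp, Finset.mem_image.2 ⟨q, Finset.mem_union.2 ?_, rfl⟩⟩
      rcases mul_eq_zero.1 (not_not.1 h4) with h5 | h5
      · exact Or.inl (mem_col.2 ⟨hq, sub_eq_zero.1 h5⟩)
      · exact Or.inr (mem_flip.2 (mem_col.2 ⟨mem_flip.2 hq, sub_eq_zero.1 h5⟩))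
    have h5 : ((P ×ˢ P).filter fun pq => ¬ rectArea pq.1 pq.2 ≠ 0).card ≤
        ∑ p ∈ P, ((col P p.1).card + (col (flip P) p.2).card) := by
      refine (Finset.card_le_card hsub).trans (Finset.card_biUnion_le.trans
        (Finset.sum_le_sum fun p _ => Finset.card_image_le.trans
          ((Finset.card_union_le _ _).trans ?_)))
      rw [card_flip]
    have h6 : 2 * ∑ p ∈ P, ((col P p.1).card + (col (flip P) p.2).card) ≤ ∑ p ∈ P, P.card := by
      rw [Finset.mul_sum]
      refine Finset.sum_le_sum fun p _ => ?_
      have := h1 p.1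
      have := h2 p.2
      omega
    rw [Finset.sum_const, smul_eq_mul, ← sq] at h6
    omega
  have h3 := Finset.card_filter_add_card_filter_not (s := P ×ˢ P)
    fun pq => rectArea pq.1 pq.2 ≠ 0
  rw [Finset.card_product, ← sq] at h3
  omega

lemma pow_card_le_of_col_le {P : Finset Pt} (h1 : ∀ c, 4 * (col P c).card ≤ P.card)
    (h2 : ∀ c, 4 * (col (flip P) c).card ≤ P.card) :
    P.card ^ 4 ≤ 4 * ((areas P).card * (equalAreas P P).card) := by
  classical
  set D := (P ×ˢ P).filter fun pq => rectArea pq.1 pq.2 ≠ 0 with hD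
  have h3 : P.card ^ 2 ≤ 2 * D.card := sq_card_le_of_col_le h1 h2
  have h4 := sq_card_le_card_image_mul D fun pq => rectArea pq.1 pq.2
  have h5 : (D.image fun pq => rectArea pq.1 pq.2).card ≤ (areas P).card := by
    refine Finset.card_le_card fun a ha => ?_
    obtain ⟨pq, h, rfl⟩ := Finset.mem_image.1 ha
    obtain ⟨hp, hq⟩ := Finset.mem_product.1 (Finset.mem_filter.1 h).1
    exact mem_areas hp hq
  have h6 : ((D ×ˢ D).filter fun t => rectArea t.1.1 t.1.2 = rectArea t.2.1 t.2.2).card ≤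
      (equalAreas P P).card := by
    refine Finset.card_le_card fun t ht => ?_
    obtain ⟨h, he⟩ := Finset.mem_filter.1 ht
    obtain ⟨hp, hq⟩ := Finset.mem_product.1 h
    obtain ⟨hp, hp0⟩ := Finset.mem_filter.1 hp
    have hq := (Finset.mem_filter.1 hq).1
    exact mem_equalAreas.2 ⟨⟨Finset.mem_product.1 hp, Finset.mem_product.1 hq⟩, he, hp0⟩
  calc P.card ^ 4 = (P.card ^ 2) ^ 2 := by ring
    _ ≤ (2 * D.card) ^ 2 := Nat.pow_le_pow_left h3 2
    _ = 4 * D.card ^ 2 := by ring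
    _ ≤ _ := Nat.mul_le_mul_left 4 (h4.trans (Nat.mul_le_mul h5 h6))

lemma log_two_add_one_le {n : ℕ} (hn : 2 ≤ n) : (Nat.log 2 n + 1 : ℝ) ≤ 4 * Real.log n := by
  have h2 : (1 / 2 : ℝ) ≤ Real.log 2 := by linarith [Real.log_two_gt_d9]
  have h3 : Real.log 2 ≤ Real.log n := Real.log_le_log two_pos (by exact_mod_cast hn)
  have h4 : (Nat.log 2 n : ℝ) * Real.log 2 ≤ Real.log n := by
    rw [← Real.log_pow]
    exact Real.log_le_log (by positivity) (by exact_mod_cast Nat.pow_log_le_self 2 (by omega))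
  have h5 : (0 : ℝ) ≤ Nat.log 2 n := Nat.cast_nonneg _
  nlinarith

theorem card_areas_ge {P : Finset Pt} (hP : 2 ≤ P.card) (h1 : ¬ ∃ a, ∀ p ∈ P, p.2 = a)
    (h2 : ¬ ∃ a, ∀ p ∈ P, p.1 = a) :
    1 / 10 ^ 13 * (P.card : ℝ) / Real.log P.card ≤ (areas P).card := by
  push Not at h1 h2
  have hlog := log_two_add_one_le hP
  have hl0 : 1 / 4 ≤ Real.log P.card := by
    have : (0 : ℝ) ≤ Nat.log 2 P.card := Nat.cast_nonneg _
    linarith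
  have hN : (0 : ℝ) < P.card := by
    have : 0 < P.card := by omega
    exact_mod_cast this
  have hR : (0 : ℝ) ≤ (areas P).card := Nat.cast_nonneg _
  rw [div_le_iff₀ (by linarith)]
  have hbig : P.card ≤ 4 * (areas P).card →
      1 / 10 ^ 13 * (P.card : ℝ) ≤ (areas P).card * Real.log P.card := by
    intro h
    have h : (P.card : ℝ) ≤ 4 * (areas P).card := by exact_mod_cast h
    nlinarith
  by_cases hc : ∃ c, P.card < 4 * (col P c).card
  · obtain ⟨c, hc⟩ := hc
    exact hbig (hc.le.trans (Nat.mul_le_mul_left 4 (card_col_le_card_areas (h2 c))))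
  by_cases hr : ∃ c, P.card < 4 * (col (flip P) c).card
  · obtain ⟨c, hr⟩ := hr
    obtain ⟨q, hq, hqc⟩ := h1 c
    have hq' : q.swap ∈ flip P := mem_flip.2 hq
    exact hbig (hr.le.trans (Nat.mul_le_mul_left 4
      ((card_col_le_card_areas ⟨q.swap, hq', hqc⟩).trans (card_areas_flip_le P))))
  push Not at hc hr
  have h3 : (P.card : ℝ) ^ 4 ≤ 4 * ((areas P).card * (equalAreas P P).card) := by
    exact_mod_cast pow_card_le_of_col_le hc hr
  have h4 := card_equalAreas_le P
  have h5 : ((equalAreas P P).card : ℝ) ≤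
      4 * 10 ^ 11 * (P.card : ℝ) ^ 3 * (4 * Real.log P.card) :=
    h4.trans (mul_le_mul_of_nonneg_left hlog (by positivity))
  have h6 := mul_le_mul_of_nonneg_left h5 hR
  have h7 : (P.card : ℝ) ^ 3 * P.card ≤
      (P.card : ℝ) ^ 3 * (64 * 10 ^ 11 * ((areas P).card * Real.log P.card)) := by
    linarith
  have h8 := le_of_mul_le_mul_left h7 (by positivity)
  linarith

end RectAreas

/-- There is an absolute constant c > 0 such that for every finite
set `P ⊆ ℝ²` with `|P| = N ≥ 2` whose points do not all lie on one horizontal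
line nor all on one vertical line, the set `R(P)` of rectangular areas
satisfies `|R(P)| ≥ c·N/log N`. -/
theorem rect_areas_lower_bound :
    ∃ c : ℝ, 0 < c ∧
      ∀ P : Finset (ℝ × ℝ), 2 ≤ P.card →
        (¬ ∃ a : ℝ, ∀ p ∈ P, p.2 = a) →
        (¬ ∃ a : ℝ, ∀ p ∈ P, p.1 = a) →
        (((P ×ˢ P).image (fun pq => rectArea pq.1 pq.2)).card : ℝ) ≥
          c * P.card / Real.log P.card := by
  refine ⟨1 / 10 ^ 13, by positivity, fun P hP h1 h2 => ?_⟩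
  convert RectAreas.card_areas_ge hP h1 h2 using 1
  rw [RectAreas.areas]
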